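/- The minor-obstruction set of the class of apex-pseudoforests consists, up to isomorphism, of exactly the 33 graphs in the list O. That is, a graph G belongs to obs(P1) if and only if G is isomorphic to one of the 33 graphs in O; consequently, a graph is an apex-pseudoforest if and only if it contains none of the 33 graphs in O as a minor. -/

import Mathlib

open SimpleGraph

/-- `H` is a minor of `G` (branch-set definition): there is a family of connected, nonempty,
pairwise disjoint branch sets in `G`, indexed by the vertices of `H`, such that vertices
adjacent in `H` have an edge of `G` between their branch sets. -/
def IsMinorOf {W V : Type} (H : SimpleGraph W) (G : SimpleGraph V) : Prop :=
  ∃ f : W → Set V,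
    (∀ w, (G.induce (f w)).Connected) ∧
    (∀ ⦃w w' : W⦄, w ≠ w' → Disjoint (f w) (f w')) ∧
    (∀ ⦃w w' : W⦄, H.Adj w w' → ∃ a ∈ f w, ∃ b ∈ f w', G.Adj a b)

/-- A pseudoforest: every connected component contains at most one cycle, i.e. any two
cycles lying in the same connected component have the same edge set. -/
def Pseudoforest {V : Type} (G : SimpleGraph V) : Prop :=
  ∀ ⦃u v : V⦄ (c : G.Walk u u) (c' : G.Walk v v),
    c.IsCycle → c'.IsCycle → G.Reachable u v → ∀ e, e ∈ c.edges ↔ e ∈ c'.edges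

/-- An apex-pseudoforest: removing at most one vertex yields a pseudoforest. -/
def ApexPseudoforest {V : Type} (G : SimpleGraph V) : Prop :=
  ∃ s : Set V, s.Subsingleton ∧ Pseudoforest (G.induce sᶜ)

/-- `G` is a minor-obstruction for the class of apex-pseudoforests: `G` is not an
apex-pseudoforest but every proper minor of `G` is. -/
def ObsApexPseudoforest {V : Type} (G : SimpleGraph V) : Prop :=
  ¬ ApexPseudoforest G ∧
    ∀ (W : Type) [Finite W] (H : SimpleGraph W),
      IsMinorOf H G → IsEmpty (H ≃g G) → ApexPseudoforest H

/-- The simple graph on `Fin n` with the given list of (0-indexed) edges. -/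
def mkGraph (n : ℕ) (E : List (ℕ × ℕ)) : SimpleGraph (Fin n) :=
  SimpleGraph.fromRel fun a b => ((a : ℕ), (b : ℕ)) ∈ E

/-- Obstruction 1: two disjoint diamonds. -/
def O1 : SimpleGraph (Fin 8) :=
  mkGraph 8 [(0,1),(0,2),(0,3),(1,2),(1,3),(4,5),(4,6),(4,7),(5,6),(5,7)]
/-- Obstruction 2: two disjoint butterflies. -/
def O2 : SimpleGraph (Fin 10) :=
  mkGraph 10 [(0,1),(0,2),(1,2),(0,3),(0,4),(3,4),(5,6),(5,7),(6,7),(5,8),(5,9),(8,9)]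
/-- Obstruction 3: a diamond plus a butterfly. -/
def O3 : SimpleGraph (Fin 9) :=
  mkGraph 9 [(0,1),(0,2),(0,3),(1,2),(1,3),(4,5),(4,6),(5,6),(4,7),(4,8),(7,8)]
def O4 : SimpleGraph (Fin 8) :=
  mkGraph 8 [(0,1),(0,2),(1,2),(2,3),(2,4),(3,4),(3,5),(4,5),(5,6),(5,7),(6,7)]
def O5 : SimpleGraph (Fin 8) :=
  mkGraph 8 [(0,1),(0,2),(1,2),(2,3),(2,4),(3,4),(3,5),(4,6),(5,6),(5,7),(6,7)]
def O6 : SimpleGraph (Fin 8) :=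
  mkGraph 8 [(0,1),(0,2),(1,2),(2,3),(2,4),(3,4),(3,5),(4,5),(3,6),(5,6),(4,7),(5,7)]
def O7 : SimpleGraph (Fin 7) :=
  mkGraph 7 [(0,1),(0,6),(1,6),(2,3),(2,4),(2,5),(3,4),(3,5),(4,6),(5,6)]
def O8 : SimpleGraph (Fin 7) :=
  mkGraph 7 [(0,1),(0,2),(1,2),(2,3),(2,4),(2,5),(3,4),(3,5),(4,5),(4,6),(5,6)]
def O9 : SimpleGraph (Fin 9) :=
  mkGraph 9 [(0,1),(0,2),(1,2),(2,3),(2,4),(3,4),(3,5),(4,5),(2,6),(4,6),(2,7),(3,7),(3,8),(4,8)]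
def O10 : SimpleGraph (Fin 9) :=
  mkGraph 9 [(0,1),(1,2),(2,3),(3,0),(0,4),(1,4),(1,5),(2,5),(2,6),(3,6),(0,7),(0,8),(7,8)]
def O11 : SimpleGraph (Fin 9) :=
  mkGraph 9 [(0,1),(0,2),(1,2),(3,4),(3,5),(4,5),(6,7),(6,8),(7,8),(2,3),(1,8),(4,8)]
def O12 : SimpleGraph (Fin 9) :=
  mkGraph 9 [(0,1),(0,2),(1,2),(3,4),(3,5),(4,5),(6,7),(6,8),(7,8),(2,3),(2,7),(3,6)]
def O13 : SimpleGraph (Fin 9) :=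
  mkGraph 9 [(0,1),(0,2),(1,2),(3,4),(3,5),(4,5),(6,7),(6,8),(7,8),(2,3),(2,8),(3,8)]
def O14 : SimpleGraph (Fin 8) :=
  mkGraph 8 [(0,1),(0,2),(1,2),(1,4),(2,3),(2,4),(3,4),(3,5),(4,5),(1,6),(1,7),(6,7)]
def O15 : SimpleGraph (Fin 9) :=
  mkGraph 9 [(0,1),(0,2),(1,2),(2,3),(2,4),(3,4),(4,5),(4,6),(5,6),(6,7),(6,8),(7,8),(2,6)]
def O16 : SimpleGraph (Fin 6) :=
  mkGraph 6 [(0,2),(0,3),(0,4),(0,5),(1,2),(1,3),(1,4),(1,5),(2,3),(4,5)]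
def O17 : SimpleGraph (Fin 6) :=
  mkGraph 6 [(0,1),(1,3),(3,2),(2,0),(4,0),(4,1),(4,2),(4,3),(5,0),(5,1)]
def O18 : SimpleGraph (Fin 8) :=
  mkGraph 8 [(0,1),(1,2),(2,3),(3,0),(4,0),(4,1),(5,1),(5,2),(6,2),(6,3),(7,3),(7,0)]
def O19 : SimpleGraph (Fin 7) :=
  mkGraph 7 [(0,2),(0,3),(1,2),(1,3),(2,3),(0,4),(4,1),(5,0),(5,4),(6,4),(6,1)]
def O20 : SimpleGraph (Fin 6) :=
  mkGraph 6 [(1,2),(1,4),(1,5),(2,4),(2,5),(4,5),(0,1),(0,4),(2,3),(3,5)]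
def O21 : SimpleGraph (Fin 7) :=
  mkGraph 7 [(0,1),(0,3),(0,4),(1,3),(1,4),(3,5),(4,5),(1,2),(2,4),(3,6),(5,6)]
def O22 : SimpleGraph (Fin 8) :=
  mkGraph 8 [(0,1),(0,3),(1,4),(3,4),(1,2),(2,4),(7,0),(7,3),(5,7),(5,0),(6,7),(6,3)]
def O23 : SimpleGraph (Fin 7) :=
  mkGraph 7 [(2,3),(2,4),(2,6),(3,4),(3,6),(4,6),(5,3),(5,4),(0,2),(0,3),(1,2),(1,4)]
def O24 : SimpleGraph (Fin 7) :=
  mkGraph 7 [(0,1),(0,2),(1,2),(1,3),(2,4),(3,5),(3,6),(4,5),(4,6),(5,6)]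
def O25 : SimpleGraph (Fin 8) :=
  mkGraph 8 [(0,1),(0,3),(1,3),(1,2),(1,5),(2,5),(1,7),(2,7),(3,4),(4,5),(3,5),(3,6),(5,6)]
def O26 : SimpleGraph (Fin 9) :=
  mkGraph 9 [(2,3),(2,4),(3,4),(5,3),(5,4),(8,3),(8,4),(0,2),(0,3),(7,2),(7,3),(1,2),(1,4),(6,2),(6,4)]
def O27 : SimpleGraph (Fin 8) :=
  mkGraph 8 [(0,2),(1,2),(0,3),(2,3),(1,6),(2,6),(3,4),(6,7),(4,5),(5,7),(3,7),(4,7)]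
def O28 : SimpleGraph (Fin 7) :=
  mkGraph 7 [(0,1),(0,2),(1,2),(1,3),(1,5),(3,5),(3,4),(3,6),(4,6),(2,5),(5,6)]
def O29 : SimpleGraph (Fin 9) :=
  mkGraph 9 [(0,1),(0,2),(1,2),(3,4),(3,5),(4,5),(6,7),(6,8),(7,8),(2,3),(1,7),(4,6)]
def O30 : SimpleGraph (Fin 8) :=
  mkGraph 8 [(0,1),(0,2),(1,2),(3,4),(3,5),(4,5),(6,7),(1,6),(4,6),(0,7),(5,7)]
/-- Obstruction 31: the prism. -/
def O31 : SimpleGraph (Fin 6) :=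
  mkGraph 6 [(0,1),(0,2),(1,2),(3,4),(3,5),(4,5),(0,3),(1,4),(2,5)]
/-- Obstruction 32: `K₃,₃`. -/
def O32 : SimpleGraph (Fin 6) :=
  mkGraph 6 [(0,3),(0,4),(0,5),(1,3),(1,4),(1,5),(2,3),(2,4),(2,5)]
/-- Obstruction 33: `K₅` minus one edge. -/
def O33 : SimpleGraph (Fin 5) :=
  mkGraph 5 [(0,1),(0,2),(0,3),(0,4),(1,2),(1,3),(1,4),(2,3),(2,4)]

/-- The list `O` of the 33 obstructions. -/
def OList : List ((n : ℕ) × SimpleGraph (Fin n)) :=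
  [⟨8, O1⟩, ⟨10, O2⟩, ⟨9, O3⟩, ⟨8, O4⟩, ⟨8, O5⟩, ⟨8, O6⟩, ⟨7, O7⟩, ⟨7, O8⟩, ⟨9, O9⟩,
   ⟨9, O10⟩, ⟨9, O11⟩, ⟨9, O12⟩, ⟨9, O13⟩, ⟨8, O14⟩, ⟨9, O15⟩, ⟨6, O16⟩, ⟨6, O17⟩,
   ⟨8, O18⟩, ⟨7, O19⟩, ⟨6, O20⟩, ⟨7, O21⟩, ⟨8, O22⟩, ⟨7, O23⟩, ⟨7, O24⟩, ⟨8, O25⟩,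
   ⟨9, O26⟩, ⟨8, O27⟩, ⟨7, O28⟩, ⟨9, O29⟩, ⟨8, O30⟩, ⟨6, O31⟩, ⟨6, O32⟩, ⟨5, O33⟩]

/-- `G` is isomorphic to one of the 33 graphs in `O`. -/
def InO {V : Type} (G : SimpleGraph V) : Prop :=
  ∃ H ∈ OList, Nonempty (G ≃g H.2)

namespace ApexObstruction

open Finset

section Counting

open scoped Classical

variable {V : Type} (G : SimpleGraph V)

/-- The number of ordered pairs of adjacent vertices in `A ×ˢ B`. -/
noncomputable def cross (A B : Finset V) : ℕ :=
  ∑ a ∈ A, ∑ b ∈ B, if G.Adj a b then 1 else 0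

/-- `Z` spans more edges than it has vertices. -/
def Bad (Z : Finset V) : Prop := 2 * #Z < cross G Z Z

variable {G}

lemma cross_comm (A B : Finset V) : cross G A B = cross G B A := by
  unfold cross
  rw [Finset.sum_comm]
  simp_rw [G.adj_comm]

lemma cross_union_left {A B : Finset V} (h : Disjoint A B) (C : Finset V) :
    cross G (A ∪ B) C = cross G A C + cross G B C :=
  Finset.sum_union h

lemma cross_union_right {A B : Finset V} (h : Disjoint A B) (C : Finset V) :
    cross G C (A ∪ B) = cross G C A + cross G C B := by
  rw [cross_comm, cross_union_left h, cross_comm A, cross_comm B]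

lemma cross_union_self {A B : Finset V} (h : Disjoint A B) :
    cross G (A ∪ B) (A ∪ B) = cross G A A + 2 * cross G A B + cross G B B := by
  rw [cross_union_left h, cross_union_right h, cross_union_right h, cross_comm B A]
  ring

lemma cross_biUnion_left {ι : Type} {Y : Finset ι} {f : ι → Finset V}
    (h : (Y : Set ι).PairwiseDisjoint f) (C : Finset V) :
    cross G (Y.biUnion f) C = ∑ i ∈ Y, cross G (f i) C :=
  Finset.sum_biUnion h

lemma cross_biUnion {ι : Type} {Y : Finset ι} {f : ι → Finset V}
    (h : (Y : Set ι).PairwiseDisjoint f) :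
    cross G (Y.biUnion f) (Y.biUnion f) = ∑ i ∈ Y, ∑ j ∈ Y, cross G (f i) (f j) := by
  rw [cross_biUnion_left h]
  refine Finset.sum_congr rfl fun i _ => ?_
  rw [cross_comm, cross_biUnion_left h]
  exact Finset.sum_congr rfl fun j _ => cross_comm _ _

lemma cross_mono {A A' B B' : Finset V} (hA : A ⊆ A') (hB : B ⊆ B') :
    cross G A B ≤ cross G A' B' :=
  (Finset.sum_le_sum_of_subset hA).trans
    (Finset.sum_le_sum fun _ _ => Finset.sum_le_sum_of_subset hB)

lemma cross_pos_iff {A B : Finset V} : 0 < cross G A B ↔ ∃ a ∈ A, ∃ b ∈ B, G.Adj a b := by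
  simp [cross, Finset.sum_pos_iff, Finset.filter_nonempty_iff]

lemma cross_singleton (a : V) : cross G {a} {a} = 0 := by simp [cross]

lemma cross_map {W : Type} {H : SimpleGraph W} (f : H ↪g G) (A B : Finset W) :
    cross G (A.map f.toEmbedding) (B.map f.toEmbedding) = cross H A B := by
  simp only [cross, Finset.sum_map, RelEmbedding.coe_toEmbedding, f.map_adj_iff]

lemma cross_univ [Fintype V] : cross G univ univ = 2 * Nat.card G.edgeSet := by
  rw [Nat.card_eq_fintype_card, ← SimpleGraph.edgeFinset_card,
    ← SimpleGraph.sum_degrees_eq_twice_card_edges]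
  simp only [cross]
  refine Finset.sum_congr rfl fun a _ => ?_
  rw [← SimpleGraph.card_neighborFinset_eq_degree, Finset.card_eq_sum_ones, ← Finset.sum_filter]
  congr 1
  ext; simp

lemma cross_induce (Z : Finset V) :
    cross G Z Z = 2 * Nat.card (G.induce (Z : Set V)).edgeSet := by
  rw [← cross_univ, ← cross_map (SimpleGraph.Embedding.induce (Z : Set V))]
  congr 1 <;> (ext; simp)

/-- The edges inside a connected set number at least its size minus one. -/
lemma two_mul_card_le_of_connected {Z : Finset V} (h : (G.induce (Z : Set V)).Connected) :
    2 * #Z ≤ cross G Z Z + 2 := by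
  have := h.card_vert_le_card_edgeSet_add_one
  rw [cross_induce]
  simp only [Finset.coe_sort_coe, Nat.card_eq_fintype_card, Fintype.card_coe] at this ⊢
  omega

lemma card_edgeSet_deleteEdges [Finite V] {e : Sym2 V} (he : e ∈ G.edgeSet) :
    Nat.card (G.deleteEdges {e}).edgeSet + 1 = Nat.card G.edgeSet := by
  have := Fintype.ofFinite V
  rw [SimpleGraph.edgeSet_deleteEdges, Nat.card_coe_set_eq, Nat.card_coe_set_eq]
  exact Set.ncard_sdiff_singleton_add_one he

/-- In a connected graph, two cycles with different edge sets force more edges than vertices. -/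
lemma card_lt_card_edgeSet_of_cycles [Finite V] (hG : G.Connected) {u v : V}
    {c : G.Walk u u} {c' : G.Walk v v} (hc : c.IsCycle) (hc' : c'.IsCycle) {e : Sym2 V}
    (he : e ∈ c.edges) (he' : e ∉ c'.edges) : Nat.card V < Nat.card G.edgeSet := by
  have heG := c.edges_subset_edgeSet he
  have hb : ¬ G.IsBridge e := fun hb => hb.notMem_edges_of_isCycle hc he
  obtain ⟨x, y⟩ := e
  have hG₁ := hG.connected_delete_edge_of_not_isBridge hb
  have hce : ∀ f ∈ c'.edges, f ∉ ({s(x, y)} : Set (Sym2 V)) := by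
    rintro f hf rfl; exact he' hf
  have hc₁ : (c'.toDeleteEdges _ hce).IsCycle := hc'.toDeleteEdges _ _ hce
  obtain ⟨f, hf⟩ := List.exists_mem_of_ne_nil _
    (mt SimpleGraph.Walk.edges_eq_nil.1 hc₁.not_nil)
  have hfG := (c'.toDeleteEdges _ hce).edges_subset_edgeSet hf
  have hb' : ¬ (G.deleteEdges {s(x, y)}).IsBridge f := fun hb => hb.notMem_edges_of_isCycle hc₁ hf
  have h₂ := card_edgeSet_deleteEdges hfG
  obtain ⟨z, w⟩ := f
  have := (hG₁.connected_delete_edge_of_not_isBridge hb').card_vert_le_card_edgeSet_add_one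
  have h₁ := card_edgeSet_deleteEdges heG
  change Nat.card (G.deleteEdges {s(x, y)}).edgeSet + 1 = _ at h₁
  change Nat.card ((G.deleteEdges {s(x, y)}).deleteEdges {s(z, w)}).edgeSet + 1 = _ at h₂
  omega

/-- A connected graph with more edges than vertices has two different cycles. -/
lemma exists_cycles_of_card_lt [Finite V] (hG : G.Connected) (h : Nat.card V < Nat.card G.edgeSet) :
    ∃ (u v : V) (c : G.Walk u u) (c' : G.Walk v v), c.IsCycle ∧ c'.IsCycle ∧
      ∃ e ∈ c.edges, e ∉ c'.edges := by
  have key : ∀ (H : SimpleGraph V), H.Connected → Nat.card V ≤ Nat.card H.edgeSet →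
      ∃ (u : V) (c : H.Walk u u), c.IsCycle := by
    intro H hH hle
    by_contra! hno
    have := (SimpleGraph.isTree_iff_connected_and_card.1 ⟨hH, fun u c => hno u c⟩).2
    omega
  obtain ⟨u, c, hc⟩ := key G hG h.le
  obtain ⟨e, he⟩ := List.exists_mem_of_ne_nil _ (mt SimpleGraph.Walk.edges_eq_nil.1 hc.not_nil)
  have heG := c.edges_subset_edgeSet he
  have hb : ¬ G.IsBridge e := fun hb => hb.notMem_edges_of_isCycle hc he
  have h₁ := card_edgeSet_deleteEdges heG
  obtain ⟨x, y⟩ := e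
  change Nat.card (G.deleteEdges {s(x, y)}).edgeSet + 1 = _ at h₁
  obtain ⟨v, c', hc'⟩ := key _ (hG.connected_delete_edge_of_not_isBridge hb) (by omega)
  refine ⟨u, v, c, c'.mapLe (SimpleGraph.deleteEdges_le _), hc, hc'.mapLe _, _, he, fun hmem => ?_⟩
  rw [SimpleGraph.Walk.edges_mapLe_eq_edges] at hmem
  simpa using c'.edges_subset_edgeSet hmem

lemma pseudoforest_iff [Finite V] : Pseudoforest G ↔ ∀ Z : Finset V, ¬ Bad G Z := by
  constructor
  · intro hG Z
    induction Z using Finset.strongInduction with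
    | H Z ih =>
      intro hZ
      have hne : Z.Nonempty := by
        rw [Finset.nonempty_iff_ne_empty]
        rintro rfl
        simp [Bad, cross] at hZ
      obtain ⟨z, hz⟩ := hne
      have hcon : (G.induce (Z : Set V)).Connected := by
        rw [SimpleGraph.connected_iff_exists_forall_reachable]
        refine ⟨⟨z, hz⟩, ?_⟩
        set K := G.induce (Z : Set V) with hK
        by_contra! hno
        obtain ⟨w, hw⟩ := hno
        let A : Finset V := Z.filter fun x => ∃ hx : x ∈ Z, K.Reachable ⟨z, hz⟩ ⟨x, hx⟩
        have hA : ¬ Bad G A := ih A <| by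
          refine Finset.filter_ssubset.2 ⟨w, w.2, ?_⟩
          rintro ⟨_, h⟩
          exact hw h
        have hB : ¬ Bad G (Z \ A) := ih _ <|
          Finset.sdiff_ssubset (Finset.filter_subset _ _)
            ⟨z, by simp only [A, Finset.mem_filter]; exact ⟨hz, hz, .refl _⟩⟩
        have h0 : cross G A (Z \ A) = 0 := by
          rw [← Nat.le_zero, ← Nat.not_lt, cross_pos_iff]
          rintro ⟨a, ha, b, hb, hab⟩
          simp only [A, Finset.mem_filter, Finset.mem_sdiff] at ha hb
          obtain ⟨haZ, _, har⟩ := ha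
          refine hb.2 ⟨hb.1, hb.1, har.trans (SimpleGraph.Adj.reachable ?_)⟩
          simpa [hK] using hab
        have hAZ : A ⊆ Z := Finset.filter_subset _ _
        have h1 := cross_union_self (G := G) (Finset.disjoint_sdiff (s := A) (t := Z))
        have h2 := Finset.card_sdiff_add_card_eq_card hAZ
        rw [Finset.union_sdiff_of_subset hAZ] at h1
        unfold Bad at *
        omega
      have hlt : Nat.card (Z : Set V) < Nat.card (G.induce (Z : Set V)).edgeSet := by
        have := cross_induce (G := G) Z
        simp only [Bad, Finset.coe_sort_coe, Nat.card_eq_fintype_card, Fintype.card_coe] at *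
        omega
      obtain ⟨u, v, c, c', hc, hc', e, he, he'⟩ := exists_cycles_of_card_lt hcon hlt
      let f := SimpleGraph.Embedding.induce (G := G) (Z : Set V)
      have := hG (c.map f.toHom) (c'.map f.toHom) (hc.map f.injective) (hc'.map f.injective)
        ((hcon.preconnected u v).map f.toHom) (e.map f)
      simp only [SimpleGraph.Walk.edges_map] at this
      obtain ⟨e', h1, h2⟩ := List.mem_map.1 (this.1 (List.mem_map.2 ⟨e, he, rfl⟩))
      exact he' (Sym2.map.injective f.injective h2 ▸ h1)
  · intro hG
    have key : ∀ ⦃u v : V⦄ (c : G.Walk u u) (c' : G.Walk v v), c.IsCycle → c'.IsCycle →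
        G.Reachable u v → ∀ e ∈ c.edges, e ∈ c'.edges := by
      intro u v c c' hc hc' huv e he
      by_contra he'
      have := Fintype.ofFinite V
      set Z : Set V := (G.connectedComponentMk u).supp with hZ
      have hcs : ∀ x ∈ c.support, x ∈ Z := fun x hx =>
        SimpleGraph.ConnectedComponent.sound (c.takeUntil x hx).reachable.symm
      have hcs' : ∀ x ∈ c'.support, x ∈ Z := fun x hx =>
        SimpleGraph.ConnectedComponent.sound
          (huv.trans (c'.takeUntil x hx).reachable).symm
      have hcon : (G.induce Z).Connected := (G.connectedComponentMk u).connected_toSimpleGraph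
      let f := SimpleGraph.Embedding.induce (G := G) Z
      have hm : (c.induce Z hcs).map f.toHom = c := c.map_induce hcs
      have hm' : (c'.induce Z hcs').map f.toHom = c' := c'.map_induce hcs'
      have h1 : (c.induce Z hcs).IsCycle := by
        rw [← SimpleGraph.Walk.isCycle_map_iff_of_injective (f := f.toHom) f.injective, hm]
        exact hc
      have h1' : (c'.induce Z hcs').IsCycle := by
        rw [← SimpleGraph.Walk.isCycle_map_iff_of_injective (f := f.toHom) f.injective, hm']
        exact hc'
      have he₁ : (c.induce Z hcs).edges.map (Sym2.map f.toHom) = c.edges :=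
        (SimpleGraph.Walk.edges_map _ _).symm.trans (congrArg _ hm)
      have he₁' : (c'.induce Z hcs').edges.map (Sym2.map f.toHom) = c'.edges :=
        (SimpleGraph.Walk.edges_map _ _).symm.trans (congrArg _ hm')
      rw [← he₁] at he
      obtain ⟨e₀, he₀, rfl⟩ := List.mem_map.1 he
      have he₀' : e₀ ∉ (c'.induce Z hcs').edges := fun h => he' <| by
        rw [← he₁']
        exact List.mem_map_of_mem h
      have hlt := card_lt_card_edgeSet_of_cycles hcon h1 h1' he₀ he₀'
      refine hG Z.toFinset ?_
      rw [Bad, cross_induce, Set.coe_toFinset, Set.toFinset_card, ← Nat.card_eq_fintype_card]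
      omega
    intro u v c c' hc hc' huv e
    exact ⟨key c c' hc hc' huv e, key c' c hc' hc huv.symm e⟩

lemma apexPseudoforest_iff [Finite V] :
    ApexPseudoforest G ↔
      ∃ s : Set V, s.Subsingleton ∧ ∀ Z : Finset V, Disjoint (Z : Set V) s → ¬ Bad G Z := by
  refine exists_congr fun s => and_congr_right fun _ => ?_
  rw [pseudoforest_iff]
  let f := SimpleGraph.Embedding.induce (G := G) sᶜ
  have hf : ∀ Z : Finset (sᶜ : Set V), Bad G (Z.map f.toEmbedding) ↔ Bad (G.induce sᶜ) Z := by
    intro Z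
    rw [Bad, Bad, cross_map f, Finset.card_map]
  constructor
  · intro h Z hZ hbad
    refine h (Z.subtype (· ∈ sᶜ)) ((hf _).1 ?_)
    convert hbad
    exact Finset.subtype_map_of_mem fun x hx => Set.disjoint_left.1 hZ hx
  · intro h Z hbad
    refine h _ ?_ ((hf Z).2 hbad)
    rw [Set.disjoint_left]
    intro x hx
    obtain ⟨y, _, rfl⟩ := Finset.mem_map.1 (Finset.mem_coe.1 hx)
    exact y.2

end Counting

section Minors

open scoped Classical

variable {V W : Type} {G : SimpleGraph V} {H : SimpleGraph W}

/-- The class of apex-pseudoforests is closed under minors. -/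
theorem ApexPseudoforest.of_isMinorOf [Finite V] [Finite W] (hHG : IsMinorOf H G)
    (hG : ApexPseudoforest G) : ApexPseudoforest H := by
  have := Fintype.ofFinite V
  obtain ⟨f, hcon, hdisj, hadj⟩ := hHG
  rw [apexPseudoforest_iff] at hG ⊢
  obtain ⟨s, hs, hbad⟩ := hG
  refine ⟨{w | ∃ v ∈ s, v ∈ f w}, ?_, ?_⟩
  · rintro w ⟨v, hv, hvw⟩ w' ⟨v', hv', hvw'⟩
    obtain rfl := hs hv hv'
    by_contra hne
    exact Set.disjoint_left.1 (hdisj hne) hvw hvw'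
  · intro Z hZ hZbad
    let g : W → Finset V := fun w => (f w).toFinset
    have hg : ∀ w, (g w : Set V) = f w := fun w => Set.coe_toFinset _
    have hgd : (Z : Set W).PairwiseDisjoint g := by
      intro i _ j _ hij
      rw [Function.onFun, ← Finset.disjoint_coe, hg, hg]
      exact hdisj hij
    refine hbad (Z.biUnion g) ?_ ?_
    · rw [Set.disjoint_left]
      intro v hv hvs
      obtain ⟨w, hw, hvw⟩ := Finset.mem_biUnion.1 (Finset.mem_coe.1 hv)
      refine Set.disjoint_left.1 hZ hw ⟨v, hvs, ?_⟩
      rwa [← hg]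
    · have key : ∀ i ∈ Z, (∑ j ∈ Z, if H.Adj i j then 1 else 0) + 2 * #(g i) ≤
          (∑ j ∈ Z, cross G (g i) (g j)) + 2 := by
        intro i hi
        have hcon' : (G.induce (g i : Set V)).Connected := by rw [hg]; exact hcon i
        have h1 := two_mul_card_le_of_connected hcon'
        have h2 : (∑ j ∈ Z.erase i, if H.Adj i j then 1 else 0) ≤
            ∑ j ∈ Z.erase i, cross G (g i) (g j) := by
          refine Finset.sum_le_sum fun j _ => ?_
          split_ifs with hij
          · rw [Nat.succ_le_iff, cross_pos_iff]
            simpa [g] using hadj hij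
          · exact Nat.zero_le _
        rw [← Finset.add_sum_erase _ _ hi, ← Finset.add_sum_erase _ (fun j => cross G _ _) hi]
        simp only [SimpleGraph.irrefl, if_false]
        omega
      have hsum := Finset.sum_le_sum key
      simp only [Finset.sum_add_distrib, ← Finset.mul_sum, Finset.sum_const, smul_eq_mul] at hsum
      rw [Bad, cross_biUnion hgd, Finset.card_biUnion hgd]
      simp only [Bad, cross] at hZbad
      omega

lemma induce_singleton_connected (v : V) : (G.induce {v}).Connected :=
  have : Nonempty ({v} : Set V) := ⟨⟨v, rfl⟩⟩
  .of_subsingleton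

lemma IsMinorOf.of_iso {V' : Type} {G' : SimpleGraph V'} (h : IsMinorOf H G) (e : G ≃g G') :
    IsMinorOf H G' := by
  obtain ⟨f, hcon, hdisj, hadj⟩ := h
  refine ⟨fun w => e '' f w, fun w => ?_, fun w w' hne => ?_, fun w w' hw => ?_⟩
  · exact (e.induce (e.injective.injOn.bijOn_image)).connected_iff.1 (hcon w)
  · exact (Set.disjoint_image_iff e.injective).2 (hdisj hne)
  · obtain ⟨a, ha, b, hb, hab⟩ := hadj hw
    exact ⟨e a, ⟨a, ha, rfl⟩, e b, ⟨b, hb, rfl⟩, e.map_adj_iff.2 hab⟩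

lemma isMinorOf_of_iso (e : H ≃g G) : IsMinorOf H G := by
  refine ⟨fun w => {e w}, fun w => ?_, fun w w' hne => ?_, fun w w' hw => ?_⟩
  · exact induce_singleton_connected _
  · simpa using hne
  · exact ⟨_, rfl, _, rfl, e.map_adj_iff.2 hw⟩

lemma ApexPseudoforest.of_iso [Finite V] [Finite W] (e : H ≃g G) (hG : ApexPseudoforest G) :
    ApexPseudoforest H :=
  ApexPseudoforest.of_isMinorOf (isMinorOf_of_iso e) hG

lemma ObsApexPseudoforest.of_iso [Finite V] [Finite W] (e : H ≃g G)
    (hG : ObsApexPseudoforest G) : ObsApexPseudoforest H := by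
  refine ⟨fun h => hG.1 (ApexPseudoforest.of_iso e.symm h), fun U _ K hK hne => ?_⟩
  exact hG.2 U K (IsMinorOf.of_iso hK e) ⟨fun e' => hne.false (e'.trans e.symm)⟩

/-- If a map collapses edges to edges or points and keeps the branch sets of a minor apart,
then it carries the minor along. -/
lemma IsMinorOf.of_collapse {V' : Type} {G' : SimpleGraph V'} (g : V → V')
    (hg : ∀ ⦃x y⦄, G.Adj x y → g x = g y ∨ G'.Adj (g x) (g y)) {f : W → Set V}
    (hcon : ∀ w, (G.induce (f w)).Connected)
    (hdisj : ∀ ⦃w w'⦄, w ≠ w' → ∀ x ∈ f w, ∀ y ∈ f w', g x ≠ g y)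
    (hadj : ∀ ⦃w w'⦄, H.Adj w w' → ∃ a ∈ f w, ∃ b ∈ f w', G.Adj a b) : IsMinorOf H G' := by
  refine ⟨fun w => g '' f w, fun w => ?_, fun w w' hne => ?_, fun w w' hw => ?_⟩
  · have hr : ∀ x y : f w, (G.induce (f w)).Reachable x y →
        (G'.induce (g '' f w)).Reachable ⟨g x, x, x.2, rfl⟩ ⟨g y, y, y.2, rfl⟩ := by
      rintro x y ⟨p⟩
      induction p with
      | nil => exact .refl _
      | cons h p ih =>
        refine SimpleGraph.Reachable.trans ?_ ih
        rcases hg (SimpleGraph.comap_adj.1 h) with h' | h'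
        · have : ∀ {z z' : g '' f w}, z = z' → (G'.induce (g '' f w)).Reachable z z' := by
            rintro z _ rfl; exact .refl _
          exact this (Subtype.ext h')
        · exact SimpleGraph.Adj.reachable (SimpleGraph.comap_adj.2 h')
    rw [SimpleGraph.connected_iff]
    refine ⟨?_, ?_⟩
    · rintro ⟨_, x, hx, rfl⟩ ⟨_, y, hy, rfl⟩
      exact hr ⟨x, hx⟩ ⟨y, hy⟩ ((hcon w).preconnected _ _)
    · obtain ⟨x⟩ := (hcon w).nonempty
      exact ⟨⟨g x, x, x.2, rfl⟩⟩
  · rw [Set.disjoint_left]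
    rintro _ ⟨x, hx, rfl⟩ ⟨y, hy, hxy⟩
    exact hdisj hne x hx y hy hxy.symm
  · obtain ⟨a, ha, b, hb, hab⟩ := hadj hw
    refine ⟨_, ⟨a, ha, rfl⟩, _, ⟨b, hb, rfl⟩, (hg hab).resolve_left ?_⟩
    exact hdisj hw.ne a ha b hb

end Minors

section Lists

lemma mkGraph_adj {n : ℕ} {E : List (ℕ × ℕ)} {a b : Fin n} :
    (mkGraph n E).Adj a b ↔ a ≠ b ∧ (((a : ℕ), (b : ℕ)) ∈ E ∨ ((b : ℕ), (a : ℕ)) ∈ E) :=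
  SimpleGraph.fromRel_adj _ _ _

/-- The `i`-th hexadecimal digit of `c`. -/
def digit (c i : ℕ) : ℕ := c / 16 ^ i % 16

/-- `∑ i < n, f i`. -/
def sumTo (f : ℕ → ℕ) : ℕ → ℕ
  | 0 => 0
  | n + 1 => sumTo f n + f n

lemma sumTo_eq (f : ℕ → ℕ) (n : ℕ) : sumTo f n = ∑ i ∈ range n, f i := by
  induction n with
  | zero => rfl
  | succ n ih => rw [sumTo, ih, Finset.sum_range_succ]

/-- `∀ i < n, p i`. -/
def allTo (p : ℕ → Bool) : ℕ → Bool
  | 0 => true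
  | n + 1 => allTo p n && p n

lemma allTo_iff {p : ℕ → Bool} {n : ℕ} : allTo p n = true ↔ ∀ i < n, p i = true := by
  induction n with
  | zero => simp [allTo]
  | succ n ih =>
    rw [allTo, Bool.and_eq_true, ih]
    exact ⟨fun h i hi => (Nat.lt_succ_iff_lt_or_eq.1 hi).elim (h.1 i) (· ▸ h.2),
      fun h => ⟨fun i hi => h i (hi.trans n.lt_succ_self), h n n.lt_succ_self⟩⟩

/-- `∃ i < n, p i`. -/
def anyTo (p : ℕ → Bool) : ℕ → Bool
  | 0 => false
  | n + 1 => anyTo p n || p n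

lemma anyTo_iff {p : ℕ → Bool} {n : ℕ} : anyTo p n = true ↔ ∃ i < n, p i = true := by
  induction n with
  | zero => simp [anyTo]
  | succ n ih =>
    rw [anyTo, Bool.or_eq_true, ih]
    constructor
    · rintro (⟨i, hi, h⟩ | h)
      exacts [⟨i, hi.trans n.lt_succ_self, h⟩, ⟨n, n.lt_succ_self, h⟩]
    · rintro ⟨i, hi, h⟩
      rcases Nat.lt_succ_iff_lt_or_eq.1 hi with hi | rfl
      exacts [.inl ⟨i, hi, h⟩, .inr h]

/-- Apart from the edges at the vertex `digit c 0`, each edge of `E` joins some `x` to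
`digit c (x + 1)`. -/
def apexCheck (E : List (ℕ × ℕ)) (c : ℕ) : Bool :=
  E.all fun e => e.1 == e.2 || e.1 == digit c 0 || e.2 == digit c 0 ||
    digit c (e.1 + 1) == e.2 || digit c (e.2 + 1) == e.1

lemma apexPseudoforest_of_check {n : ℕ} {E : List (ℕ × ℕ)} {c : ℕ} (h : apexCheck E c = true) :
    ApexPseudoforest (mkGraph n E) := by
  classical
  rw [apexPseudoforest_iff]
  refine ⟨{x | (x : ℕ) = digit c 0}, fun x hx y hy => Fin.ext (hx.trans hy.symm), fun Z hZ => ?_⟩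
  let φ : ℕ → ℕ := fun x => digit c (x + 1)
  have hadj : ∀ a ∈ Z, ∀ b ∈ Z, (mkGraph n E).Adj a b → φ a = b ∨ φ b = a := by
    intro a ha b hb hab
    have ha' : (a : ℕ) ≠ digit c 0 := fun h => Set.disjoint_left.1 hZ ha h
    have hb' : (b : ℕ) ≠ digit c 0 := fun h => Set.disjoint_left.1 hZ hb h
    obtain ⟨hne, hE⟩ := mkGraph_adj.1 hab
    have hne' : (a : ℕ) ≠ b := fun h => hne (Fin.ext h)
    simp only [apexCheck, List.all_eq_true, Bool.or_eq_true, beq_iff_eq] at h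
    rcases hE with hE | hE
    · have := h _ hE
      simp only [φ]
      tauto
    · have := h _ hE
      simp only [φ]
      have := hne'.symm
      tauto
  have hcount : ∀ a : Fin n, (∑ b ∈ Z, if φ a = b then 1 else 0) ≤ 1 := by
    intro a
    rw [← Finset.sum_filter, ← Finset.card_eq_sum_ones, Finset.card_le_one]
    simp only [Finset.mem_filter]
    rintro x ⟨_, hx⟩ y ⟨_, hy⟩
    exact Fin.ext (hx.symm.trans hy)
  have h1 : cross (mkGraph n E) Z Z ≤
      ∑ a ∈ Z, ∑ b ∈ Z, ((if φ a = b then 1 else 0) + if φ b = a then 1 else 0) := by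
    refine Finset.sum_le_sum fun a ha => Finset.sum_le_sum fun b hb => ?_
    split_ifs <;> simp_all
    have := hadj a ha b hb ‹_›
    tauto
  simp only [Finset.sum_add_distrib] at h1
  rw [Finset.sum_comm (f := fun (a b : Fin n) => if φ b = a then 1 else 0)] at h1
  have h2 := Finset.sum_le_sum fun a (_ : a ∈ Z) => hcount a
  simp only [Finset.sum_const, smul_eq_mul, mul_one] at h2
  rw [Bad]
  omega

/-- Adjacency in `mkGraph n E`. -/
def listAdj (E : List (ℕ × ℕ)) (a b : ℕ) : Bool :=
  !(a == b) && E.any fun e => (e.1 == a && e.2 == b) || (e.1 == b && e.2 == a)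

lemma listAdj_iff {n : ℕ} {E : List (ℕ × ℕ)} {a b : Fin n} :
    listAdj E a b = true ↔ (mkGraph n E).Adj a b := by
  rw [mkGraph_adj, listAdj]
  simp only [Bool.and_eq_true, Bool.not_eq_true', beq_eq_false_iff_ne, List.any_eq_true,
    Bool.or_eq_true, beq_iff_eq, ne_eq, Fin.ext_iff]
  refine and_congr_right fun _ => ?_
  constructor
  · rintro ⟨⟨x, y⟩, he, ⟨rfl, rfl⟩ | ⟨rfl, rfl⟩⟩
    exacts [.inl he, .inr he]
  · rintro (he | he)
    exacts [⟨_, he, .inl ⟨rfl, rfl⟩⟩, ⟨_, he, .inr ⟨rfl, rfl⟩⟩]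

/-- The set of vertices given by the bits of `m` spans more edges than it has vertices. -/
def badCheck (n : ℕ) (E : List (ℕ × ℕ)) (m : ℕ) : Bool :=
  Nat.blt (2 * sumTo (fun a => bif m.testBit a then 1 else 0) n)
    (sumTo (fun a => bif m.testBit a then
      sumTo (fun b => bif m.testBit b && listAdj E a b then 1 else 0) n else 0) n)

lemma bad_of_check {n : ℕ} {E : List (ℕ × ℕ)} {m : ℕ} (h : badCheck n E m = true) :
    Bad (mkGraph n E) (univ.filter fun a : Fin n => m.testBit a = true) := by
  classical
  simp only [badCheck, Nat.blt_eq, sumTo_eq, Finset.sum_range] at h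
  simp only [Bad, cross, Finset.sum_filter, Finset.card_eq_sum_ones, ← listAdj_iff]
  convert h using 3 with a _ a _
  · cases m.testBit a <;> simp
  · cases m.testBit a
    · simp
    · simp only [cond_true, if_true]
      refine Finset.sum_congr rfl fun b _ => ?_
      cases m.testBit b <;> cases listAdj E a b <;> simp

/-- Contraction of the edge `e` of a graph given by its edge list. -/
def contractList (E : List (ℕ × ℕ)) (e : ℕ × ℕ) : List (ℕ × ℕ) :=
  E.map fun x => (bif x.1 == e.2 then e.1 else x.1, bif x.2 == e.2 then e.1 else x.2)

/-- Deletion of the edge `e` of a graph given by its edge list. -/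
def deleteList (E : List (ℕ × ℕ)) (e : ℕ × ℕ) : List (ℕ × ℕ) :=
  E.filter fun x => !(x.1 == e.1 && x.2 == e.2)

/-- Certificate check for `mkGraph n E` being an obstruction: `bads` lists vertex sets spanning
too many edges without a common vertex, and `cs` lists certificates for the deletion and the
contraction of the edges of `E`. -/
def obsCheck (n : ℕ) (E : List (ℕ × ℕ)) (bads : List ℕ) (cs : List (ℕ × ℕ)) : Bool :=
  (!bads.isEmpty && bads.all (badCheck n E)) &&
  allTo (fun v => bads.any fun m => !m.testBit v) n &&
  allTo (fun v => E.any fun e => e.1 == v || e.2 == v) n &&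
  E.all (fun e => Nat.blt e.1 n && Nat.blt e.2 n && !(e.1 == e.2)) &&
  (E.length == cs.length && (E.zip cs).all fun x =>
    apexCheck (deleteList E x.1) x.2.1 && apexCheck (contractList E x.1) x.2.2)

theorem obs_of_check {n : ℕ} {E : List (ℕ × ℕ)} {bads : List ℕ} {cs : List (ℕ × ℕ)}
    (h : obsCheck n E bads cs = true) : ObsApexPseudoforest (mkGraph n E) := by
  simp only [obsCheck, Bool.and_eq_true, allTo_iff, List.all_eq_true, List.any_eq_true,
    Bool.not_eq_true', Nat.blt_eq, beq_eq_false_iff_ne, beq_iff_eq, Bool.or_eq_true,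
    List.isEmpty_eq_false_iff_exists_mem] at h
  obtain ⟨⟨⟨⟨⟨⟨m₀, hm₀⟩, hbad⟩, hcover⟩, hiso⟩, hE⟩, hlen, hcs⟩ := h
  have hcs' : ∀ e ∈ E, ApexPseudoforest (mkGraph n (deleteList E e)) ∧
      ApexPseudoforest (mkGraph n (contractList E e)) := by
    intro e he
    obtain ⟨i, hi, rfl⟩ := List.getElem_of_mem he
    have hx : (E[i], cs[i]'(hlen ▸ hi)) ∈ E.zip cs := by
      rw [← List.getElem_zip (h := by simp; omega)]
      exact List.getElem_mem _
    exact ⟨apexPseudoforest_of_check (hcs _ hx).1, apexPseudoforest_of_check (hcs _ hx).2⟩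
  refine ⟨?_, fun W _ H hH hne => ?_⟩
  · rw [apexPseudoforest_iff]
    rintro ⟨s, hs, hno⟩
    rcases hs.eq_empty_or_singleton with rfl | ⟨v, rfl⟩
    · exact hno _ (Set.disjoint_empty _) (bad_of_check (hbad m₀ hm₀))
    · obtain ⟨m, hm, hmv⟩ := hcover v v.2
      refine hno _ ?_ (bad_of_check (hbad m hm))
      simp [hmv]
  · obtain ⟨f, hcon, hdisj, hadj⟩ := hH
    by_cases hsub : ∀ w, (f w).Subsingleton
    · have hg : ∀ w, ∃ x, f w = {x} := fun w =>
        ((hsub w).eq_empty_or_singleton).resolve_left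
          (Set.nonempty_iff_ne_empty.1 (Set.nonempty_coe_sort.1 (hcon w).nonempty))
      choose g hg using hg
      have hginj : Function.Injective g := by
        intro w w' hww
        by_contra hne
        have := hdisj hne
        rw [hg, hg, hww] at this
        simp at this
      have hgadj : ∀ ⦃w w'⦄, H.Adj w w' → (mkGraph n E).Adj (g w) (g w') := by
        intro w w' hw
        obtain ⟨a, ha, b, hb, hab⟩ := hadj hw
        rw [hg] at ha hb
        rwa [Set.mem_singleton_iff.1 ha, Set.mem_singleton_iff.1 hb] at hab
      by_cases hall : ∀ e ∈ E, ∃ w w', H.Adj w w' ∧ (g w : ℕ) = e.1 ∧ (g w' : ℕ) = e.2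
      · exfalso
        have hgsur : Function.Surjective g := by
          intro v
          obtain ⟨e, he, hv⟩ := hiso v v.2
          obtain ⟨w, w', _, h1, h2⟩ := hall e he
          rcases hv with hv | hv
          · exact ⟨w, Fin.ext (h1.trans hv)⟩
          · exact ⟨w', Fin.ext (h2.trans hv)⟩
        refine hne.false ⟨Equiv.ofBijective g ⟨hginj, hgsur⟩,
          fun {w w'} => ⟨fun h => ?_, @hgadj w w'⟩⟩
        rcases (mkGraph_adj.1 h).2 with he | he
        all_goals
          obtain ⟨u, u', hu, h1, h2⟩ := hall _ he
          obtain rfl := hginj (Fin.ext h1)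
          obtain rfl := hginj (Fin.ext h2)
        exacts [hu, hu.symm]
      · push Not at hall
        obtain ⟨e, he, hno⟩ := hall
        refine ApexPseudoforest.of_isMinorOf ⟨f, fun w => ?_, hdisj, fun w w' hw => ?_⟩
          (hcs' e he).1
        · rw [hg]
          exact induce_singleton_connected _
        · refine ⟨g w, by simp [hg], g w', by simp [hg], mkGraph_adj.2 ?_⟩
          obtain ⟨hne, hor⟩ := mkGraph_adj.1 (hgadj hw)
          refine ⟨hne, hor.imp (fun h => ?_) fun h => ?_⟩
          · have := hno w w' hw
            simp only [deleteList, List.mem_filter, h, true_and, Bool.not_eq_true',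
              Bool.and_eq_false_iff, beq_eq_false_iff_ne]
            tauto
          · have := hno w' w hw.symm
            simp only [deleteList, List.mem_filter, h, true_and, Bool.not_eq_true',
              Bool.and_eq_false_iff, beq_eq_false_iff_ne]
            tauto
    · push Not at hsub
      obtain ⟨w₀, hw₀⟩ := hsub
      have hedge : ∃ a ∈ f w₀, ∃ b ∈ f w₀, (mkGraph n E).Adj a b := by
        classical
        have hc : ((mkGraph n E).induce ((f w₀).toFinset : Set (Fin n))).Connected := by
          rw [Set.coe_toFinset]; exact hcon w₀
        have h1 := two_mul_card_le_of_connected hc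
        have h2 : 1 < #(f w₀).toFinset := by
          rw [Finset.one_lt_card_iff_nontrivial]
          simpa using hw₀
        simpa using cross_pos_iff.1
          (show 0 < cross (mkGraph n E) (f w₀).toFinset (f w₀).toFinset by omega)
      have hedge' : ∃ a ∈ f w₀, ∃ b ∈ f w₀, a ≠ b ∧ ((a : ℕ), (b : ℕ)) ∈ E := by
        obtain ⟨a, ha, b, hb, hab⟩ := hedge
        obtain ⟨hne, hE | hE⟩ := mkGraph_adj.1 hab
        exacts [⟨a, ha, b, hb, hne, hE⟩, ⟨b, hb, a, ha, hne.symm, hE⟩]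
      obtain ⟨a, ha, b, hb, hab, hE'⟩ := hedge'
      let g : Fin n → Fin n := fun x => if x = b then a else x
      have hgval : ∀ x, (g x : ℕ) = bif (x : ℕ) == b then (a : ℕ) else x := by
        intro x
        by_cases hx : x = b
        · simp [g, hx]
        · have : ((x : ℕ) == b) = false := by simpa [Fin.ext_iff] using hx
          simp [g, hx, this]
      refine ApexPseudoforest.of_isMinorOf
        (IsMinorOf.of_collapse g (fun x y hxy => ?_) hcon ?_ hadj) (hcs' _ hE').2
      · by_cases hgxy : g x = g y
        · exact .inl hgxy
        · refine .inr (mkGraph_adj.2 ⟨hgxy, (mkGraph_adj.1 hxy).2.imp (fun h => ?_) fun h => ?_⟩)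
          all_goals
            rw [hgval, hgval]
            exact List.mem_map_of_mem
              (f := fun x : ℕ × ℕ => (bif x.1 == (b : ℕ) then (a : ℕ) else x.1,
                bif x.2 == (b : ℕ) then (a : ℕ) else x.2)) h
      · intro w w' hww x hx y hy hxy
        have hin : ∀ {w : W} {z}, z ∈ f w → z ∈ f w₀ → w = w₀ := by
          intro w z hz hz'
          by_contra hne
          exact Set.disjoint_left.1 (hdisj hne) hz hz'
        simp only [g] at hxy
        split_ifs at hxy with h1 h2 h2
        · subst h1 h2
          exact hww ((hin hx hb).trans (hin hy hb).symm)
        · subst h1 hxy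
          exact hww ((hin hx hb).trans (hin hy ha).symm)
        · subst h2 hxy
          exact hww ((hin hx ha).trans (hin hy hb).symm)
        · subst hxy
          exact Set.disjoint_left.1 (hdisj hww) hx hy

end Lists

lemma obs_O1 : ObsApexPseudoforest O1 :=
  obs_of_check (bads := [15, 240])
    (cs := [
      (1459622692, 1459617844), (1459622676, 1459618580), (1459683860, 1459618324), (1459618580,
      1459618580), (1459618324, 1459618324), (18645783296, 1081086720), (18644734720, 17302557440),
      (22654489344, 1179652864), (18376299264, 17302557440), (18359522048, 1179652864)])
    (by decide +kernel)

lemma obs_O2 : ObsApexPseudoforest O2 :=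
  obs_of_check (bads := [31, 992])
    (cs := [
      (620354601525, 620354601013), (620354605109, 620354601013), (620354601013, 620354601013),
      (620354601493, 620354339349), (620357485077, 620354339349), (620354339349, 620354339349),
      (6139521794560, 6137642746368), (6143279890944, 6117510087168), (6138984923648,
      6117510087168), (6139488240128, 5521012949504), (9163145216512, 367052194304), (5864610333184,
      367052194304)])
    (by decide +kernel)

lemma obs_O3 : ObsApexPseudoforest O3 :=
  obs_of_check (bads := [15, 496])
    (cs := [
      (34460406564, 34460401716), (34460406548, 34460402452), (34460467732, 34460402196),
      (34460402452, 34460402452), (34460402196, 34460402196), (310419395328, 310318732032),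
      (310654276352, 309312099072), (310385840896, 309312099072), (310417298176, 276057559808),
      (499395859200, 18359522048), (293237428992, 18359522048)])
    (by decide +kernel)

lemma obs_O4 : ObsApexPseudoforest O4 :=
  obs_of_check (bads := [31, 248, 239, 247])
    (cs := [
      (23459807779, 23459807267), (23459807763, 23459790915), (23459807267, 23459791891),
      (23454876180, 23459790866), (23459791379, 23454875666), (23460118546, 23454888448),
      (23460053010, 14767489042), (23458021394, 19065470994), (23409721362, 21530673170),
      (27167817746, 1398013970), (22872850450, 1398013970)])
    (by decide +kernel)

lemma obs_O5 : ObsApexPseudoforest O5 :=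
  obs_of_check (bads := [31, 248, 239, 247])
    (cs := [
      (23460856355, 23460855843), (23460856339, 23460839491), (23460855843, 23460840467),
      (23454876180, 23460839442), (23460839955, 23454875666), (23461167122, 23454548499),
      (23461101586, 26845643283), (23458021394, 21525299732), (23410769938, 21530673170),
      (26947682322, 1177878546), (22652715026, 1177878546)])
    (by decide +kernel)

lemma obs_O6 : ObsApexPseudoforest O6 :=
  obs_of_check (bads := [120, 31, 111, 183])
    (cs := [
      (18644746787, 18644746275), (18644746771, 18644729923), (18644746275, 18644730899),
      (22381134356, 18644729874), (18644730387, 22381133842), (17987404309, 1459618323),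
      (22380937748, 17988780050), (18641584659, 17991729170), (22867477012, 21525299732),
      (22330606100, 21525299732), (22886220307, 1411383827), (18591253011, 1411383827)])
    (by decide +kernel)

lemma obs_O7 : ObsApexPseudoforest O7 :=
  obs_of_check (bads := [60, 95, 111, 119, 123])
    (cs := [
      (1177880162, 1177878626), (1177880082, 50593874), (1177878626, 51643666), (101013012,
      1176524288), (106976787, 100992530), (106972691, 6555154), (107283986, 100685331), (107218450,
      6309395), (104138258, 33894420), (56886802, 2371605)])
    (by decide +kernel)

lemma obs_O8 : ObsApexPseudoforest O8 :=
  obs_of_check (bads := [116, 120, 31, 47])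
    (cs := [
      (1376072228, 1376071716), (1376072212, 1342505012), (1376071716, 1359282964), (1376059924,
      1179648018), (1077019157, 100990994), (1392640532, 6553618), (1179975698, 906297362),
      (1179910162, 1077280786), (1177878546, 1076113920), (1398013970, 55836690), (1129578514,
      55836690)])
    (by decide +kernel)

lemma obs_O9 : ObsApexPseudoforest O9 :=
  obs_of_check (bads := [312, 87, 143])
    (cs := [
      (284078129699, 284078129187), (284078129683, 274951307331), (284078129187, 279514711059),
      (215336026644, 1149239314), (284078113299, 12935757842), (220192899090, 13741064210),
      (220192833554, 220125724690), (220176056338, 220125724690), (284610789907, 283537048083),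
      (284073918995, 283537048083), (219630666260, 206745764372), (215335698964, 206745764372),
      (288892387346, 14014480402), (220172910610, 14014480402)])
    (by decide +kernel)

lemma obs_O10 : ObsApexPseudoforest O10 :=
  obs_of_check (bads := [110, 403, 461])
    (cs := [
      (35181823090, 34930569216), (34931619072, 34646393600), (34914849280, 34914456064),
      (34930569329, 34914456067), (35182870642, 35181822066), (35181822066, 35181822066),
      (34931618304, 34898063872), (34914841088, 34898063872), (35183022592, 34377716224),
      (34914587136, 34377716224), (34930569265, 570830897), (481607168049, 570830897), (570830897,
      570830897)])
    (by decide +kernel)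

lemma obs_O11 : ObsApexPseudoforest O11 :=
  obs_of_check (bads := [63, 455, 504])
    (cs := [
      (448631150627, 448631144579), (448631150611, 448631146515), (448631146515, 448631146515),
      (448631484449, 448606515233), (448631418913, 448564310049), (448614641697, 448564310049),
      (311440977953, 277081239585), (311172542497, 26899394593), (302851043361, 19114766369),
      (1934885400, 448631146514), (448631144979, 1934897185), (448611495969, 1929511444)])
    (by decide +kernel)

lemma obs_O12 : ObsApexPseudoforest O12 :=
  obs_of_check (bads := [63, 455, 504])
    (cs := [
      (448560919075, 448560918563), (448560919059, 448560889971), (448560918563, 448560891667),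
      (448611614738, 448606371858), (448626294802, 448559185938), (448609517586, 448559185938),
      (447537741842, 413178003474), (507667283986, 26630946834), (438947807250, 26630946834),
      (489682108950, 448560889874), (448560890387, 413178003474), (448611483666, 489631515155)])
    (by decide +kernel)

lemma obs_O13 : ObsApexPseudoforest O13 :=
  obs_of_check (bads := [63, 455, 504])
    (cs := [
      (448560923171, 448560922659), (448560923155, 448560889987), (448560922659, 448560891923),
      (448611745810, 448606502930), (448626425874, 448559317010), (448609648658, 448559317010),
      (242721488914, 208361750546), (242453053458, 26630946834), (234131554322, 14819786770),
      (1934885400, 448560889874), (448560890387, 1934884882), (448611483666, 1884291603)])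
    (by decide +kernel)

lemma obs_O14 : ObsApexPseudoforest O14 :=
  obs_of_check (bads := [60, 199, 250])
    (cs := [
      (6224483876, 1929511012), (6224483860, 6224348692), (6224479764, 1934884865), (6229853714,
      1879388193), (1934901281, 1917861921), (1934897185, 1929531425), (1934770209, 1879388193),
      (1948528673, 1881419809), (1931751457, 1881419809), (6229853202, 4350805010), (26094076946,
      324273170), (4619240466, 324273170)])
    (by decide +kernel)

lemma obs_O15 : ObsApexPseudoforest O15 :=
  obs_of_check (bads := [31, 496, 455])
    (cs := [
      (448656466468, 448656465956), (448656466452, 448656310372), (448656465956, 448656377364),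
      (34429207062, 34428944918), (34430124566, 448656310290), (34429075990, 34410201622),
      (448662863890, 448562200594), (448661815314, 309312356370), (448629309458, 378080067602),
      (447856508946, 413496770578), (507986051090, 26949713938), (439266574354, 26949713938),
      (448656441876, 34365243410)])
    (by decide +kernel)

lemma obs_O16 : ObsApexPseudoforest O16 :=
  obs_of_check (bads := [15, 51, 61, 62])
    (cs := [
      (5255233, 22086656), (5374017, 22025216), (5255201, 16855552), (67121185, 1126912), (22098944,
      22086656), (22156288, 22025216), (22098432, 16855552), (68235776, 1126912), (22090752,
      22025216), (17904128, 1126912)])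
    (by decide +kernel)

lemma obs_O17 : ObsApexPseudoforest O17 :=
  obs_of_check (bads := [29, 30, 51, 47])
    (cs := [
      (79140, 2371584), (19149824, 17842688), (18105088, 18088704), (2371649, 35926017), (2371617,
      69480449), (19149568, 70402048), (18100992, 19989504), (17974016, 1066240), (16855076,
      16929540), (77860, 340004)])
    (by decide +kernel)

lemma obs_O18 : ObsApexPseudoforest O18 :=
  obs_of_check (bads := [55, 110, 155, 205])
    (cs := [
      (13706986610, 13455732736), (13456782592, 13171557120), (13440012800, 9144652288),
      (13455732849, 13458878465), (13708034162, 13714588674), (13706985586, 13757317234),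
      (13456781824, 13460975616), (13440004608, 14278853888), (13708186112, 13255443712),
      (13439750656, 26324521472), (570830897, 10502561905), (13455732785, 13463072769)])
    (by decide +kernel)

lemma obs_O19 : ObsApexPseudoforest O19 :=
  obs_of_check (bads := [15, 61, 94, 115])
    (cs := [
      (1078997057, 1141966336), (1079115841, 1141904896), (1141978624, 1141966336), (1142035968,
      1141904896), (1141970432, 1141904896), (1078997025, 268513792), (341914112, 1143222272),
      (1140863009, 1112879105), (1073754145, 1342189601), (336671232, 369177088), (1141977600,
      610676736)])
    (by decide +kernel)

lemma obs_O20 : ObsApexPseudoforest O20 :=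
  obs_of_check (bads := [23, 46, 51, 60])
    (cs := [
      (33895700, 5570625), (22347842, 33894401), (68485186, 2109505), (39137345, 33894433),
      (69546049, 1196544), (35991617, 2371649), (22348866, 5570626), (22348818, 17104978),
      (39141441, 38813761), (38944833, 2371649)])
    (by decide +kernel)

lemma obs_O21 : ObsApexPseudoforest O21 :=
  obs_of_check (bads := [23, 62, 107, 121])
    (cs := [
      (1410351683, 911556608), (911556673, 1410351616), (911556657, 906302208), (906301492,
      105922625), (1409303059, 906297393), (911228993, 805584945), (906313777, 805311252),
      (1409303571, 1409287187), (1409291283, 1375732243), (1397768257, 55590977), (860897345,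
      55590977)])
    (by decide +kernel)

lemma obs_O22 : ObsApexPseudoforest O22 :=
  obs_of_check (bads := [169, 31, 183, 222])
    (cs := [
      (1997554259, 14884945920), (806634007, 1997554176), (14884946432, 14881788672), (14882849280,
      1996492883), (14884946944, 14884930560), (14884934656, 14881796608), (23354950163,
      14884945921), (26693878272, 19177423360), (1880113683, 1343242771), (1997554195, 23371727363),
      (13808976384, 907297280), (14882718208, 26962051584)])
    (by decide +kernel)

lemma obs_O23 : ObsApexPseudoforest O23 :=
  obs_of_check (bads := [29, 77, 86, 120])
    (cs := [
      (587596340, 1078985730), (610276387, 805634098), (1142952995, 55837746), (1129710642,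
      805634866), (1129579570, 55837746), (861144114, 55837746), (878969906, 1415578706),
      (862192690, 906298674), (587608628, 50724916), (587608612, 536871524), (610288675, 341836819),
      (610288163, 553653795)])
    (by decide +kernel)

lemma obs_O24 : ObsApexPseudoforest O24 :=
  obs_of_check (bads := [120, 63, 95, 111, 119])
    (cs := [
      (1179664931, 1179664419), (1179664915, 1179648067), (1179664419, 1179649043), (906297876,
      1179664417), (1179648531, 906298130), (1180057633, 811876385), (1179992097, 55853089),
      (912605217, 811876385), (911556641, 55853089), (879050785, 55656960)])
    (by decide +kernel)

lemma obs_O25 : ObsApexPseudoforest O25 :=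
  obs_of_check (bads := [120, 166, 143])
    (cs := [
      (5103514165, 808480805), (5103514133, 4294996501), (5103448597, 8695861249), (5675971859,
      4400874771), (5675971091, 3567665), (5659193875, 5103420178), (9954152979, 1364218387),
      (5659185683, 1364218387), (9501495345, 9496252465), (9499398193, 9401810993), (9501429809,
      8593485873), (10002714673, 8660537393), (9465843761, 8660537393)])
    (by decide +kernel)

lemma obs_O26 : ObsApexPseudoforest O26 :=
  obs_of_check (bads := [86, 141, 312])
    (cs := [
      (215336026676, 274951308290), (284078117923, 206209220658), (220192900146, 219094057778),
      (220192834610, 366221460562), (220176057394, 220520056114), (288892388402, 310450848898),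
      (220172911666, 221325363250), (215336038964, 206209220660), (215336038948, 9126806132),
      (219630666292, 208088270644), (215335698996, 490280583796), (284078130211, 279514711059),
      (284078129699, 77863065123), (284610794531, 300989547619), (284073923619, 421544334883)])
    (by decide +kernel)

lemma obs_O27 : ObsApexPseudoforest O27 :=
  obs_of_check (bads := [184, 79, 246])
    (cs := [
      (338846263, 338690151), (23428359715, 23428335123), (338846247, 335569447), (338715175,
      23428335106), (23428358691, 21549291299), (23428339235, 21549314595), (23428793906,
      23404676658), (21817745955, 70267430), (14888994354, 19062523442), (14838662706, 1412761138),
      (23428597298, 875890226), (23424599602, 1079248434)])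
    (by decide +kernel)

lemma obs_O28 : ObsApexPseudoforest O28 :=
  obs_of_check (bads := [39, 120, 95])
    (cs := [
      (1365266979, 1348489251), (1365266963, 1365246035), (1365266467, 106956051), (811860501,
      106975265), (1382023699, 811860001), (912543777, 811872289), (912609313, 906317857),
      (1177899041, 50614305), (909463585, 55857185), (1365246483, 811860754), (862212129,
      55857185)])
    (by decide +kernel)

lemma obs_O29 : ObsApexPseudoforest O29 :=
  obs_of_check (bads := [63, 455, 504])
    (cs := [
      (448629053219, 448629047411), (448629053203, 448629049107), (448629049107, 448629049107),
      (448629387297, 448606384161), (448629321761, 448562212897), (448612544545, 448562212897),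
      (447806189601, 413446451233), (507935731745, 26899394593), (439216255009, 26899394593),
      (485387141654, 448629049106), (448629047827, 413446451233), (448611495969, 485381767700)])
    (by decide +kernel)

lemma obs_O30 : ObsApexPseudoforest O30 :=
  obs_of_check (bads := [199, 248, 127, 191])
    (cs := [
      (26156008052, 25887572084), (26156011636, 26156007540), (26156007540, 26156007540),
      (26966562304, 26692883968), (26966496768, 26847155712), (26964465152, 26851153408),
      (22604420608, 55837206), (1996816916, 21530673265), (23409726976, 117768724), (26156007956,
      1129584128), (26899387904, 274989589)])
    (by decide +kernel)

lemma obs_O31 : ObsApexPseudoforest O31 :=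
  obs_of_check (bads := [31, 47, 55, 59, 61, 62])
    (cs := [
      (55837746, 55857152), (55857201, 55837696), (55858176, 55836721), (68506112, 50418176),
      (68440576, 1323520), (51663360, 1327616), (55857185, 68178432), (55857664, 50352161),
      (55841792, 3146770)])
    (by decide +kernel)

lemma obs_O32 : ObsApexPseudoforest O32 :=
  obs_of_check (bads := [31, 47, 55, 59, 61, 62])
    (cs := [
      (2248769, 18895872), (2248753, 16929536), (33701937, 1196800), (19026944, 2117697), (19026688,
      151601), (34751232, 147505), (18961408, 1049922), (17978112, 66866), (17974016, 66610)])
    (by decide +kernel)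

lemma obs_O33 : ObsApexPseudoforest O33 :=
  obs_of_check (bads := [15, 23, 27, 29, 30])
    (cs := [
      (66610, 147456), (147505, 66560), (147489, 1065472), (2109473, 78336), (1196800, 66560),
      (1196544, 1065472), (2175488, 78336), (1131008, 1065472), (1126912, 78336)])
    (by decide +kernel)

section Splitting

open scoped Classical

variable {V : Type} {G : SimpleGraph V}

lemma connected_union {A B : Finset V} (hA : (G.induce (A : Set V)).Connected)
    (hB : (G.induce (B : Set V)).Connected) (h : 0 < cross G A B) :
    (G.induce ((A ∪ B : Finset V) : Set V)).Connected := by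
  obtain ⟨a, ha, b, hb, hab⟩ := cross_pos_iff.1 h
  rw [Finset.coe_union]
  exact SimpleGraph.connected_induce_union hA.preconnected hB.preconnected
    (Finset.mem_coe.2 ha) (Finset.mem_coe.2 hb) hab

lemma connected_singleton (v : V) : (G.induce (({v} : Finset V) : Set V)).Connected := by
  rw [Finset.coe_singleton]
  exact induce_singleton_connected v

lemma nonempty_of_connected {A : Finset V} (hA : (G.induce (A : Set V)).Connected) :
    A.Nonempty := by
  obtain ⟨x⟩ := hA.nonempty
  exact ⟨x, x.2⟩

/-- A connected set is not the disjoint union of two nonempty sets with no edges between them. -/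
lemma cross_pos_of_connected {A B S : Finset V} (hS : (G.induce (S : Set V)).Connected)
    (hAB : A ∪ B = S) (hdisj : Disjoint A B) (hA : A.Nonempty) (hB : B.Nonempty) :
    0 < cross G A B := by
  obtain ⟨a, ha⟩ := hA
  obtain ⟨b, hb⟩ := hB
  have haS : a ∈ (S : Set V) := by rw [← hAB]; simp [ha]
  have hbS : b ∈ (S : Set V) := by rw [← hAB]; simp [hb]
  obtain ⟨p⟩ := hS.preconnected ⟨a, haS⟩ ⟨b, hbS⟩
  obtain ⟨d, -, h1, h2⟩ := p.exists_boundary_dart {x | (x : V) ∈ A} ha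
    (Finset.disjoint_right.1 hdisj hb)
  refine cross_pos_iff.2 ⟨d.fst, h1, d.snd, ?_, SimpleGraph.comap_adj.1 d.adj⟩
  have h3 : (d.snd : V) ∈ A ∪ B := by
    rw [hAB]
    exact Finset.mem_coe.1 d.snd.2
  exact (Finset.mem_union.1 h3).resolve_left h2

/-- Two vertices of a connected set can be separated by a partition into two connected sets. -/
lemma exists_connected_split {S : Finset V} (hS : (G.induce (S : Set V)).Connected) {a b : V}
    (ha : a ∈ S) (hb : b ∈ S) (hab : a ≠ b) :
    ∃ A B : Finset V, A ∪ B = S ∧ Disjoint A B ∧ a ∈ A ∧ b ∈ B ∧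
      (G.induce (A : Set V)).Connected ∧ (G.induce (B : Set V)).Connected := by
  have key : ∀ k, ∀ A B : Finset V, A ∪ B ⊆ S → Disjoint A B → a ∈ A → b ∈ B →
      (G.induce (A : Set V)).Connected → (G.induce (B : Set V)).Connected →
      #(S \ (A ∪ B)) = k →
      ∃ A B : Finset V, A ∪ B = S ∧ Disjoint A B ∧ a ∈ A ∧ b ∈ B ∧
        (G.induce (A : Set V)).Connected ∧ (G.induce (B : Set V)).Connected := by
    intro k
    induction k with
    | zero =>
      intro A B hsub hdisj haA hbB hA hB hk
      rw [Finset.card_eq_zero, Finset.sdiff_eq_empty_iff_subset] at hk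
      exact ⟨A, B, hsub.antisymm hk, hdisj, haA, hbB, hA, hB⟩
    | succ k ih =>
      intro A B hsub hdisj haA hbB hA hB hk
      have hne : (S \ (A ∪ B)).Nonempty := by
        rw [← Finset.card_pos]; omega
      have := cross_pos_of_connected hS (Finset.union_sdiff_of_subset hsub)
        Finset.disjoint_sdiff ⟨a, Finset.mem_union_left _ haA⟩ hne
      obtain ⟨x, hx, y, hy, hxy⟩ := cross_pos_iff.1 this
      have hyS := Finset.mem_sdiff.1 hy
      have hyA : y ∉ A := fun h => hyS.2 (Finset.mem_union_left _ h)
      have hyB : y ∉ B := fun h => hyS.2 (Finset.mem_union_right _ h)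
      have hcard : ∀ T : Finset V, T = insert y (A ∪ B) → T ⊆ S ∧ #(S \ T) = k := by
        rintro T rfl
        refine ⟨Finset.insert_subset hyS.1 hsub, ?_⟩
        rw [Finset.sdiff_insert, Finset.card_erase_of_mem hy, hk]
        rfl
      rcases Finset.mem_union.1 hx with hx | hx
      · have hc := hcard ((A ∪ {y}) ∪ B) (by ext; simp)
        exact ih _ _ hc.1 (by simp [hdisj, hyB])
          (Finset.mem_union_left _ haA) hbB (connected_union hA (connected_singleton y)
            (cross_pos_iff.2 ⟨x, hx, y, by simp, hxy⟩)) hB hc.2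
      · have hc := hcard (A ∪ (B ∪ {y})) (by ext; simp)
        exact ih _ _ hc.1 (by simp [hdisj, hyA])
          haA (Finset.mem_union_left _ hbB) hA (connected_union hB (connected_singleton y)
            (cross_pos_iff.2 ⟨x, hx, y, by simp, hxy⟩)) hc.2
  exact key _ {a} {b} (by simp [Finset.insert_subset_iff, ha, hb])
    (by simpa using hab) (by simp) (by simp) (connected_singleton a) (connected_singleton b) rfl

/-- A connected set spanning at least as many edges as vertices can be split into two connected
sets joined by at least two edges. -/
lemma exists_cycle_split {S : Finset V} (hS : (G.induce (S : Set V)).Connected)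
    (h : 2 * #S < cross G S S + 2) :
    ∃ A B : Finset V, A ∪ B = S ∧ Disjoint A B ∧ (G.induce (A : Set V)).Connected ∧
      (G.induce (B : Set V)).Connected ∧ 2 ≤ cross G A B := by
  induction hk : #S using Nat.strong_induction_on generalizing S with
  | _ k ih =>
    by_contra hno
    push Not at hno
    obtain ⟨a, ha⟩ := nonempty_of_connected hS
    by_cases hb : ∃ b ∈ S, a ≠ b
    · obtain ⟨b, hb, hab⟩ := hb
      obtain ⟨A, B, rfl, hdisj, haA, hbB, hA, hB⟩ := exists_connected_split hS ha hb hab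
      have hm := hno A B rfl hdisj hA hB
      have hcard := Finset.card_union_of_disjoint hdisj
      have hApos := Finset.card_pos.2 ⟨a, haA⟩
      have hBpos := Finset.card_pos.2 ⟨b, hbB⟩
      have hcr := cross_union_self (G := G) hdisj
      have part : ∀ C D : Finset V, C ∪ D = A ∪ B → Disjoint C D →
          (G.induce (C : Set V)).Connected → (G.induce (D : Set V)).Connected → #C < k →
          cross G C D < 2 → 0 < cross G C D → cross G C C + 2 ≤ 2 * #C := by
        intro C D hCD hdis hC hD hlt hcd hpos
        by_contra hCC
        obtain ⟨C₁, C₂, rfl, h12, h1, h2, h3⟩ := ih _ hlt hC (by omega) rfl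
        rw [cross_union_left h12] at hcd hpos
        rw [Finset.disjoint_union_left] at hdis
        by_cases h0 : 0 < cross G C₁ D
        · have := hno (C₁ ∪ D) C₂ (by rw [← hCD]; ext; simp; tauto)
            (Finset.disjoint_union_left.2 ⟨h12, hdis.2.symm⟩) (connected_union h1 hD h0) h2
          rw [cross_union_left hdis.1] at this
          omega
        · have := hno C₁ (C₂ ∪ D) (by rw [← hCD]; ext; simp)
            (Finset.disjoint_union_right.2 ⟨h12, hdis.1⟩) h1 (connected_union h2 hD (by omega))
          rw [cross_union_right hdis.2] at this
          omega
      have hpos := cross_pos_of_connected hS rfl hdisj ⟨a, haA⟩ ⟨b, hbB⟩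
      have e1 := part A B rfl hdisj hA hB (by omega) hm hpos
      have e2 := part B A (Finset.union_comm _ _) hdisj.symm hB hA (by omega)
        (by rwa [cross_comm]) (by rwa [cross_comm])
      omega
    · push Not at hb
      obtain rfl : S = {a} := by
        ext x
        simp only [Finset.mem_singleton]
        exact ⟨fun hx => (hb x hx).symm, fun hx => hx ▸ ha⟩
      simp [cross_singleton] at h

end Splitting

section Models

open scoped Classical

variable {V : Type} {G : SimpleGraph V} {n : ℕ} {g : ℕ → ℕ → ℕ} {f : ℕ → Finset V}

/-- Disjoint connected sets `f 0, …, f (n - 1)` such that there are at least `g i j` edges between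
`f i` and `f j`, and at least `g i i` edges inside `f i` beyond a spanning tree. -/
structure Model (G : SimpleGraph V) (n : ℕ) (g : ℕ → ℕ → ℕ) (f : ℕ → Finset V) : Prop where
  conn : ∀ i < n, (G.induce (f i : Set V)).Connected
  disj : ∀ i < n, ∀ j < n, i ≠ j → Disjoint (f i) (f j)
  edge : ∀ i < n, ∀ j < n, i ≠ j → g i j ≤ cross G (f i) (f j)
  loop : ∀ i < n, 2 * g i i + 2 * #(f i) ≤ cross G (f i) (f i) + 2

lemma Model.comp {n' : ℕ} {g' : ℕ → ℕ → ℕ} {σ : ℕ → ℕ} (h : Model G n g f)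
    (hσ : ∀ i < n', σ i < n) (hinj : ∀ i < n', ∀ j < n', i ≠ j → σ i ≠ σ j)
    (hg : ∀ i < n', ∀ j < n', g' i j ≤ g (σ i) (σ j)) : Model G n' g' (f ∘ σ) where
  conn i hi := h.conn _ (hσ i hi)
  disj i hi j hj hij := h.disj _ (hσ i hi) _ (hσ j hj) (hinj i hi j hj hij)
  edge i hi j hj hij := (hg i hi j hj).trans (h.edge _ (hσ i hi) _ (hσ j hj) (hinj i hi j hj hij))
  loop i hi := by
    have := h.loop _ (hσ i hi)
    have := hg i hi i hi
    simp only [Function.comp]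
    omega

/-- Replace the `i`-th set by `A` and append `B` as the `n`-th one. -/
noncomputable def splitAt (f : ℕ → Finset V) (n i : ℕ) (A B : Finset V) (x : ℕ) : Finset V :=
  if x = n then B else if x = i then A else f x

lemma Model.split {N : ℕ → ℕ → ℕ} (h : Model G n g f) {i : ℕ} (hi : i < n) {A B : Finset V}
    (hAB : A ∪ B = f i) (hdisj : Disjoint A B) (hA : (G.induce (A : Set V)).Connected)
    (hB : (G.induce (B : Set V)).Connected)
    (hold : ∀ x < n, ∀ y < n, x ≠ i → y ≠ i → N x y ≤ g x y)
    (hiA : ∀ x < n, x ≠ i → N x i ≤ cross G (f x) A ∧ N i x ≤ cross G (f x) A)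
    (hnB : ∀ x < n, x ≠ i → N x n ≤ cross G (f x) B ∧ N n x ≤ cross G (f x) B)
    (hin : N i n ≤ cross G A B ∧ N n i ≤ cross G A B)
    (hii : 2 * N i i + 2 * #A ≤ cross G A A + 2) (hnn : 2 * N n n + 2 * #B ≤ cross G B B + 2) :
    Model G (n + 1) N (splitAt f n i A B) := by
  have hn : splitAt f n i A B n = B := by simp [splitAt]
  have hi' : splitAt f n i A B i = A := by simp [splitAt, hi.ne]
  have hx : ∀ x < n, x ≠ i → splitAt f n i A B x = f x := fun x hx hxi => by
    simp [splitAt, hx.ne, hxi]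
  have cases3 : ∀ x < n + 1, x = n ∨ x = i ∨ (x < n ∧ x ≠ i) := by omega
  have hfA : ∀ x < n, x ≠ i → Disjoint (f x) A ∧ Disjoint (f x) B := fun x hx hxi => by
    have := h.disj x hx i hi hxi
    rwa [← hAB, Finset.disjoint_union_right] at this
  constructor
  · intro x hx'
    rcases cases3 x hx' with rfl | rfl | ⟨h1, h2⟩
    · rwa [hn]
    · rwa [hi']
    · rw [hx x h1 h2]; exact h.conn x h1
  · intro x hx' y hy' hxy
    rcases cases3 x hx' with rfl | rfl | ⟨h1, h2⟩ <;>
      rcases cases3 y hy' with rfl | rfl | ⟨h3, h4⟩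
    · exact absurd rfl hxy
    · rw [hn, hi']; exact hdisj.symm
    · rw [hn, hx y h3 h4]; exact (hfA y h3 h4).2.symm
    · rw [hn, hi']; exact hdisj
    · exact absurd rfl hxy
    · rw [hi', hx y h3 h4]; exact (hfA y h3 h4).1.symm
    · rw [hn, hx x h1 h2]; exact (hfA x h1 h2).2
    · rw [hi', hx x h1 h2]; exact (hfA x h1 h2).1
    · rw [hx x h1 h2, hx y h3 h4]; exact h.disj x h1 y h3 hxy
  · intro x hx' y hy' hxy
    rcases cases3 x hx' with rfl | rfl | ⟨h1, h2⟩ <;>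
      rcases cases3 y hy' with rfl | rfl | ⟨h3, h4⟩
    · exact absurd rfl hxy
    · rw [hn, hi', cross_comm]; exact hin.2
    · rw [hn, hx y h3 h4, cross_comm]; exact (hnB y h3 h4).2
    · rw [hn, hi']; exact hin.1
    · exact absurd rfl hxy
    · rw [hi', hx y h3 h4, cross_comm]; exact (hiA y h3 h4).2
    · rw [hn, hx x h1 h2]; exact (hnB x h1 h2).1
    · rw [hi', hx x h1 h2]; exact (hiA x h1 h2).1
    · rw [hx x h1 h2, hx y h3 h4]
      exact (hold x h1 y h3 h2 h4).trans (h.edge x h1 y h3 hxy)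
  · intro x hx'
    rcases cases3 x hx' with rfl | rfl | ⟨h1, h2⟩
    · rwa [hn]
    · rwa [hi']
    · rw [hx x h1 h2]
      have := h.loop x h1
      have := hold x h1 x h1 h2 h2
      omega

end Models

section Packing

/-- The position of the entry `(i, j)` of a packed symmetric matrix. -/
def pos (i j : ℕ) : ℕ := bif Nat.ble j i then i * (i + 1) / 2 + j else j * (j + 1) / 2 + i

/-- The entry `(i, j)` of a packed symmetric matrix. -/
def ent (M i j : ℕ) : ℕ := digit M (pos i j)

/-- Set a zero entry of a packed symmetric matrix to `a`. -/
def setEnt (M i j a : ℕ) : ℕ := M ||| a <<< (4 * pos i j)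

lemma pos_comm (i j : ℕ) : pos i j = pos j i := by
  rcases lt_trichotomy i j with h | rfl | h
  · have h1 : Nat.ble j i = false := by rw [Bool.eq_false_iff]; simpa using h
    have h2 : Nat.ble i j = true := by simpa using h.le
    simp [pos, h1, h2]
  · rfl
  · have h1 : Nat.ble i j = false := by rw [Bool.eq_false_iff]; simpa using h
    have h2 : Nat.ble j i = true := by simpa using h.le
    simp [pos, h1, h2]

lemma ent_comm (M i j : ℕ) : ent M i j = ent M j i := by
  rw [ent, ent, pos_comm]

lemma pos_of_le {i j : ℕ} (h : j ≤ i) : pos i j = i * (i + 1) / 2 + j := by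
  have h1 : Nat.ble j i = true := by simpa using h
  simp [pos, h1]

lemma pos_lt_of_lt {i j i' j' : ℕ} (hj : j ≤ i) (hj' : j' ≤ i') (h : i < i') :
    pos i j < pos i' j' := by
  rw [pos_of_le hj, pos_of_le hj']
  have h1 : (i + 1) * (i + 1 + 1) / 2 ≤ i' * (i' + 1) / 2 :=
    Nat.div_le_div_right (Nat.mul_le_mul h (Nat.succ_le_succ h))
  have h2 : (i + 1) * (i + 1 + 1) = i * (i + 1) + 2 * (i + 1) := by ring
  omega

lemma pos_inj_of_le {i j i' j' : ℕ} (hj : j ≤ i) (hj' : j' ≤ i') (h : pos i j = pos i' j') :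
    i = i' ∧ j = j' := by
  rcases lt_trichotomy i i' with h' | rfl | h'
  · exact absurd h (pos_lt_of_lt hj hj' h').ne
  · rw [pos_of_le hj, pos_of_le hj'] at h
    exact ⟨rfl, by omega⟩
  · exact absurd h (pos_lt_of_lt hj' hj h').ne'

lemma pos_inj {i j i' j' : ℕ} (h : pos i j = pos i' j') :
    (i = i' ∧ j = j') ∨ (i = j' ∧ j = i') := by
  rcases le_total j i with h1 | h1 <;> rcases le_total j' i' with h2 | h2
  · exact .inl (pos_inj_of_le h1 h2 h)
  · exact .inr (pos_inj_of_le h1 h2 (h.trans (pos_comm _ _)))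
  · exact .inr (pos_inj_of_le h1 h2 ((pos_comm _ _).trans h)).symm
  · exact .inl (pos_inj_of_le h1 h2 (((pos_comm _ _).trans h).trans (pos_comm _ _))).symm

lemma testBit_digit (M p i : ℕ) :
    (digit M p).testBit i = (decide (i < 4) && M.testBit (4 * p + i)) := by
  have h : digit M p = (M >>> (4 * p)) % 2 ^ 4 := by
    rw [digit, Nat.shiftRight_eq_div_pow, pow_mul]
    norm_num
  rw [h, Nat.testBit_mod_two_pow, Nat.testBit_shiftRight]

lemma digit_lor {M p a q : ℕ} (h : digit M p = 0) (ha : a < 16) :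
    digit (M ||| a <<< (4 * p)) q = if q = p then a else digit M q := by
  refine Nat.eq_of_testBit_eq fun i => ?_
  have ha' : ∀ k, 4 ≤ k → a.testBit k = false := fun k hk =>
    Nat.testBit_lt_two_pow (ha.trans_le (Nat.pow_le_pow_right (n := 2) (by norm_num) hk))
  rw [testBit_digit, Nat.testBit_or, Nat.testBit_shiftLeft]
  split_ifs with hq
  · subst hq
    by_cases hi : i < 4
    · have := testBit_digit M q i
      rw [h] at this
      simp only [Nat.zero_testBit, hi, decide_true, Bool.true_and] at this
      simp [hi, ← this]
    · simp [hi, ha' i (by omega)]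
  · rw [testBit_digit]
    by_cases hi : i < 4
    · by_cases hpq : 4 * p ≤ 4 * q + i
      · rw [ha' (4 * q + i - 4 * p) (by omega)]
        simp
      · simp [hpq]
    · simp [hi]

lemma ent_setEnt {M i j a : ℕ} (h : ent M i j = 0) (ha : a < 16) (x y : ℕ) :
    ent (setEnt M i j a) x y = if pos x y = pos i j then a else ent M x y :=
  digit_lor h ha

end Packing

section Leaves

open scoped Classical

variable {V : Type} {G : SimpleGraph V} {n : ℕ} {g : ℕ → ℕ → ℕ} {f : ℕ → Finset V}

/-- `G` has one of the 33 graphs as a minor. -/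
def HasObs (G : SimpleGraph V) : Prop := ∃ H ∈ OList, IsMinorOf H.2 G

lemma Model.set {N i j a : ℕ} (h : Model G n (ent N) f) (hi : i < n) (hj : j < n) (hij : i ≠ j)
    (h0 : ent N i j = 0) (ha : a < 16) (hc : a ≤ cross G (f i) (f j)) :
    Model G n (ent (setEnt N i j a)) f where
  conn := h.conn
  disj := h.disj
  edge x hx y hy hxy := by
    rw [ent_setEnt h0 ha]
    split_ifs with hp
    · rcases pos_inj hp with ⟨rfl, rfl⟩ | ⟨rfl, rfl⟩
      · exact hc
      · rwa [cross_comm]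
    · exact h.edge x hx y hy hxy
  loop x hx := by
    rw [ent_setEnt h0 ha, if_neg]
    · exact h.loop x hx
    · intro hp
      rcases pos_inj hp with ⟨rfl, rfl⟩ | ⟨rfl, rfl⟩ <;> exact hij rfl

/-- The labels `digit lam x < m` of the vertices `x < n` define a minor given by `m`, `E`. -/
def minorCheck (m : ℕ) (E : List (ℕ × ℕ)) (n : ℕ) (g : ℕ → ℕ → ℕ) (lam : ℕ) : Bool :=
  allTo (fun y => anyTo (fun x => digit lam x == y) n) m &&
  allTo (fun x => Nat.ble m (digit lam x) || allTo (fun x' => !(digit lam x' == digit lam x)) x ||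
    anyTo (fun x' => digit lam x' == digit lam x && Nat.ble 1 (g x x')) x) n &&
  E.all fun e => anyTo (fun x => digit lam x == e.1 &&
    anyTo (fun x' => digit lam x' == e.2 && Nat.ble 1 (g x x')) n) n

lemma Model.isMinorOf {m : ℕ} {E : List (ℕ × ℕ)} {lam : ℕ} (h : Model G n g f)
    (hc : minorCheck m E n g lam = true) : IsMinorOf (mkGraph m E) G := by
  simp only [minorCheck, Bool.and_eq_true, allTo_iff, anyTo_iff, List.all_eq_true, Bool.or_eq_true,
    Nat.ble_eq, beq_iff_eq, Bool.not_eq_true', beq_eq_false_iff_ne] at hc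
  obtain ⟨⟨hsur, hord⟩, hE⟩ := hc
  let B : ℕ → ℕ → Finset V := fun k y => ((range k).filter fun x => digit lam x = y).biUnion f
  have hBs : ∀ k y, B (k + 1) y = if digit lam k = y then f k ∪ B k y else B k y := by
    intro k y
    simp only [B, Finset.range_add_one, Finset.filter_insert]
    split_ifs <;> simp
  have hcon : ∀ y < m, ∀ k ≤ n, (∃ x < k, digit lam x = y) →
      (G.induce (B k y : Set V)).Connected := by
    intro y hy k
    induction k with
    | zero => rintro _ ⟨x, hx, -⟩; omega
    | succ k ih =>
      rintro hk ⟨x, hx, hxy⟩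
      by_cases hky : digit lam k = y
      · rw [hBs, if_pos hky]
        rcases hord k hk with (h1 | h1) | ⟨x', hx', h1, h2⟩
        · omega
        · have : B k y = ∅ := by
            simp only [B]
            rw [Finset.filter_false_of_mem, Finset.biUnion_empty]
            intro z hz hzy
            exact h1 z (Finset.mem_range.1 hz) (hzy.trans hky.symm)
          rw [this, Finset.union_empty]
          exact h.conn k hk
        · refine connected_union (h.conn k hk) (ih (by omega) ⟨x', hx', h1.trans hky⟩) ?_
          refine (h2.trans (h.edge k hk x' (by omega) (by omega))).trans
            (cross_mono subset_rfl ?_)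
          exact Finset.subset_biUnion_of_mem f (by simp [hx', h1, hky])
      · rw [hBs, if_neg hky]
        refine ih (by omega) ⟨x, ?_, hxy⟩
        rcases Nat.lt_succ_iff_lt_or_eq.1 hx with h1 | rfl
        exacts [h1, absurd hxy hky]
  refine ⟨fun y => B n y, fun y => ?_, fun y y' hne => ?_, fun y y' hadj => ?_⟩
  · exact hcon y y.2 n le_rfl (hsur y y.2)
  · rw [Finset.disjoint_coe]
    simp only [B, Finset.disjoint_biUnion_left, Finset.disjoint_biUnion_right]
    intro x hx x' hx'
    simp only [Finset.mem_filter, Finset.mem_range] at hx hx'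
    refine h.disj _ hx'.1 _ hx.1 ?_
    rintro rfl
    exact hne (Fin.ext (hx'.2.symm.trans hx.2))
  · have key : ∀ y y' : Fin m, y ≠ y' → ((y : ℕ), (y' : ℕ)) ∈ E →
        ∃ a ∈ (B n y : Set V), ∃ b ∈ (B n y' : Set V), G.Adj a b := by
      intro y y' hne he
      obtain ⟨x, hx, h1, x', hx', h2, h3⟩ := hE _ he
      have hxx : x ≠ x' := by
        rintro rfl
        exact hne (Fin.ext (h1.symm.trans h2))
      obtain ⟨a, ha, b, hb, hab⟩ := cross_pos_iff.1 (h3.trans (h.edge x hx x' hx' hxx))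
      refine ⟨a, ?_, b, ?_, hab⟩ <;> simp only [B, Finset.mem_coe, Finset.mem_biUnion,
        Finset.mem_filter, Finset.mem_range]
      exacts [⟨x, ⟨hx, h1⟩, ha⟩, ⟨x', ⟨hx', h2⟩, hb⟩]
    obtain ⟨hne, he | he⟩ := mkGraph_adj.1 hadj
    · exact key y y' hne he
    · obtain ⟨a, ha, b, hb, hab⟩ := key y' y hne.symm he
      exact ⟨b, hb, a, ha, hab.symm⟩

/-- The orders and edge lists of the 33 graphs. -/
def oData : List (ℕ × List (ℕ × ℕ)) :=
  [
   (8, [(0,1),(0,2),(0,3),(1,2),(1,3),(4,5),(4,6),(4,7),(5,6),(5,7)]),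
   (10, [(0,1),(0,2),(1,2),(0,3),(0,4),(3,4),(5,6),(5,7),(6,7),(5,8),(5,9),(8,9)]),
   (9, [(0,1),(0,2),(0,3),(1,2),(1,3),(4,5),(4,6),(5,6),(4,7),(4,8),(7,8)]),
   (8, [(0,1),(0,2),(1,2),(2,3),(2,4),(3,4),(3,5),(4,5),(5,6),(5,7),(6,7)]),
   (8, [(0,1),(0,2),(1,2),(2,3),(2,4),(3,4),(3,5),(4,6),(5,6),(5,7),(6,7)]),
   (8, [(0,1),(0,2),(1,2),(2,3),(2,4),(3,4),(3,5),(4,5),(3,6),(5,6),(4,7),(5,7)]),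
   (7, [(0,1),(0,6),(1,6),(2,3),(2,4),(2,5),(3,4),(3,5),(4,6),(5,6)]),
   (7, [(0,1),(0,2),(1,2),(2,3),(2,4),(2,5),(3,4),(3,5),(4,5),(4,6),(5,6)]),
   (9, [(0,1),(0,2),(1,2),(2,3),(2,4),(3,4),(3,5),(4,5),(2,6),(4,6),(2,7),(3,7),(3,8),(4,8)]),
   (9, [(0,1),(1,2),(2,3),(3,0),(0,4),(1,4),(1,5),(2,5),(2,6),(3,6),(0,7),(0,8),(7,8)]),
   (9, [(0,1),(0,2),(1,2),(3,4),(3,5),(4,5),(6,7),(6,8),(7,8),(2,3),(1,8),(4,8)]),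
   (9, [(0,1),(0,2),(1,2),(3,4),(3,5),(4,5),(6,7),(6,8),(7,8),(2,3),(2,7),(3,6)]),
   (9, [(0,1),(0,2),(1,2),(3,4),(3,5),(4,5),(6,7),(6,8),(7,8),(2,3),(2,8),(3,8)]),
   (8, [(0,1),(0,2),(1,2),(1,4),(2,3),(2,4),(3,4),(3,5),(4,5),(1,6),(1,7),(6,7)]),
   (9, [(0,1),(0,2),(1,2),(2,3),(2,4),(3,4),(4,5),(4,6),(5,6),(6,7),(6,8),(7,8),(2,6)]),
   (6, [(0,2),(0,3),(0,4),(0,5),(1,2),(1,3),(1,4),(1,5),(2,3),(4,5)]),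
   (6, [(0,1),(1,3),(3,2),(2,0),(4,0),(4,1),(4,2),(4,3),(5,0),(5,1)]),
   (8, [(0,1),(1,2),(2,3),(3,0),(4,0),(4,1),(5,1),(5,2),(6,2),(6,3),(7,3),(7,0)]),
   (7, [(0,2),(0,3),(1,2),(1,3),(2,3),(0,4),(4,1),(5,0),(5,4),(6,4),(6,1)]),
   (6, [(1,2),(1,4),(1,5),(2,4),(2,5),(4,5),(0,1),(0,4),(2,3),(3,5)]),
   (7, [(0,1),(0,3),(0,4),(1,3),(1,4),(3,5),(4,5),(1,2),(2,4),(3,6),(5,6)]),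
   (8, [(0,1),(0,3),(1,4),(3,4),(1,2),(2,4),(7,0),(7,3),(5,7),(5,0),(6,7),(6,3)]),
   (7, [(2,3),(2,4),(2,6),(3,4),(3,6),(4,6),(5,3),(5,4),(0,2),(0,3),(1,2),(1,4)]),
   (7, [(0,1),(0,2),(1,2),(1,3),(2,4),(3,5),(3,6),(4,5),(4,6),(5,6)]),
   (8, [(0,1),(0,3),(1,3),(1,2),(1,5),(2,5),(1,7),(2,7),(3,4),(4,5),(3,5),(3,6),(5,6)]),
   (9, [(2,3),(2,4),(3,4),(5,3),(5,4),(8,3),(8,4),(0,2),(0,3),(7,2),(7,3),(1,2),(1,4),(6,2),(6,4)]),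
   (8, [(0,2),(1,2),(0,3),(2,3),(1,6),(2,6),(3,4),(6,7),(4,5),(5,7),(3,7),(4,7)]),
   (7, [(0,1),(0,2),(1,2),(1,3),(1,5),(3,5),(3,4),(3,6),(4,6),(2,5),(5,6)]),
   (9, [(0,1),(0,2),(1,2),(3,4),(3,5),(4,5),(6,7),(6,8),(7,8),(2,3),(1,7),(4,6)]),
   (8, [(0,1),(0,2),(1,2),(3,4),(3,5),(4,5),(6,7),(1,6),(4,6),(0,7),(5,7)]),
   (6, [(0,1),(0,2),(1,2),(3,4),(3,5),(4,5),(0,3),(1,4),(2,5)]),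
   (6, [(0,3),(0,4),(0,5),(1,3),(1,4),(1,5),(2,3),(2,4),(2,5)]),
   (5, [(0,1),(0,2),(0,3),(0,4),(1,2),(1,3),(1,4),(2,3),(2,4)])]

lemma oData_map : oData.map (fun x => (⟨x.1, mkGraph x.1 x.2⟩ : (n : ℕ) × SimpleGraph (Fin n))) =
    OList := rfl

/-- The injection `x ↦ digit lam x` embeds the weights `g'` into the weights `g`. -/
def embedCheck (n' : ℕ) (g' : ℕ → ℕ → ℕ) (n : ℕ) (g : ℕ → ℕ → ℕ) (lam : ℕ) : Bool :=
  allTo (fun i => Nat.blt (digit lam i) n && allTo (fun j =>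
    (i == j || !(digit lam i == digit lam j)) &&
      Nat.ble (g' i j) (g (digit lam i) (digit lam j))) n') n'

/-- The weights `g` contain one of the 33 graphs (`t < 33`) or a packed matrix from the list `T`. -/
def leafCheck (T : List (ℕ × ℕ)) (n : ℕ) (g : ℕ → ℕ → ℕ) (t lam : ℕ) : Bool :=
  match oData[t]? with
  | some d => minorCheck d.1 d.2 n g lam
  | none =>
    match T[t - 33]? with
    | some s => embedCheck s.1 (ent s.2) n g lam
    | none => false

/-- Every graph modelling the packed matrix `s.2` on `s.1` vertices has one of the 33 graphs as a
minor. -/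
def Forces (s : ℕ × ℕ) : Prop :=
  ∀ (V : Type) (G : SimpleGraph V) (f : ℕ → Finset V), Model G s.1 (ent s.2) f → HasObs G

lemma embedCheck_iff {n' : ℕ} {g' : ℕ → ℕ → ℕ} {lam : ℕ} :
    embedCheck n' g' n g lam = true ↔ (∀ i < n', digit lam i < n) ∧
      (∀ i < n', ∀ j < n', i ≠ j → digit lam i ≠ digit lam j) ∧
      ∀ i < n', ∀ j < n', g' i j ≤ g (digit lam i) (digit lam j) := by
  simp only [embedCheck, Bool.and_eq_true, allTo_iff, Bool.or_eq_true, Nat.ble_eq, Nat.blt_eq,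
    beq_iff_eq, Bool.not_eq_true', beq_eq_false_iff_ne]
  constructor
  · exact fun h => ⟨fun i hi => (h i hi).1,
      fun i hi j hj hij => ((h i hi).2 j hj).1.resolve_left hij,
      fun i hi j hj => ((h i hi).2 j hj).2⟩
  · exact fun h i hi => ⟨h.1 i hi, fun j hj => ⟨or_iff_not_imp_left.2 (h.2.1 i hi j hj),
      h.2.2 i hi j hj⟩⟩

lemma Model.hasObs_of_leafCheck {T : List (ℕ × ℕ)} (hT : ∀ s ∈ T, Forces s) {t lam : ℕ}
    (h : Model G n g f) (hc : leafCheck T n g t lam = true) : HasObs G := by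
  unfold leafCheck at hc
  split at hc
  next d hd =>
    have hmem := List.mem_map_of_mem (f := fun x : ℕ × List (ℕ × ℕ) =>
      (⟨x.1, mkGraph x.1 x.2⟩ : (n : ℕ) × SimpleGraph (Fin n))) (List.mem_of_getElem? hd)
    rw [oData_map] at hmem
    exact ⟨_, hmem, h.isMinorOf hc⟩
  next =>
    split at hc
    next s hs =>
      obtain ⟨h1, h2, h3⟩ := embedCheck_iff.1 hc
      exact hT s (List.mem_of_getElem? hs) V G _ (h.comp h1 h2 h3)
    next => cases hc

end Leaves

section Trees

open scoped Classical

/-- A case distinction on how the edges of a split set distribute to its two halves. -/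
inductive Tree
  | leaf (t lam : ℕ)
  | one (j : ℕ) (c₀ c₁ : Tree)
  | two (j : ℕ) (c₀ c₁ c₂ : Tree)
  | three (j : ℕ) (c₀ c₁ c₂ c₃ : Tree)

/-- Check a case distinction: the vertex `i` of the packed matrix `S` on `n` vertices is split
into `i` and `n`, and `N` collects the known edges. -/
def treeCheck (T : List (ℕ × ℕ)) (n S i : ℕ) : Tree → ℕ → Bool
  | .leaf t lam, N => leafCheck T (n + 1) (ent N) t lam
  | .one j c₀ c₁, N => nodeOK j N 1 && treeCheck T n S i c₀ (setEnt N n j 1) &&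
      treeCheck T n S i c₁ (setEnt N i j 1)
  | .two j c₀ c₁ c₂, N => nodeOK j N 2 && treeCheck T n S i c₀ (setEnt N n j 2) &&
      treeCheck T n S i c₁ (setEnt (setEnt N i j 1) n j 1) && treeCheck T n S i c₂ (setEnt N i j 2)
  | .three j c₀ c₁ c₂ c₃, N => nodeOK j N 3 && treeCheck T n S i c₀ (setEnt N n j 3) &&
      treeCheck T n S i c₁ (setEnt (setEnt N i j 1) n j 2) &&
      treeCheck T n S i c₂ (setEnt (setEnt N i j 2) n j 1) && treeCheck T n S i c₃ (setEnt N i j 3)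
where
  /-- The distribution of `μ` edges to `j` is undecided. -/
  nodeOK (j N μ : ℕ) : Bool :=
    Nat.blt j n && !(j == i) && ent N i j == 0 && ent N n j == 0 && Nat.ble μ (ent S i j)

lemma nodeOK_iff {n S i j N μ : ℕ} : treeCheck.nodeOK n S i j N μ = true ↔
    (((j < n ∧ j ≠ i) ∧ ent N i j = 0) ∧ ent N n j = 0) ∧ μ ≤ ent S i j := by
  simp only [treeCheck.nodeOK, Bool.and_eq_true, Nat.blt_eq, Nat.ble_eq, beq_iff_eq,
    Bool.not_eq_true', beq_eq_false_iff_ne, ne_eq]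

lemma hasObs_of_treeCheck {V : Type} {G : SimpleGraph V} {f : ℕ → Finset V} {n : ℕ}
    {T : List (ℕ × ℕ)} (hT : ∀ s ∈ T, Forces s) {S i : ℕ} (hi : i < n)
    (hS : ∀ j < n, j ≠ i → ent S i j ≤ cross G (f i) (f j) + cross G (f n) (f j)) (c : Tree) :
    ∀ N, Model G (n + 1) (ent N) f → treeCheck T n S i c N = true → HasObs G := by
  have hin : i < n + 1 := by omega
  have seti : ∀ {N j a}, Model G (n + 1) (ent N) f → j < n → j ≠ i → ent N i j = 0 → a < 16 →
      a ≤ cross G (f i) (f j) → Model G (n + 1) (ent (setEnt N i j a)) f :=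
    fun h hj hji h0 ha hc => h.set hin (by omega) hji.symm h0 ha hc
  have setn : ∀ {N j a}, Model G (n + 1) (ent N) f → j < n → ent N n j = 0 → a < 16 →
      a ≤ cross G (f n) (f j) → Model G (n + 1) (ent (setEnt N n j a)) f :=
    fun h hj h0 ha hc => h.set (by omega) (by omega) (by omega) h0 ha hc
  have both : ∀ {N j a b}, Model G (n + 1) (ent N) f → j < n → j ≠ i → ent N i j = 0 →
      ent N n j = 0 → a < 16 → b < 16 → a ≤ cross G (f i) (f j) → b ≤ cross G (f n) (f j) →
      Model G (n + 1) (ent (setEnt (setEnt N i j a) n j b)) f := by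
    intro N j a b h hj hji h0 h0' ha hb hca hcb
    refine setn (seti h hj hji h0 ha hca) hj ?_ hb hcb
    rw [ent_setEnt h0 ha, if_neg, h0']
    intro hp
    rcases pos_inj hp with ⟨h1, -⟩ | ⟨h1, -⟩ <;> omega
  induction c with
  | leaf t lam =>
    intro N h hc
    exact h.hasObs_of_leafCheck hT hc
  | one j c₀ c₁ ih₀ ih₁ =>
    intro N h hc
    simp only [treeCheck, Bool.and_eq_true, nodeOK_iff] at hc
    obtain ⟨⟨⟨⟨⟨⟨hj, hji⟩, hz⟩, hz'⟩, hμ⟩, hc₀⟩, hc₁⟩ := hc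
    have hsum := hS j hj hji
    by_cases h1 : 1 ≤ cross G (f i) (f j)
    · exact ih₁ _ (seti h hj hji hz (by norm_num) h1) hc₁
    · exact ih₀ _ (setn h hj hz' (by norm_num) (by omega)) hc₀
  | two j c₀ c₁ c₂ ih₀ ih₁ ih₂ =>
    intro N h hc
    simp only [treeCheck, Bool.and_eq_true, nodeOK_iff] at hc
    obtain ⟨⟨⟨⟨⟨⟨⟨hj, hji⟩, hz⟩, hz'⟩, hμ⟩, hc₀⟩, hc₁⟩, hc₂⟩ := hc
    have hsum := hS j hj hji
    by_cases h2 : 2 ≤ cross G (f i) (f j)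
    · exact ih₂ _ (seti h hj hji hz (by norm_num) h2) hc₂
    by_cases h1 : 1 ≤ cross G (f i) (f j)
    · exact ih₁ _ (both h hj hji hz hz' (by norm_num) (by norm_num) h1 (by omega)) hc₁
    · exact ih₀ _ (setn h hj hz' (by norm_num) (by omega)) hc₀
  | three j c₀ c₁ c₂ c₃ ih₀ ih₁ ih₂ ih₃ =>
    intro N h hc
    simp only [treeCheck, Bool.and_eq_true, nodeOK_iff] at hc
    obtain ⟨⟨⟨⟨⟨⟨⟨⟨hj, hji⟩, hz⟩, hz'⟩, hμ⟩, hc₀⟩, hc₁⟩, hc₂⟩, hc₃⟩ := hc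
    have hsum := hS j hj hji
    by_cases h3 : 3 ≤ cross G (f i) (f j)
    · exact ih₃ _ (seti h hj hji hz (by norm_num) h3) hc₃
    by_cases h2 : 2 ≤ cross G (f i) (f j)
    · exact ih₂ _ (both h hj hji hz hz' (by norm_num) (by norm_num) h2 (by omega)) hc₂
    by_cases h1 : 1 ≤ cross G (f i) (f j)
    · exact ih₁ _ (both h hj hji hz hz' (by norm_num) (by norm_num) h1 (by omega)) hc₁
    · exact ih₀ _ (setn h hj hz' (by norm_num) (by omega)) hc₀

end Trees

section Table

open scoped Classical

/-- Upper bound for the entries after splitting the vertex `u` into `u` and `n`, with `la` and `lb`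
excess edges inside the two halves, `m` edges between them, and `a` and `b` edges from them
to `v`. -/
def splitEnt (n S u v la lb m a b x y : ℕ) : ℕ :=
  bif x == n then
    bif y == n then lb else bif y == u then m else bif y == v then b else 0
  else bif x == u then
    bif y == n then m else bif y == u then la else bif y == v then a else 0
  else bif y == n then bif x == v then b else 0
  else bif y == u then bif x == v then a else 0
  else ent S x y

/-- Check one case of the splitting of the vertex `u`. -/
def kidCheck (T : List (ℕ × ℕ)) (n S u v la lb m a b : ℕ) (k : ℕ × Tree) : Bool :=
  allTo (fun x => allTo (fun y =>
    Nat.ble (ent k.1 x y) (splitEnt n S u v la lb m a b x y)) (n + 1)) (n + 1) &&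
  treeCheck T n S u k.2 k.1

lemma hasObs_of_kidCheck {V : Type} {G : SimpleGraph V} {f : ℕ → Finset V} {n S : ℕ}
    {T : List (ℕ × ℕ)} (hT : ∀ s ∈ T, Forces s) (h : Model G n (ent S) f)
    {u v la lb m a b : ℕ} {k : ℕ × Tree} (hc : kidCheck T n S u v la lb m a b k = true)
    (hu : u < n) {A B : Finset V} (hAB : A ∪ B = f u) (hdisj : Disjoint A B)
    (hA : (G.induce (A : Set V)).Connected) (hB : (G.induce (B : Set V)).Connected)
    (hm : m ≤ cross G A B) (ha : v < n → a ≤ cross G (f v) A) (hb : v < n → b ≤ cross G (f v) B)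
    (hla : 2 * la + 2 * #A ≤ cross G A A + 2) (hlb : 2 * lb + 2 * #B ≤ cross G B B + 2) :
    HasObs G := by
  simp only [kidCheck, Bool.and_eq_true, allTo_iff, Nat.ble_eq] at hc
  obtain ⟨hle, htree⟩ := hc
  have hnu := beq_false_of_ne hu.ne
  have hun := beq_false_of_ne hu.ne'
  have hn : ∀ {x}, x < n → (x == n) = false := fun hx => beq_false_of_ne hx.ne
  have hbnd : ∀ {x y c : ℕ}, x < n + 1 → y < n + 1 → splitEnt n S u v la lb m a b x y ≤ c →
      ent k.1 x y ≤ c := fun hx hy h => (hle _ hx _ hy).trans h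
  have hmodel : Model G (n + 1) (ent k.1) (splitAt f n u A B) := by
    refine h.split hu hAB hdisj hA hB ?_ ?_ ?_ ?_ ?_ ?_
    · intro x hx y hy hxu hyu
      refine hbnd (by omega) (by omega) ?_
      simp [splitEnt, hn hx, hn hy, beq_false_of_ne hxu, beq_false_of_ne hyu]
    · intro x hx hxu
      constructor <;>
      · refine hbnd (by omega) (by omega) ?_
        by_cases hxv : x = v
        · subst hxv
          simpa [splitEnt, hn hx, beq_false_of_ne hxu, hnu] using ha hx
        · simp [splitEnt, hn hx, beq_false_of_ne hxu, hnu, beq_false_of_ne hxv]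
    · intro x hx hxu
      constructor <;>
      · refine hbnd (by omega) (by omega) ?_
        by_cases hxv : x = v
        · subst hxv
          simpa [splitEnt, hn hx, beq_false_of_ne hxu, hun] using hb hx
        · simp [splitEnt, hn hx, beq_false_of_ne hxu, hun, beq_false_of_ne hxv]
    · constructor <;>
      · refine hbnd (by omega) (by omega) ?_
        simpa [splitEnt, hnu, hun] using hm
    · have : ent k.1 u u ≤ la := hbnd (by omega) (by omega) (by simp [splitEnt, hnu])
      omega
    · have : ent k.1 n n ≤ lb := hbnd (by omega) (by omega) (by simp [splitEnt])
      omega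
  refine hasObs_of_treeCheck hT hu (fun j hj hju => ?_) k.2 k.1 hmodel htree
  have h1 : splitAt f n u A B n = B := by simp [splitAt]
  have h2 : splitAt f n u A B u = A := by simp [splitAt, hu.ne]
  have h3 : splitAt f n u A B j = f j := by simp [splitAt, hj.ne, hju]
  rw [h1, h2, h3, ← cross_union_left hdisj, hAB]
  exact h.edge u hu j hj hju.symm

/-- A packed matrix `mat` on `n` vertices with a case distinction: with one or three cases, the
vertex `i` is split along a cycle; with two or four cases, one of `i` and `j` is split so that both
halves are adjacent to the other one. -/
structure State where
  n : ℕ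
  mat : ℕ
  i : ℕ
  j : ℕ
  kids : List (ℕ × Tree)

/-- Check the case distinction of a `State`. -/
def State.check (T : List (ℕ × ℕ)) (s : State) : Bool :=
  Nat.blt s.i s.n && Nat.blt s.j s.n &&
  match s.kids with
  | [k] => Nat.ble 1 (ent s.mat s.i s.i) && kidCheck T s.n s.mat s.i s.n 0 0 2 0 0 k
  | [k₀, k₁, k₂] => Nat.ble 2 (ent s.mat s.i s.i) && kidCheck T s.n s.mat s.i s.n 0 0 3 0 0 k₀ &&
      kidCheck T s.n s.mat s.i s.n 1 0 2 0 0 k₁ && kidCheck T s.n s.mat s.i s.n 0 1 2 0 0 k₂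
  | [k₀, k₁] => !(s.i == s.j) && Nat.ble 2 (ent s.mat s.i s.j) &&
      kidCheck T s.n s.mat s.i s.j 0 0 1 1 1 k₀ && kidCheck T s.n s.mat s.j s.i 0 0 1 1 1 k₁
  | [k₀, k₁, k₂, k₃] => !(s.i == s.j) && Nat.ble 3 (ent s.mat s.i s.j) &&
      kidCheck T s.n s.mat s.i s.j 0 0 1 1 2 k₀ && kidCheck T s.n s.mat s.i s.j 0 0 1 2 1 k₁ &&
      kidCheck T s.n s.mat s.j s.i 0 0 1 1 2 k₂ && kidCheck T s.n s.mat s.j s.i 0 0 1 2 1 k₃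
  | _ => false

/-- If two sets are joined by at least two edges, one of them can be split so that both halves are
adjacent to the other set. -/
lemma exists_split_of_two_le {V : Type} {G : SimpleGraph V} {A B : Finset V}
    (hA : (G.induce (A : Set V)).Connected) (hB : (G.induce (B : Set V)).Connected)
    (h : 2 ≤ cross G A B) :
    (∃ C D : Finset V, C ∪ D = A ∧ Disjoint C D ∧ (G.induce (C : Set V)).Connected ∧
      (G.induce (D : Set V)).Connected ∧ 0 < cross G B C ∧ 0 < cross G B D) ∨
    (∃ C D : Finset V, C ∪ D = B ∧ Disjoint C D ∧ (G.induce (C : Set V)).Connected ∧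
      (G.induce (D : Set V)).Connected ∧ 0 < cross G A C ∧ 0 < cross G A D) := by
  have hcard : cross G A B = #((A ×ˢ B).filter fun p => G.Adj p.1 p.2) := by
    rw [cross, ← Finset.sum_product', Finset.card_filter]
  rw [hcard] at h
  obtain ⟨⟨a, b⟩, hp, ⟨a', b'⟩, hq, hne⟩ := Finset.one_lt_card.1 h
  simp only [Finset.mem_filter, Finset.mem_product] at hp hq
  by_cases haa : a = a'
  · have hbb : b ≠ b' := by
      rintro rfl
      exact hne (by rw [haa])
    obtain ⟨C, D, h1, h2, h3, h4, h5, h6⟩ := exists_connected_split hB hp.1.2 hq.1.2 hbb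
    exact .inr ⟨C, D, h1, h2, h5, h6, cross_pos_iff.2 ⟨a, hp.1.1, b, h3, hp.2⟩,
      cross_pos_iff.2 ⟨a', hq.1.1, b', h4, hq.2⟩⟩
  · obtain ⟨C, D, h1, h2, h3, h4, h5, h6⟩ := exists_connected_split hA hp.1.1 hq.1.1 haa
    exact .inl ⟨C, D, h1, h2, h5, h6, cross_pos_iff.2 ⟨b, hp.1.2, a, h3, hp.2.symm⟩,
      cross_pos_iff.2 ⟨b', hq.1.2, a', h4, hq.2.symm⟩⟩

lemma State.forces {T : List (ℕ × ℕ)} (hT : ∀ s ∈ T, Forces s) {s : State}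
    (hs : s.check T = true) : Forces (s.n, s.mat) := by
  intro V G f h
  obtain ⟨n, M, i, j, kids⟩ := s
  simp only [State.check, Bool.and_eq_true, Nat.blt_eq] at hs
  simp only at h
  obtain ⟨⟨hi, hj⟩, hs⟩ := hs
  have cyc : 1 ≤ ent M i i → ∃ A B : Finset V, A ∪ B = f i ∧ Disjoint A B ∧
      (G.induce (A : Set V)).Connected ∧ (G.induce (B : Set V)).Connected ∧ 2 ≤ cross G A B ∧
      2 * #A ≤ cross G A A + 2 ∧ 2 * #B ≤ cross G B B + 2 ∧
      2 * ent M i i + 2 * #A + 2 * #B ≤ cross G A A + 2 * cross G A B + cross G B B + 2 := by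
    intro h1
    have hl := h.loop i hi
    obtain ⟨A, B, hAB, hd, hA, hB, h2⟩ := exists_cycle_split (h.conn i hi) (by omega)
    refine ⟨A, B, hAB, hd, hA, hB, h2, two_mul_card_le_of_connected hA,
      two_mul_card_le_of_connected hB, ?_⟩
    rw [← hAB, Finset.card_union_of_disjoint hd, cross_union_self hd] at hl
    omega
  have dbl : i ≠ j → 2 ≤ ent M i j →
      (∃ C D : Finset V, C ∪ D = f i ∧ Disjoint C D ∧ (G.induce (C : Set V)).Connected ∧
        (G.induce (D : Set V)).Connected ∧ 1 ≤ cross G C D ∧ 0 < cross G (f j) C ∧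
        0 < cross G (f j) D ∧ ent M i j ≤ cross G (f j) C + cross G (f j) D ∧
        2 * #C ≤ cross G C C + 2 ∧ 2 * #D ≤ cross G D D + 2) ∨
      (∃ C D : Finset V, C ∪ D = f j ∧ Disjoint C D ∧ (G.induce (C : Set V)).Connected ∧
        (G.induce (D : Set V)).Connected ∧ 1 ≤ cross G C D ∧ 0 < cross G (f i) C ∧
        0 < cross G (f i) D ∧ ent M i j ≤ cross G (f i) C + cross G (f i) D ∧
        2 * #C ≤ cross G C C + 2 ∧ 2 * #D ≤ cross G D D + 2) := by
    intro hij h2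
    have he := h.edge i hi j hj hij
    refine (exists_split_of_two_le (h.conn i hi) (h.conn j hj) (h2.trans he)).imp ?_ ?_
    · rintro ⟨C, D, hCD, hd, hC, hD, h3, h4⟩
      refine ⟨C, D, hCD, hd, hC, hD, cross_pos_of_connected (h.conn i hi) hCD hd
        (nonempty_of_connected hC) (nonempty_of_connected hD), h3, h4, ?_,
        two_mul_card_le_of_connected hC, two_mul_card_le_of_connected hD⟩
      rwa [← cross_union_right hd, hCD, cross_comm]
    · rintro ⟨C, D, hCD, hd, hC, hD, h3, h4⟩
      refine ⟨C, D, hCD, hd, hC, hD, cross_pos_of_connected (h.conn j hj) hCD hd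
        (nonempty_of_connected hC) (nonempty_of_connected hD), h3, h4, ?_,
        two_mul_card_le_of_connected hC, two_mul_card_le_of_connected hD⟩
      rwa [← cross_union_right hd, hCD]
  split at hs
  · simp only [Bool.and_eq_true, Nat.ble_eq] at hs
    obtain ⟨A, B, hAB, hd, hA, hB, h1, h2, h3, h4⟩ := cyc hs.1
    exact hasObs_of_kidCheck hT h hs.2 hi hAB hd hA hB h1 (by simp) (by simp) (by omega) (by omega)
  · simp only [Bool.and_eq_true, Nat.ble_eq] at hs
    obtain ⟨⟨⟨hl, c0⟩, c1⟩, c2⟩ := hs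
    obtain ⟨A, B, hAB, hd, hA, hB, h1, h2, h3, h4⟩ := cyc (by omega)
    by_cases h5 : 3 ≤ cross G A B
    · exact hasObs_of_kidCheck hT h c0 hi hAB hd hA hB h5 (by simp) (by simp) (by omega) (by omega)
    by_cases h6 : 2 * 1 + 2 * #A ≤ cross G A A + 2
    · exact hasObs_of_kidCheck hT h c1 hi hAB hd hA hB h1 (by simp) (by simp) h6 (by omega)
    · have : Even (cross G A A) := by rw [cross_induce]; exact even_two_mul _
      obtain ⟨q, hq⟩ := this
      exact hasObs_of_kidCheck hT h c2 hi hAB hd hA hB h1 (by simp) (by simp) (by omega) (by omega)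
  · simp only [Bool.and_eq_true, Nat.ble_eq, Bool.not_eq_true', beq_eq_false_iff_ne] at hs
    obtain ⟨⟨⟨hij, hl⟩, c0⟩, c1⟩ := hs
    rcases dbl hij hl with ⟨C, D, hCD, hd, hC, hD, h1, h2, h3, h4, h5, h6⟩ |
      ⟨C, D, hCD, hd, hC, hD, h1, h2, h3, h4, h5, h6⟩
    · exact hasObs_of_kidCheck hT h c0 hi hCD hd hC hD h1 (fun _ => h2) (fun _ => h3) (by omega)
        (by omega)
    · exact hasObs_of_kidCheck hT h c1 hj hCD hd hC hD h1 (fun _ => h2) (fun _ => h3) (by omega)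
        (by omega)
  · simp only [Bool.and_eq_true, Nat.ble_eq, Bool.not_eq_true', beq_eq_false_iff_ne] at hs
    obtain ⟨⟨⟨⟨⟨hij, hl⟩, c0⟩, c1⟩, c2⟩, c3⟩ := hs
    rcases dbl hij (by omega) with ⟨C, D, hCD, hd, hC, hD, h1, h2, h3, h4, h5, h6⟩ |
      ⟨C, D, hCD, hd, hC, hD, h1, h2, h3, h4, h5, h6⟩
    · by_cases h7 : 2 ≤ cross G (f j) C
      · exact hasObs_of_kidCheck hT h c1 hi hCD hd hC hD h1 (fun _ => h7) (fun _ => h3) (by omega)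
          (by omega)
      · exact hasObs_of_kidCheck hT h c0 hi hCD hd hC hD h1 (fun _ => h2)
          (fun _ => by omega) (by omega) (by omega)
    · by_cases h7 : 2 ≤ cross G (f i) C
      · exact hasObs_of_kidCheck hT h c3 hj hCD hd hC hD h1 (fun _ => h7) (fun _ => h3) (by omega)
          (by omega)
      · exact hasObs_of_kidCheck hT h c2 hj hCD hd hC hD h1 (fun _ => h2)
          (fun _ => by omega) (by omega) (by omega)
  · cases hs

/-- Check a list of states, each with respect to `T` and the preceding ones. -/
def checkStates : List (ℕ × ℕ) → List State → Bool
  | _, [] => true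
  | T, s :: l => s.check T && checkStates ((s.n, s.mat) :: T) l

lemma forces_of_checkStates (l : List State) : ∀ T : List (ℕ × ℕ), (∀ s ∈ T, Forces s) →
    checkStates T l = true → ∀ s ∈ l, Forces (s.n, s.mat) := by
  induction l with
  | nil => simp
  | cons s l ih =>
    intro T hT hc
    rw [checkStates, Bool.and_eq_true] at hc
    have hs := s.forces hT hc.1
    refine List.forall_mem_cons.2 ⟨hs, ih _ (List.forall_mem_cons.2 ⟨hs, hT⟩) hc.2⟩

end Table

/-- Case distinctions showing that a packed matrix forces one of the 33 graphs. -/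
def states : List State :=
  [
    ⟨8, 92558221341449340040027474059027814612992, 6, 5,
      [(397528445359451529139462079525838391739871305728000, .one 3 (.one 4 (.one 7 (.leaf 14
      26395308291) (.leaf 3 22082445570)) (.one 7 (.leaf 13 17500952416) (.leaf 13 13222885216)))
      (.one 4 (.one 7 (.leaf 13 17501075296) (.leaf 13 13222762336)) (.one 7 (.leaf 3 18558814063)
      (.leaf 14 14533331061)))), (397528445441119297201834189519789638341081316786176, .one 0 (.one
      7 (.leaf 14 18827249781) (.leaf 3 18558814052)) (.one 7 (.leaf 3 18558814053) (.leaf 14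
      14533331061)))]⟩,
    ⟨8, 98001409963831884609116481534848638386192, 7, 5,
      [(6009694732710117317545842059584364680120164704845840, .one 0 (.one 1 (.one 6 (.leaf 13
      4364391542) (.leaf 3 22585413750)) (.one 6 (.leaf 27 14517666116) (.leaf 27 26597261364)))
      (.one 1 (.one 6 (.leaf 27 14517665862) (.leaf 27 26597261379)) (.one 6 (.leaf 4 17820907280)
      (.leaf 13 337859702)))), (6009694732797229691726366491643848730491273389015056, .one 4 (.one 6
      (.leaf 13 8925697142) (.leaf 4 17804195088)) (.one 6 (.leaf 4 17820907024) (.leaf 13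
      337859702)))]⟩,
    ⟨7, 22901890877914862203045056348176, 5, 4, [(5784800240275435077563096713945224839184, .one 0
      (.one 1 (.one 6 (.leaf 34 1984110853) (.leaf 3 1380126838)) (.one 6 (.leaf 33 1732579378)
      (.leaf 33 1699152178))) (.one 1 (.one 6 (.leaf 33 1732575538) (.leaf 33 1699156018)) (.one 6
      (.leaf 3 1159951888) (.leaf 34 1447239943)))), (5784800258022543480777908000477386113040, .two
      6 (.leaf 34 1450385668) (.leaf 3 1159951888) (.leaf 34 1447239943))]⟩,
    ⟨8, 11251915005869701895834714708953679265792, 7, 5,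
      [(6009694732710117317545837436576473758487783470530560, .one 2 (.one 3 (.one 4 (.leaf 9
      1108576101) (.leaf 4 9751105663)) (.one 4 (.leaf 26 31175628560) (.leaf 26 19096040720)))
      (.one 3 (.one 4 (.leaf 26 31175627792) (.leaf 26 19096032528)) (.one 4 (.leaf 4 17804169343)
      (.leaf 9 17214703461)))), (6009694732710480196768404309006123674469788146466816, .one 0 (.one
      6 (.leaf 9 4332947301) (.leaf 3 18558842370)) (.one 6 (.leaf 3 18558842371) (.leaf 9
      17214703461)))]⟩,
    ⟨7, 1431368255427470557109844770816, 5, 3, [(5465785520098942244526542058694046187520, .one 0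
      (.one 4 (.leaf 33 1731469573) (.leaf 6 908411141)) (.one 4 (.leaf 6 908411138) (.leaf 33
      1697915143))), (5465785519940485995057030030925888552960, .two 6 (.leaf 33 1702109443) (.leaf
      3 1159804768) (.leaf 33 1697915143))]⟩,
    ⟨7, 22822972129556479726997198667776, 6, 4, [(87452568299948835790596891145349353242624, .one 1
      (.one 2 (.one 5 (.leaf 13 272775013) (.leaf 4 610488583)) (.one 5 (.leaf 27 907355200) (.leaf
      27 1662329920))) (.one 2 (.one 5 (.leaf 27 907354944) (.leaf 27 1662329904)) (.one 5 (.leaf 3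
      1159927648) (.leaf 13 21116773)))), (87452568320236506563857656205950975016960, .one 3 (.one 5
      (.leaf 13 557856613) (.leaf 4 1112760583)) (.one 5 (.leaf 4 1113805063) (.leaf 13
      21116773)))]⟩,
    ⟨6, 85316200350304954286080, 4, 0, [(1267669952799670851655363002368, .two 3 (.one 5 (.leaf 36
      106119201) (.leaf 34 90452496)) (.one 5 (.leaf 33 90391056) (.leaf 33 88302096)) (.one 5
      (.leaf 34 88486416) (.leaf 36 88285536))), (1267670028357543584768941162496, .leaf 36
      88285536)]⟩,
    ⟨8, 5465873829551590729140009127380655276032, 6, 5,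
      [(397528445359471467559398853263931949127250755977216, .one 2 (.one 4 (.leaf 17 13256099653)
      (.leaf 23 26394957327)) (.one 4 (.leaf 23 26394957060) (.leaf 17 22299018358))),
      (397528445354026949689936440208902173409434157449216, .one 0 (.one 7 (.leaf 17 9417262198)
      (.leaf 3 18558840933)) (.one 7 (.leaf 3 18558840933) (.leaf 17 22299018358)))]⟩,
    ⟨7, 1352140163749856400562555191296, 5, 0, [(5444523064384013958152231793764276895744, .two 4
      (.one 3 (.leaf 37 1984122913) (.leaf 33 1732587553)) (.one 3 (.leaf 26 1917018373) (.leaf 26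
      1114857733)) (.one 3 (.leaf 33 1699164193) (.leaf 37 1447260193))),
      (5444523064384014113990325728462568947712, .leaf 37 1447260193)]⟩,
    ⟨7, 1272641051047564244048706273280, 6, 0, [(87112291124057124529300607520414602625024, .one 2
      (.one 4 (.leaf 6 1630872656) (.leaf 23 560157744)) (.one 4 (.leaf 23 560223040) (.leaf 6
      372581456))), (87112291125329726889685978443010902327296, .leaf 6 372581456)]⟩,
    ⟨7, 1352140088191997160651378196480, 5, 0, [(5444523064384013958152236279767423320064, .one 3
      (.one 4 (.leaf 3 1383346438) (.leaf 4 1382297863)) (.one 4 (.leaf 4 1649684743) (.leaf 3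
      354695008))), (5444523064384014038432466488551391952896, .leaf 3 354695008)]⟩,
    ⟨6, 5314973220379599831040, 4, 2, [(1272602365700339340309109407744, .one 1 (.one 3 (.leaf 35
      106049856) (.leaf 34 90391056)) (.one 3 (.leaf 34 88302096) (.leaf 35 72495456))),
      (1272602365110048051142217170944, .two 5 (.leaf 35 72757536) (.leaf 33 72753936) (.leaf 35
      72495456))]⟩,
    ⟨7, 1351850017142075698937992380416, 5, 4, [(5784800239007803820147985650110666178560, .one 1
      (.one 2 (.leaf 26 654525973) (.leaf 6 908399680)) (.one 2 (.leaf 23 1649611856) (.leaf 26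
      119752213))), (5784800237740153220233346394267397980160, .one 3 (.one 6 (.leaf 26 924861973)
      (.leaf 4 1159946503)) (.one 6 (.leaf 4 1176719623) (.leaf 26 119752213)))]⟩,
    ⟨6, 80593833867439604039680, 4, 0, [(1267669948077304368790012755968, .two 3 (.one 5 (.leaf 40
      106112001) (.leaf 33 90383361)) (.one 5 (.leaf 27 51794436) (.leaf 27 36787776)) (.one 5
      (.leaf 33 88286721) (.leaf 40 72558081))), (1267670023635177101903590916096, .leaf 40
      72558081)]⟩,
    ⟨5, 5101742576369664, 3, 0, [(4723520002508594348032, .two 2 (.one 4 (.leaf 40 5513985) (.leaf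
      35 4534785)) (.one 4 (.leaf 33 5513985) (.leaf 33 3417345)) (.one 4 (.leaf 35 4411905) (.leaf
      40 3417345))), (4723524506116811653120, .leaf 40 3417345)]⟩,
    ⟨6, 315905294933629599744, 5, 0, [(20282428946465941982190006960128, .one 1 (.one 2 (.leaf 6
      101918016) (.leaf 23 35017536)) (.one 2 (.leaf 23 35017776) (.leaf 6 23274816))),
      (20282428946779536631443069337600, .leaf 6 23274816)]⟩,
    ⟨5, 582750289526784, 3, 1, [(4740813809684785922048, .two 2 (.leaf 37 4526640) (.leaf 33
      4534800) (.leaf 37 4395600)), (4740813792101189812224, .one 4 (.leaf 37 4411920) (.leaf 37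
      4395600))]⟩,
    ⟨5, 5068753435951104, 3, 1, [(4740813792092599943168, .one 2 (.one 4 (.leaf 36 5513520) (.leaf
      34 4526880)) (.one 4 (.leaf 34 4396320) (.leaf 36 3416400))), (4740818295696522215424, .one 2
      (.leaf 36 3417360) (.leaf 36 3416400))]⟩,
    ⟨4, 73551454208, 3, 3, [(9007199254880256, .two 1 (.one 2 (.leaf 36 270640) (.leaf 34 147760))
      (.one 2 (.leaf 33 147760) (.leaf 33 143680)) (.one 2 (.leaf 34 143680) (.leaf 36 205120)))]⟩,
    ⟨7, 1277863610866153524689408884736, 5, 2, [(5445847100008663937134383741104375726080, .one 0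
      (.one 3 (.leaf 44 1982083333) (.leaf 23 1649488902)) (.one 3 (.leaf 23 1649488901) (.leaf 44
      1445212423))), (5445847099998760421543620103279434792960, .two 6 (.leaf 44 1450455298) (.leaf
      3 1160188768) (.leaf 44 1445212423))]⟩,
    ⟨6, 76149312476478460395520, 3, 1, [(79537723673398159131870756864, .two 2 (.leaf 33 105988656)
      (.leaf 23 102847536) (.leaf 33 87298566)), (79537723673398141548274647040, .one 4 (.leaf 33
      87319041) (.leaf 33 87298566))]⟩,
    ⟨6, 5035965918301118267424, 1, 0, [(328832840454353362928795664, .one 5 (.leaf 23 37971201)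
      (.leaf 23 4416801)), (328832858901096337126719504, .one 4 (.leaf 23 36988176) (.leaf 23
      4416801))]⟩,
    ⟨5, 598142948999184, 3, 0, [(4723520002508594348048, .two 2 (.leaf 34 5259795) (.leaf 33
      2118465) (.leaf 34 3162645)), (4723520002517184282624, .one 1 (.leaf 34 3490320) (.leaf 34
      3162645))]⟩,
    ⟨6, 9741038612682494709760, 4, 1, [(1267960094979084556581132570624, .one 2 (.one 3 (.leaf 43
      106107396) (.leaf 23 52838736)) (.one 3 (.leaf 23 102973776) (.leaf 43 72552966))),
      (1267960094979089341655468216320, .one 3 (.leaf 43 72573441) (.leaf 43 72552966))]⟩,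
    ⟨5, 4523399443513344, 2, 1, [(313599172643915890688, .two 3 (.leaf 33 5517570) (.leaf 41
      4530960) (.leaf 33 2371845)), (313599155060319780864, .one 4 (.leaf 33 2372865) (.leaf 33
      2371845))]⟩,
    ⟨4, 69273264128, 3, 3, [(9007199254880256, .two 1 (.one 0 (.leaf 41 270595) (.leaf 35 270640))
      (.one 0 (.leaf 33 266755) (.leaf 33 201220)) (.one 0 (.leaf 35 205120) (.leaf 41 205060)))]⟩,
    ⟨6, 80576535838135255306240, 3, 1, [(79537723378250534327983017984, .one 4 (.one 5 (.leaf 27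
      51724896) (.leaf 23 102973776)) (.one 5 (.leaf 6 90452256) (.leaf 27 3479076))),
      (79537728100621503205069557760, .one 4 (.leaf 27 37033476) (.leaf 27 3479076))]⟩,
    ⟨5, 4803771133599744, 2, 0, [(296305348975821590528, .one 3 (.one 4 (.leaf 33 5517330) (.leaf 44
      3278145)) (.one 4 (.leaf 44 3474465) (.leaf 33 2371605))), (296305629355581640704, .one 4
      (.leaf 33 2372880) (.leaf 33 2371605))]⟩,
    ⟨4, 73551388688, 3, 3, [(9007199254814736, .two 1 (.one 2 (.leaf 43 270595) (.leaf 36 136240))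
      (.one 2 (.leaf 33 82480) (.leaf 33 78400)) (.one 2 (.leaf 36 136000) (.leaf 43 205060)))]⟩,
    ⟨3, 1122592, 1, 1, [(537927680, .two 0 (.one 2 (.leaf 43 8961) (.leaf 36 8961)) (.one 2 (.leaf
      33 8961) (.leaf 33 8451)) (.one 2 (.leaf 36 8451) (.leaf 43 8451)))]⟩,
    ⟨8, 98362876900668323321654697268276885454848, 7, 5,
      [(6009694732710117317544574737736715116821137965711360, .one 0 (.one 3 (.one 4 (.one 6 (.leaf
      8 10539305046) (.leaf 7 9483388658)) (.one 6 (.leaf 24 4887574080) (.leaf 19 22080008437)))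
      (.one 4 (.one 6 (.leaf 24 4887901760) (.leaf 19 22080069877)) (.one 6 (.leaf 5 17803841383)
      (.leaf 7 13509920501)))) (.one 3 (.one 4 (.one 6 (.leaf 7 9483388661) (.leaf 5 9750775543))
      (.one 6 (.leaf 19 22080085764) (.leaf 24 8914040384))) (.one 4 (.one 6 (.leaf 19 22080205042)
      (.leaf 24 8914433600)) (.one 6 (.leaf 7 13509922658) (.leaf 8 30671964246))))),
      (6009694732797591158663202930431631215301362897125376, .one 1 (.one 2 (.one 6 (.leaf 8
      17773430871) (.leaf 7 22082029122)) (.one 6 (.leaf 7 22082028655) (.leaf 7 13509920319)))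
      (.one 2 (.one 6 (.leaf 7 22082029135) (.leaf 7 13509919589)) (.one 6 (.leaf 7 13509920111)
      (.leaf 8 30671964246))))]⟩,
    ⟨8, 92897174479027943728550245009037939703808, 6, 5,
      [(397528445359790482278387233149280721249836157894656, .one 0 (.one 1 (.one 7 (.leaf 24
      14228287844) (.leaf 7 22601076837)) (.one 7 (.leaf 7 22601073206) (.leaf 7 14296420451)))
      (.one 1 (.one 7 (.leaf 7 22601076836) (.leaf 20 1094017858)) (.one 7 (.leaf 20 1094017858)
      (.leaf 24 1393698660)))), (397528445441458250339412793132460550581502372478976, .one 2 (.one 4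
      (.one 7 (.leaf 24 5687636324) (.leaf 7 10002501702)) (.one 7 (.leaf 16 17450611807) (.leaf 16
      8862769909))) (.one 4 (.one 7 (.leaf 16 17450611551) (.leaf 19 18556928243)) (.one 7 (.leaf 20
      1094017825) (.leaf 24 1393698660))))]⟩,
    ⟨7, 20366899091614289766296458428416, 4, 3, [(361550035220396133486257056079249735680, .one 0
      (.one 5 (.leaf 5 1380331783) (.leaf 6 911360259)) (.one 5 (.leaf 6 911360258) (.leaf 5
      1648701703))), (361550035141168041807489962629895618560, .one 5 (.one 6 (.leaf 5 1110798598)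
      (.leaf 6 911360271)) (.one 6 (.leaf 6 1447239940) (.leaf 5 1648701703)))]⟩,
    ⟨7, 43184300406008668919769681887232, 6, 4, [(87452568299948835785892966921649766006784, .two 5
      (.one 2 (.one 3 (.leaf 35 1951604998) (.leaf 34 1165373968)) (.one 3 (.leaf 34 1165370128)
      (.leaf 33 105214752))) (.one 2 (.one 3 (.leaf 7 592711926) (.leaf 19 1380000752)) (.one 3
      (.leaf 19 1380004848) (.leaf 7 844370166))) (.one 2 (.one 3 (.leaf 33 121987872) (.leaf 34
      1164387088)) (.one 3 (.leaf 34 1164390928) (.leaf 35 1683169543)))),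
      (87452568340597834840309849883631387934720, .one 0 (.one 1 (.one 5 (.leaf 35 1733501188)
      (.leaf 7 1380126821)) (.one 5 (.leaf 7 1380126774) (.leaf 7 844370019))) (.one 1 (.one 5
      (.leaf 7 1380126820) (.leaf 7 844370006)) (.one 5 (.leaf 7 844369990) (.leaf 35
      1683169543))))]⟩,
    ⟨6, 160874064075119782854656, 4, 3, [(1346878772500825857682244173824, .two 5 (.one 0 (.leaf 33
      90382656) (.leaf 61 87441936)) (.one 0 (.leaf 7 86196486) (.leaf 7 52773126)) (.one 0 (.leaf
      61 87319056) (.leaf 33 88285536))), (1346878914171820344871095435264, .two 5 (.one 0 (.leaf 33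
      90448176) (.leaf 61 88486416)) (.one 0 (.leaf 7 86257926) (.leaf 7 52773126)) (.one 0 (.leaf
      61 88302096) (.leaf 33 88285536)))]⟩,
    ⟨6, 80594987068220164276240, 4, 3, [(1346878767779612296321483931664, .one 2 (.one 5 (.leaf 7
      86393616) (.leaf 6 56960016)) (.one 5 (.leaf 6 90383376) (.leaf 7 103105296))),
      (1346878838615109820836843880464, .one 2 (.one 5 (.leaf 7 86270736) (.leaf 6 56775696)) (.one
      5 (.leaf 6 90383376) (.leaf 7 103105296)))]⟩,
    ⟨6, 85022201423785806004240, 4, 2, [(1272602369849703835393178206224, .one 3 (.one 5 (.leaf 63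
      90382596) (.leaf 6 56967696)) (.one 5 (.leaf 6 90391056) (.leaf 63 88285446))),
      (1272602445407572064902834028560, .one 3 (.leaf 63 88301826) (.leaf 63 88285446))]⟩,
    ⟨5, 9588853790736400, 3, 2, [(5312662874874296926224, .two 4 (.leaf 35 4530435) (.leaf 34
      4530960) (.leaf 33 4338960)), (5017514969699239067664, .two 4 (.leaf 33 4346640) (.leaf 34
      4400400) (.leaf 35 4399365)), (9739889896813890633744, .two 4 (.leaf 35 4534530) (.leaf 34
      4534800) (.leaf 33 4400400)), (5017523413948540387344, .two 4 (.leaf 33 4411920) (.leaf 34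
      4400400) (.leaf 35 4399365))]⟩,
    ⟨7, 21634259620499751156806961856512, 5, 4, [(5784800239007803820147985667707130347520, .one 0
      (.one 1 (.one 6 (.leaf 24 828712768) (.leaf 20 319051299)) (.one 6 (.leaf 26 843538768) (.leaf
      20 51664416))) (.one 1 (.one 6 (.leaf 7 1379143779) (.leaf 13 824473168)) (.one 6 (.leaf 7
      844370018) (.leaf 24 1630873408)))), (5784800258022562823591021834544181411840, .one 1 (.one 3
      (.one 6 (.leaf 24 1362503488) (.leaf 20 1125144099)) (.one 6 (.leaf 19 1411452978) (.leaf 27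
      588604419))) (.one 3 (.one 6 (.leaf 27 1393714191) (.leaf 19 1380012815)) (.one 6 (.leaf 20
      51664431) (.leaf 24 1630873408))))]⟩,
    ⟨7, 1352159506561821799127890067456, 5, 4, [(5784800239008113305157806995179374182400, .one 0
      (.one 3 (.leaf 7 1382297858) (.leaf 6 1446134021)) (.one 3 (.leaf 6 911360261) (.leaf 7
      1649684738))), (5784800237740462709653092494457295667200, .one 3 (.one 6 (.leaf 7 1380331780)
      (.leaf 6 908411151)) (.one 6 (.leaf 6 1446134031) (.leaf 7 1649684738)))]⟩,
    ⟨7, 21555340947698074963977007333376, 5, 4, [(5784800238928885142643542657585847009280, .one 3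
      (.one 6 (.leaf 7 1382297859) (.leaf 6 911360262)) (.one 6 (.leaf 6 1446134020) (.leaf 7
      1649684738))), (5784800257943644150789345659306412933120, .one 3 (.one 6 (.leaf 7 1380331779)
      (.leaf 6 908411140)) (.one 6 (.leaf 6 1446134022) (.leaf 7 1649684738)))]⟩,
    ⟨7, 21555340872141368663166901354496, 4, 3, [(361550035141187313785106552552501084160, .one 5
      (.one 6 (.leaf 13 1092958048) (.leaf 6 911483142)) (.one 6 (.leaf 6 1447239951) (.leaf 13
      1361327968))), (361550036408837984848833197093882494976, .one 5 (.leaf 13 824465248) (.leaf 13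
      1361327968))]⟩,
    ⟨6, 5037123359894000373760, 4, 3, [(1346878767779612296317457403904, .one 1 (.one 2 (.leaf 20
      70391046) (.leaf 23 102977856)) (.one 2 (.leaf 23 52842816) (.leaf 20 36967686))),
      (1346878763057246112514706509824, .one 1 (.one 5 (.leaf 20 20194566) (.leaf 6 56774976)) (.one
      5 (.leaf 6 90382656) (.leaf 20 36967686)))]⟩,
    ⟨6, 80576540060259637596160, 4, 3, [(1346878767761165552243747917824, .one 1 (.one 5 (.leaf 19
      88285456) (.leaf 23 103043376)) (.one 5 (.leaf 23 69620016) (.leaf 19 54862096))),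
      (1346878838596662812880343732224, .one 1 (.one 5 (.leaf 19 88224016) (.leaf 23 103104816))
      (.one 5 (.leaf 23 69620016) (.leaf 19 54862096)))]⟩,
    ⟨6, 80594991291444326629376, 4, 3, [(1426106930293876633915027947520, .one 0 (.one 5 (.leaf 38
      90382656) (.leaf 37 90391056)) (.one 5 (.leaf 36 90391056) (.leaf 35 88302096))),
      (1346878767779616799921111367680, .one 0 (.one 5 (.leaf 35 90391056) (.leaf 36 88302096))
      (.one 5 (.leaf 37 88302096) (.leaf 38 88285536))), (2614529438843338941958082068480, .one 2
      (.one 5 (.leaf 38 88482096) (.leaf 34 5653041)) (.one 5 (.leaf 33 5653041) (.leaf 50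
      5456481))), (1346878838615114044061006233600, .one 2 (.one 5 (.leaf 50 5653041) (.leaf 33
      5517921)) (.one 5 (.leaf 34 5456481) (.leaf 38 88285536)))]⟩,
    ⟨6, 80299838899158020853760, 4, 3, [(1346878767484464391142131175424, .one 1 (.one 5 (.leaf 16
      21299762) (.leaf 30 52773121)) (.one 5 (.leaf 30 86196482) (.leaf 19 54862096))),
      (1346878838319961651774700457984, .one 2 (.one 5 (.leaf 16 20992804) (.leaf 30 69423361))
      (.one 5 (.leaf 30 86196481) (.leaf 19 54862096)))]⟩,
    ⟨6, 80593834146711530901520, 4, 3, [(1346878767778459374812850556944, .one 2 (.one 5 (.leaf 16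
      21300002) (.leaf 30 69546240)) (.one 5 (.leaf 30 86257920) (.leaf 16 88146722))),
      (1346878838613956899332237037584, .one 1 (.one 5 (.leaf 16 20992563) (.leaf 30 52711681))
      (.one 5 (.leaf 30 86257921) (.leaf 16 88146722)))]⟩,
    ⟨5, 4821363588075520, 4, 1, [(75576310487585319292928, .one 0 (.one 2 (.one 3 (.leaf 35 5321220)
      (.leaf 37 5444160)) (.one 3 (.leaf 34 5321280) (.leaf 33 4395600))) (.one 2 (.one 3 (.leaf 33
      5444160) (.leaf 34 4272720)) (.one 3 (.leaf 37 4395600) (.leaf 35 4272645)))),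
      (75576315273758629695488, .three 3 (.leaf 35 4534785) (.leaf 44 4534560) (.leaf 44 4396320)
      (.leaf 35 4272645))]⟩,
    ⟨7, 21555031311592130617732807786496, 4, 3, [(361550035140877828793731951557754224640, .one 2
      (.one 6 (.leaf 17 840369733) (.leaf 18 826409814)) (.one 6 (.leaf 18 826409558) (.leaf 17
      1110508918))), (361550036408528424299595151659520491520, .one 1 (.one 5 (.leaf 17 824210533)
      (.leaf 18 873473302)) (.one 5 (.leaf 18 873473318) (.leaf 17 1110508918)))]⟩,
    ⟨7, 1351850017142071196442423197696, 5, 4, [(5784800239007803820147981147615096995840, .one 1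
      (.one 2 (.leaf 18 275001877) (.leaf 30 1110773778)) (.one 2 (.leaf 30 843386959) (.leaf 18
      1359229494))), (5784800237740153220233346394271944540160, .one 0 (.one 6 (.leaf 18 1090859526)
      (.leaf 15 1359229445)) (.one 6 (.leaf 15 1359229492) (.leaf 18 1359229494)))]⟩,
    ⟨6, 85021044016273774612480, 4, 2, [(1272602369848550913888588140544, .one 1 (.one 5 (.leaf 34
      103100676) (.leaf 33 39019536)) (.one 5 (.leaf 33 39011856) (.leaf 34 69546246))),
      (1272602445406414657390802632704, .one 0 (.one 3 (.leaf 34 73740546) (.leaf 33 70607361))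
      (.one 3 (.leaf 33 70592001) (.leaf 34 69546246)))]⟩,
    ⟨6, 75872620304975322480640, 4, 3, [(1346878763057245813452107218944, .one 0 (.one 5 (.leaf 18
      68485926) (.leaf 15 85197601)) (.one 5 (.leaf 15 85197601) (.leaf 18 85197606))),
      (1346878838615109540461378863104, .one 1 (.one 2 (.leaf 18 17064741) (.leaf 30 52773135))
      (.one 2 (.leaf 30 69546255) (.leaf 18 85197606)))]⟩,
    ⟨5, 5067649646198784, 2, 1, [(313599153952755089408, .two 4 (.leaf 34 4411650) (.leaf 33
      4396320) (.leaf 34 4399365)), (313599716902171639808, .two 3 (.leaf 34 3428865) (.leaf 33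
      3417360) (.leaf 34 4399365))]⟩,
    ⟨5, 4803770882064384, 2, 1, [(313599171544672698368, .one 3 (.one 4 (.leaf 19 4530195) (.leaf 16
      2163525)) (.one 4 (.leaf 16 3211845) (.leaf 19 336915))), (313599435431489896448, .one 3 (.one
      4 (.leaf 19 4530435) (.leaf 16 2163765)) (.one 4 (.leaf 16 3212325) (.leaf 19 336915)))]⟩,
    ⟨4, 9160556544, 3, 0, [(4504699155972096, .two 1 (.two 2 (.leaf 49 270640) (.leaf 39 271120)
      (.leaf 34 213520)) (.two 2 (.leaf 39 267040) (.leaf 33 274960) (.leaf 39 201760)) (.two 2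
      (.leaf 34 274960) (.leaf 39 205840) (.leaf 49 205120))), (4504708282777600, .leaf 49
      205120)]⟩,
    ⟨5, 301270783033344, 3, 0, [(4723519705640454914048, .one 1 (.one 2 (.leaf 36 5259795) (.leaf 30
      2298960)) (.one 2 (.leaf 30 2299200) (.leaf 36 3162645))), (4723519703445995061248, .two 4
      (.leaf 36 3490320) (.leaf 15 3212610) (.leaf 36 3162645))]⟩,
    ⟨5, 4803775160127504, 3, 2, [(5017514688219967393808, .one 1 (.one 4 (.leaf 16 1331250) (.leaf
      30 4346640)) (.one 4 (.leaf 30 5391120) (.leaf 16 5509170))), (5017518910344886485008, .one 0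
      (.one 4 (.leaf 16 1312035) (.leaf 30 3294480)) (.one 4 (.leaf 30 5391120) (.leaf 16
      5509170)))]⟩,
    ⟨4, 4865593344, 3, 0, [(4504699155976192, .two 1 (.one 2 (.leaf 42 270355) (.leaf 34 271105))
      (.one 2 (.leaf 33 270595) (.leaf 33 205060)) (.one 2 (.leaf 34 205825) (.leaf 42 204820))),
      (4504703987810304, .one 2 (.leaf 42 205840) (.leaf 42 204820))]⟩,
    ⟨4, 9126813728, 1, 0, [(18700287614992, .two 3 (.leaf 38 262945) (.leaf 35 197650) (.leaf 38
      66340)), (18700824477712, .two 2 (.leaf 38 82720) (.leaf 35 136195) (.leaf 38 66340))]⟩,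
    ⟨4, 8875216928, 1, 0, [(18700304388112, .one 2 (.one 3 (.leaf 38 262945) (.leaf 35 12820)) (.one
      3 (.leaf 35 12865) (.leaf 38 66340))), (18700556107792, .one 2 (.one 3 (.leaf 38 267040)
      (.leaf 35 78340)) (.one 3 (.leaf 35 78400) (.leaf 38 66340)))]⟩,
    ⟨3, 1187888, 2, 2, [(8589934640, .two 0 (.two 1 (.leaf 38 12546) (.leaf 35 12546) (.leaf 34
      8976)) (.two 1 (.leaf 35 12306) (.leaf 33 12816) (.leaf 35 8211)) (.two 1 (.leaf 34 12816)
      (.leaf 35 8451) (.leaf 38 8451)))]⟩,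
    ⟨8, 92579488989386850529727382459480302157824, 6, 5,
      [(397528445359472796787394638255381158619224196775936, .one 2 (.one 3 (.one 4 (.one 7 (.leaf
      25 18088035696) (.leaf 22 18088023024)) (.one 7 (.leaf 24 22315230223) (.leaf 19
      22079874047))) (.one 4 (.one 7 (.leaf 22 18088027632) (.leaf 19 18556663295)) (.one 7 (.leaf
      19 22079874047) (.leaf 22 26895995935)))) (.one 3 (.one 4 (.one 7 (.leaf 22 18088022799)
      (.leaf 19 18556670975)) (.one 7 (.leaf 19 22079878399) (.leaf 22 26895992305))) (.one 4 (.one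
      7 (.leaf 19 18556670975) (.leaf 24 9480659983)) (.one 7 (.leaf 22 26895988209) (.leaf 25
      31190975841))))), (397528445441140564849771699933913236271545771360256, .one 0 (.one 1 (.one 4
      (.one 7 (.leaf 25 18025115781) (.leaf 22 18025148485)) (.one 7 (.leaf 24 22299537508) (.leaf
      19 22079930147))) (.one 4 (.one 7 (.leaf 22 18025148517) (.leaf 19 22583443205)) (.one 7
      (.leaf 19 22079885091) (.leaf 22 26895998742)))) (.one 1 (.one 4 (.one 7 (.leaf 22
      18025087574) (.leaf 19 22583439936)) (.one 7 (.leaf 19 22079927345) (.leaf 22 26895998817)))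
      (.one 4 (.one 7 (.leaf 19 22583443264) (.leaf 24 9417723748)) (.one 7 (.leaf 22 26896037138)
      (.leaf 25 31190975841)))))]⟩,
    ⟨7, 1352159506580268824676576264192, 5, 4, [(5784800239008113305157807276654350827520, .one 0
      (.one 1 (.one 3 (.leaf 22 1125277765) (.leaf 16 271855365)) (.one 3 (.leaf 32 557858578)
      (.leaf 32 1108357156))) (.one 1 (.one 3 (.leaf 32 557858593) (.leaf 32 1108357697)) (.one 3
      (.leaf 16 553926480) (.leaf 22 70410549)))), (5784800237740462709671539238531005153280, .one 2
      (.one 3 (.one 6 (.leaf 22 1126262018) (.leaf 32 553923056)) (.one 6 (.leaf 16 272835919)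
      (.leaf 32 1108358385))) (.one 3 (.one 6 (.leaf 32 553923615) (.leaf 16 557856241)) (.one 6
      (.leaf 32 1108357663) (.leaf 22 70410549))))]⟩,
    ⟨7, 21555340947716521709154506637312, 5, 4, [(5784800238928885142643542658689636761600, .one 1
      (.one 3 (.one 6 (.leaf 22 1125279312) (.leaf 32 557855535)) (.one 6 (.leaf 16 271852127)
      (.leaf 32 1108357711))) (.one 3 (.one 6 (.leaf 32 557855567) (.leaf 16 553922911)) (.one 6
      (.leaf 32 1108357920) (.leaf 22 70411857)))), (5784800257943644150807792403384400609280, .one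
      0 (.one 3 (.one 6 (.leaf 22 1126261509) (.leaf 32 553923570)) (.one 6 (.leaf 16 272835317)
      (.leaf 32 1108358132))) (.one 3 (.one 6 (.leaf 32 553923332) (.leaf 16 557855733)) (.one 6
      (.leaf 32 1108358130) (.leaf 22 70411857))))]⟩,
    ⟨6, 75872616082854966722560, 3, 2, [(84179998544017437943916396544, .one 1 (.one 4 (.leaf 19
      72483139) (.leaf 16 51389461)) (.one 4 (.leaf 16 34616373) (.leaf 19 5390675))),
      (84179998248873754889482665984, .one 4 (.one 5 (.leaf 19 72486931) (.leaf 16 34620229)) (.one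
      5 (.leaf 16 51397141) (.leaf 19 5390675)))]⟩,
    ⟨6, 5037118857402206126080, 3, 2, [(84179922986153729621779021824, .one 4 (.one 5 (.leaf 19
      72483155) (.leaf 16 34616400)) (.one 5 (.leaf 16 51389521) (.leaf 19 5390642))),
      (84179927413376529436722069504, .one 4 (.one 5 (.leaf 19 72486947) (.leaf 16 34620240)) (.one
      5 (.leaf 16 51397125) (.leaf 19 5390642)))]⟩,
    ⟨7, 21555340872159815688715587551232, 4, 3, [(361550035141187313803553296626210570240, .one 2
      (.one 5 (.one 6 (.leaf 24 324477028) (.leaf 16 1090725109)) (.one 6 (.leaf 18 335750751)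
      (.leaf 16 822354709))) (.one 5 (.one 6 (.leaf 16 1090724191) (.leaf 18 873473526)) (.one 6
      (.leaf 16 822355189) (.leaf 24 1934696548)))), (361550036408837984867280222642568691712, .one
      5 (.leaf 24 592539748) (.leaf 24 1934696548))]⟩,
    ⟨7, 21634569186065346447756280987648, 5, 4, [(6125082605929051768621177117703212630016, .one 2
      (.one 3 (.one 6 (.leaf 38 1732588048) (.leaf 37 108286002)) (.one 6 (.leaf 36 108286752)
      (.leaf 35 6648867))) (.one 3 (.one 6 (.leaf 36 108286512) (.leaf 35 6648882)) (.one 6 (.leaf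
      34 6648882) (.leaf 33 106197042)))), (5784800239008113380715666236185767837696, .one 2 (.one 3
      (.one 6 (.leaf 33 108286002) (.leaf 34 7754802)) (.one 6 (.leaf 35 6771762) (.leaf 36
      106197552))) (.one 3 (.one 6 (.leaf 35 6771747) (.leaf 36 106197792)) (.one 6 (.leaf 37
      106197042) (.leaf 38 1699164688)))), (11229318128757887729012751620987584249856, .one 0 (.one
      1 (.one 6 (.leaf 38 1733562418) (.leaf 37 108347920)) (.one 6 (.leaf 36 108347650) (.leaf 35
      6583553))) (.one 1 (.one 6 (.leaf 36 108347410) (.leaf 35 6583568)) (.one 6 (.leaf 34 6583568)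
      (.leaf 33 105214480)))), (5784800258022872389156621627993616285696, .one 0 (.one 1 (.one 6
      (.leaf 33 108347920) (.leaf 34 7754768)) (.one 6 (.leaf 35 6767888) (.leaf 36 106197025)))
      (.one 1 (.one 6 (.leaf 35 6767873) (.leaf 36 106197280)) (.one 6 (.leaf 37 105214480) (.leaf
      38 1699164688))))]⟩,
    ⟨7, 21629617345352431244658880806912, 5, 4, [(5784800239003161545000665755559049297920, .one 0
      (.one 1 (.one 6 (.leaf 24 889268068) (.leaf 20 335762962)) (.one 6 (.leaf 20 335763010) (.leaf
      20 68376100))) (.one 1 (.one 6 (.leaf 20 335762980) (.leaf 7 893521974)) (.one 6 (.leaf 7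
      893522006) (.leaf 24 87107428)))), (5784800258017920548443701658513309696000, .one 2 (.one 3
      (.one 6 (.leaf 24 355477348) (.leaf 20 873486066)) (.one 6 (.leaf 19 1159794751) (.leaf 16
      553923573))) (.one 3 (.one 6 (.leaf 16 1090663413) (.leaf 16 553923423)) (.one 6 (.leaf 20
      68376111) (.leaf 24 87107428))))]⟩,
    ⟨7, 21629617345629132141881733414912, 5, 4, [(5784800239003161545000665491676258631680, .one 0
      (.one 2 (.one 6 (.leaf 22 1125279237) (.leaf 32 557855473)) (.one 6 (.leaf 16 271852037)
      (.leaf 32 1108357618))) (.one 2 (.one 6 (.leaf 32 557855732) (.leaf 16 553923317)) (.one 6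
      (.leaf 32 1108358129) (.leaf 22 70411797)))), (5784800258017920548720402819618952970240, .one
      1 (.one 3 (.one 6 (.leaf 22 1126262352) (.leaf 32 553923359)) (.one 6 (.leaf 16 272835679)
      (.leaf 32 1108357967))) (.one 3 (.one 6 (.leaf 32 553922639) (.leaf 16 557855583)) (.one 6
      (.leaf 32 1108357935) (.leaf 22 70411797))))]⟩,
    ⟨6, 85317357791906157821952, 5, 3, [(20361637770888314773905315201024, .one 0 (.one 1 (.one 2
      (.one 4 (.leaf 35 105058386) (.leaf 40 105075216)) (.one 4 (.leaf 34 105075216) (.leaf 19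
      88215635))) (.one 2 (.one 4 (.leaf 33 105074976) (.leaf 19 72486964)) (.one 4 (.leaf 19
      88215619) (.leaf 33 88301601)))) (.one 1 (.one 2 (.one 4 (.leaf 33 105074721) (.leaf 19
      72486947)) (.one 4 (.leaf 19 88215602) (.leaf 33 88301856))) (.one 2 (.one 4 (.leaf 19
      72486947) (.leaf 34 88302096)) (.one 4 (.leaf 40 88302096) (.leaf 35 88281186))))),
      (20361637846760912559774130765824, .three 4 (.one 2 (.leaf 35 90452496) (.leaf 58 5530400))
      (.one 2 (.leaf 40 88486416) (.leaf 49 341570)) (.one 2 (.leaf 49 414770) (.leaf 40 88302096))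
      (.one 2 (.leaf 58 5518880) (.leaf 35 88281186)))]⟩,
    ⟨6, 5037123079522561884160, 4, 3, [(1346878767779612296321483997184, .one 0 (.one 1 (.leaf 16
      21299764) (.leaf 30 86196482)) (.one 1 (.leaf 30 52773122) (.leaf 16 88146484))),
      (1346878763057245832139241488384, .one 2 (.one 5 (.leaf 16 20992800) (.leaf 30 69423375))
      (.one 5 (.leaf 30 86196495) (.leaf 16 88146484)))]⟩,
    ⟨6, 9759489843867183742976, 4, 3, [(1346878772501978779191129145344, .one 0 (.one 1 (.one 2
      (.leaf 42 106112016) (.leaf 16 16990800)) (.one 2 (.leaf 32 34865938) (.leaf 32 69272356)))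
      (.one 1 (.one 2 (.leaf 32 34865940) (.leaf 32 69272385)) (.one 2 (.leaf 16 34620240) (.leaf 42
      72558096)))), (1346878763057246113614218133504, .two 5 (.one 2 (.leaf 42 72753936) (.leaf 33
      4547360)) (.one 2 (.leaf 32 34620401) (.leaf 32 69272562)) (.one 2 (.leaf 33 4535840) (.leaf
      42 72558096)))]⟩,
    ⟨6, 80593833866336065884160, 4, 3, [(1346878767778459374812850622464, .one 0 (.one 5 (.leaf 16
      21300001) (.leaf 30 69546241)) (.one 5 (.leaf 30 86257921) (.leaf 16 88146721))),
      (1346878838613956618956772020224, .one 1 (.one 5 (.leaf 16 20992560) (.leaf 30 52711684))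
      (.one 5 (.leaf 30 86257921) (.leaf 16 88146721)))]⟩,
    ⟨6, 85022205647009968357376, 4, 3, [(1346878772206830874011776385024, .one 0 (.one 2 (.one 5
      (.leaf 37 106111296) (.leaf 32 34865970)) (.one 5 (.leaf 16 16990725) (.leaf 32 69272356)))
      (.one 2 (.one 5 (.leaf 32 34865972) (.leaf 16 34620213)) (.one 5 (.leaf 32 69272369) (.leaf 37
      72556896)))), (1346878838319961916757002747904, .two 5 (.one 2 (.leaf 37 72753456) (.leaf 33
      4547121)) (.one 2 (.leaf 32 34620223) (.leaf 32 69272383)) (.one 2 (.leaf 33 4534881) (.leaf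
      37 72556896)))]⟩,
    ⟨6, 80594986805441180205056, 3, 2, [(84179998544017174061125730304, .two 4 (.one 5 (.leaf 39
      88482576) (.leaf 56 5530400)) (.one 5 (.leaf 16 68166645) (.leaf 16 34620241)) (.one 5 (.leaf
      56 5518880) (.leaf 39 88286736))), (84180002971244758950672859136, .one 5 (.leaf 39 88302096)
      (.leaf 39 88286736))]⟩,
    ⟨5, 4821371389542400, 4, 1, [(75576310487593120759808, .one 0 (.one 2 (.one 3 (.leaf 64 5448000)
      (.leaf 37 5448000)) (.one 3 (.leaf 57 5448720) (.leaf 35 4400400))) (.one 2 (.one 3 (.leaf 35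
      5448720) (.leaf 57 4400400)) (.one 3 (.leaf 37 4399440) (.leaf 64 4399440)))),
      (75576315273767236403200, .one 2 (.leaf 64 4400400) (.leaf 64 4399440))]⟩,
    ⟨5, 5366729425289216, 3, 2, [(5312663156349273636864, .one 0 (.one 1 (.one 4 (.leaf 39 5514000)
      (.leaf 37 5514000)) (.one 4 (.leaf 35 4530960) (.leaf 45 4411905))) (.one 1 (.one 4 (.leaf 35
      4530945) (.leaf 45 4411920)) (.one 4 (.leaf 44 4411920) (.leaf 34 3417360)))),
      (5017515251174215778304, .one 0 (.one 1 (.one 4 (.leaf 34 5514000) (.leaf 44 5517840)) (.one 4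
      (.leaf 45 4534800) (.leaf 35 4400385))) (.one 1 (.one 4 (.leaf 45 4534785) (.leaf 35 4400400))
      (.one 4 (.leaf 37 4400400) (.leaf 39 3417360)))), (9739885393214548475904, .three 4 (.leaf 39
      3428880) (.leaf 37 4411920) (.leaf 50 21314) (.leaf 33 213584)), (5017518910349198229504,
      .three 4 (.leaf 33 214304) (.leaf 50 21554) (.leaf 37 4400400) (.leaf 39 3417360))]⟩,
    ⟨6, 80594987085812367097856, 4, 3, [(1346878767779612296321500708864, .one 1 (.one 2 (.one 5
      (.leaf 22 70329936) (.leaf 32 34865967)) (.one 5 (.leaf 16 16990800) (.leaf 32 69272367)))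
      (.one 2 (.one 5 (.leaf 32 34865951) (.leaf 16 34620255)) (.one 5 (.leaf 32 69272367) (.leaf 22
      4400721)))), (1346878838615109838429029924864, .one 0 (.one 2 (.one 5 (.leaf 22 70391301)
      (.leaf 32 34620402)) (.one 5 (.leaf 16 17052405) (.leaf 32 69272562))) (.one 2 (.one 5 (.leaf
      32 34620404) (.leaf 16 34865989)) (.one 5 (.leaf 32 69272560) (.leaf 22 4400721))))]⟩,
    ⟨5, 5085250153676800, 3, 2, [(5017514969694944165888, .one 0 (.one 1 (.one 4 (.leaf 33 5513475)
      (.leaf 32 2179122)) (.one 4 (.leaf 16 1061925) (.leaf 32 4329522))) (.one 1 (.one 4 (.leaf 32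
      2179121) (.leaf 16 2163765)) (.one 4 (.leaf 32 4329522) (.leaf 33 3416325)))),
      (5017518910344903262208, .two 4 (.one 1 (.leaf 33 3490080) (.leaf 55 218145)) (.one 1 (.leaf
      32 2163775) (.leaf 32 4329522)) (.one 1 (.leaf 55 213525) (.leaf 33 3416325)))]⟩,
    ⟨4, 9412218880, 3, 2, [(4785078899249152, .three 1 (.one 0 (.leaf 35 270640) (.leaf 65 148240))
      (.one 0 (.leaf 33 270640) (.leaf 59 205840)) (.one 0 (.leaf 59 271120) (.leaf 33 205120))
      (.one 0 (.leaf 65 144400) (.leaf 35 205120))), (4785079721132032, .three 1 (.one 0 (.leaf 35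
      274720) (.leaf 65 213520)) (.one 0 (.leaf 33 274720) (.leaf 59 205840)) (.one 0 (.leaf 59
      274960) (.leaf 33 205120)) (.one 0 (.leaf 65 205840) (.leaf 35 205120)))]⟩,
    ⟨4, 9143717904, 2, 1, [(299067716468752, .two 3 (.one 0 (.leaf 34 267010) (.leaf 57 82720))
      (.one 0 (.leaf 32 136195) (.leaf 32 270595)) (.one 0 (.leaf 57 78340) (.leaf 34 135940))),
      (299075769536512, .two 3 (.one 0 (.leaf 34 271105) (.leaf 57 148240)) (.one 0 (.leaf 32
      135235) (.leaf 32 270595)) (.one 0 (.leaf 57 143620) (.leaf 34 135940)))]⟩,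
    ⟨3, 208944, 1, 0, [(302002192, .three 2 (.leaf 34 12321) (.leaf 33 12801) (.leaf 55 8496) (.leaf
      57 291)), (285224992, .three 2 (.leaf 57 801) (.leaf 55 12816) (.leaf 33 8451) (.leaf 34
      4131)), (553844752, .three 2 (.leaf 34 12576) (.leaf 33 12816) (.leaf 55 12576) (.leaf 57
      4131)), (285409312, .three 2 (.leaf 57 4896) (.leaf 55 12816) (.leaf 33 8451) (.leaf 34
      4131))]⟩,
    ⟨8, 92918353837636430028288672378561620934656, 5, 0,
      [(23384048585513481168501103868400656277057898086400, .one 6 (.one 7 (.leaf 12 35206283526)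
      (.leaf 11 30910267656)) (.one 7 (.leaf 11 26616348936) (.leaf 12 6495364416))),
      (23384048590957999059518528887466320419913440755712, .leaf 12 6495364416)]⟩,
    ⟨8, 87475165194891977044780847409654552068096, 6, 0,
      [(374144441457819224833615760162778889329388080332800, .one 5 (.one 7 (.leaf 11 13512413316)
      (.leaf 10 15101687301)) (.one 7 (.leaf 10 19379877381) (.leaf 11 5141582976))),
      (374144441544931510785658416413054459255867993751552, .leaf 11 5141582976)]⟩,
    ⟨7, 21634240202146062900402155683840, 4, 0, [(340287579584386524650972909819714863104, .one 5
      (.one 6 (.leaf 34 1985217313) (.leaf 33 1702113793)) (.one 6 (.leaf 33 1699164673) (.leaf 34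
      1683171073))), (340287580852037200437066037230741487616, .leaf 34 1683171073)]⟩,
    ⟨8, 361560421002226155862947436351063064576, 7, 0,
      [(5986310728808123556706768086845219004544519682129920, .one 3 (.one 4 (.leaf 10 36291482886)
      (.leaf 28 31728080136)) (.one 4 (.leaf 28 27701548296) (.leaf 10 32264951046))),
      (5986310728808485106721621583962648840064915935854592, .leaf 10 32264951046)]⟩,
    ⟨7, 21550679178624219626539162009600, 5, 0, [(5444523064300143520490652047622279266304, .one 3
      (.one 6 (.leaf 35 1984122913) (.leaf 33 1731543073)) (.one 6 (.leaf 33 1698119713) (.leaf 35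
      1447260193))), (5444523084582553128864688954439175766016, .leaf 35 1447260193)]⟩,
    ⟨6, 80870530557926707298304, 3, 0, [(79247581475537743117757186048, .one 4 (.one 5 (.leaf 35
      106180641) (.leaf 33 88301601)) (.one 5 (.leaf 33 88485921) (.leaf 35 55861281))),
      (79247586197908729587029770240, .leaf 35 55861281)]⟩,
    ⟨6, 80317123980613977636864, 3, 2, [(84179998266163356433177903104, .one 5 (.leaf 34 88482576)
      (.leaf 34 88286736)), (84180002988529557827846406144, .one 4 (.leaf 34 88302096) (.leaf 34
      88286736))]⟩,
    ⟨5, 76842673473855488, 4, 4, [(151115727451833478684672, .one 2 (.one 3 (.leaf 34 5448720)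
      (.leaf 33 3294480)) (.one 3 (.leaf 33 3298320) (.leaf 34 4400400)))]⟩,
    ⟨7, 1272641126310275561188344463360, 3, 2, [(22596877200984691427273798339170140160, .one 5
      (.leaf 37 1702109488) (.leaf 37 1697915248)), (22596877196032935992498760109218856960, .one 6
      (.leaf 37 1666662928) (.leaf 37 1697915248))]⟩,
    ⟨6, 315905558812393734144, 3, 1, [(79537647839986737874766659584, .one 4 (.leaf 33 90260016)
      (.leaf 33 87114336)), (79537647821544497400684478464, .one 5 (.leaf 33 87441936) (.leaf 33
      87114336))]⟩,
    ⟨5, 76578790179995648, 4, 4, [(151115727451832975491072, .one 1 (.one 3 (.leaf 36 5444160)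
      (.leaf 33 3478560)) (.one 3 (.leaf 33 3413280) (.leaf 36 4395600)))]⟩,
    ⟨4, 73283993632, 2, 2, [(563018941333536, .one 1 (.one 3 (.leaf 36 213280) (.leaf 33 201760))
      (.one 3 (.leaf 33 201280) (.leaf 36 205120)))]⟩,
    ⟨8, 5465868596689932405397306347573273952256, 3, 2,
      [(97052848548606220669337197353411103878520242176, .one 7 (.leaf 28 9517269336) (.leaf 28
      927342936)), (97052848569873868596944091162730495743409258496, .one 6 (.leaf 28 10525872261)
      (.leaf 28 927342936))]⟩,
    ⟨7, 20287380706641530511242077143040, 3, 1, [(21350744969675917850043408547934371840, .one 4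
      (.leaf 33 1981104688) (.leaf 33 907362928)), (21350744969675917831601168073852190720, .one 5
      (.leaf 33 913654288) (.leaf 33 907362928))]⟩,
    ⟨6, 85002597254603835707424, 1, 0, [(328912825532433739087351824, .one 3 (.leaf 33 101008161)
      (.leaf 33 17122086)), (328912825532433739355783184, .one 2 (.leaf 33 23413536) (.leaf 33
      17122086))]⟩,
    ⟨5, 72076290567446528, 4, 4, [(151115727451833478684672, .one 0 (.one 1 (.leaf 38 5447940)
      (.leaf 33 1324320)) (.one 1 (.leaf 33 1389600) (.leaf 38 4399365)))]⟩,
    ⟨4, 73283932192, 2, 2, [(563018941333536, .one 0 (.one 3 (.leaf 38 213010) (.leaf 33 213025))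
      (.one 3 (.leaf 33 204865) (.leaf 38 204820)))]⟩,
    ⟨3, 1118481, 0, 0, [(34668800, .one 1 (.one 2 (.leaf 38 8496) (.leaf 33 4656)) (.one 2 (.leaf 33
      8496) (.leaf 38 8451)))]⟩,
    ⟨7, 84218688596310778755866951680, 6, 0, [(87112291124057124604563319119024922558464, .one 2
      (.one 3 (.leaf 4 560284528) (.leaf 29 1410361123)) (.one 3 (.leaf 29 1158702883) (.leaf 4
      308626288))), (87112291124141304527234724977718063005696, .leaf 4 308626288)]⟩,
    ⟨6, 5054412663474339446784, 4, 0, [(1267669948095751112863722242048, .one 2 (.one 3 (.leaf 124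
      106112001) (.leaf 33 88486401)) (.one 3 (.leaf 33 90452481) (.leaf 124 72558081))),
      (1267669948095755897938326323200, .leaf 124 72558081)]⟩,
    ⟨6, 80282540836868054974464, 2, 1, [(5261325449503421561399476224, .one 4 (.leaf 34 90260256)
      (.leaf 34 86066016)), (5261325449503703036107751424, .one 3 (.leaf 34 86393616) (.leaf 34
      86066016))]⟩,
    ⟨5, 72356665797705728, 4, 4, [(151115727451833243860992, .one 1 (.one 2 (.leaf 34 5448000)
      (.leaf 33 3282000)) (.one 2 (.leaf 33 3282240) (.leaf 34 4399440)))]⟩,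
    ⟨7, 21550079551416537848959874498560, 2, 1, [(1412326295601024531497862486445588480, .one 4
      (.leaf 29 341209603) (.leaf 29 609644803)), (1412326295601024531498143961153863680, .one 3
      (.leaf 29 356999203) (.leaf 29 609644803))]⟩,
    ⟨6, 80298677235440756457504, 1, 0, [(328908103165670502566985744, .one 5 (.leaf 33 101008161)
      (.leaf 33 17122086)), (328908121612413476764909584, .one 4 (.leaf 33 23413536) (.leaf 33
      17122086))]⟩,
    ⟨5, 76842673205415968, 4, 4, [(151115727451833210245152, .one 2 (.one 3 (.leaf 36 5447940)
      (.leaf 33 3294480)) (.one 3 (.leaf 33 3298320) (.leaf 36 4399365)))]⟩,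
    ⟨4, 69005807632, 2, 2, [(563018958110736, .one 0 (.one 1 (.leaf 36 213250) (.leaf 33 196930))
      (.one 1 (.leaf 33 200770) (.leaf 36 205060)))]⟩,
    ⟨6, 80577688759643888680960, 5, 0, [(20282428946465941982190006960128, .one 2 (.one 3 (.one 4
      (.leaf 7 34947936) (.leaf 20 55840806)) (.one 4 (.leaf 20 55656486) (.leaf 19 86250755)))
      (.one 3 (.one 4 (.leaf 19 86249987) (.leaf 20 87113766)) (.one 4 (.leaf 20 87298086) (.leaf 7
      19219296)))), (20282429027041320096153328418816, .leaf 7 19219296)]⟩,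
    ⟨5, 4804874671816704, 3, 2, [(5017514689319479083008, .one 1 (.one 4 (.leaf 33 4530480) (.leaf
      127 4530960)) (.one 4 (.leaf 127 4400400) (.leaf 33 4399440))), (5017518911444398112768, .one
      1 (.one 4 (.leaf 33 4534560) (.leaf 127 4534800)) (.one 4 (.leaf 127 4400400) (.leaf 33
      4399440)))]⟩,
    ⟨5, 301275061223424, 4, 0, [(75559016648527317106688, .one 1 (.one 2 (.leaf 101 5447700) (.leaf
      30 2176080)) (.one 2 (.leaf 30 2176320) (.leaf 101 4399125))), (75559016947594463084544, .one
      3 (.leaf 101 4400400) (.leaf 101 4399125))]⟩,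
    ⟨5, 4787282485772304, 4, 0, [(75559016648527300329488, .one 2 (.one 3 (.leaf 101 5447700) (.leaf
      30 2180400)) (.one 3 (.leaf 30 2184240) (.leaf 101 4399125))), (75559021433601904410624, .one
      1 (.leaf 101 4400400) (.leaf 101 4399125))]⟩,
    ⟨4, 73299791888, 3, 3, [(9007199254876176, .one 0 (.one 1 (.one 2 (.leaf 35 270595) (.leaf 34
      270595)) (.one 2 (.leaf 34 266755) (.leaf 33 205060))) (.one 1 (.one 2 (.leaf 33 270595)
      (.leaf 34 201220)) (.one 2 (.leaf 34 205060) (.leaf 35 205060))))]⟩,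
    ⟨6, 80299834940920455757840, 3, 2, [(84179998248869813140028653584, .one 4 (.one 5 (.leaf 114
      90325251) (.leaf 6 56967696)) (.one 5 (.leaf 6 90452496) (.leaf 114 87179526))),
      (84180002971240236659347816464, .two 4 (.leaf 114 87441666) (.leaf 6 56967696) (.leaf 114
      87179526))]⟩,
    ⟨7, 21555031457967040057547790811136, 5, 4, [(5784800238928575657633721312521668853760, .one 0
      (.one 6 (.leaf 21 1934627878) (.leaf 23 1666457859)) (.one 6 (.leaf 23 1666457859) (.leaf 21
      1399854118))), (5784800257943334661058310752877196410880, .one 3 (.one 6 (.leaf 21 813056293)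
      (.leaf 23 1130701071)) (.one 6 (.leaf 23 1666457859) (.leaf 21 1399854118)))]⟩,
    ⟨6, 80317124013595048284160, 4, 1, [(1267960089997310735178990096384, .one 2 (.one 5 (.leaf 33
      102052356) (.leaf 23 54927696)) (.one 5 (.leaf 23 105062736) (.leaf 33 68497926))),
      (1267960165518281254420871122944, .two 5 (.leaf 33 73740801) (.leaf 23 105062736) (.leaf 33
      68497926))]⟩,
    ⟨5, 4787278459305984, 4, 0, [(75559016648523273863168, .one 2 (.one 3 (.leaf 35 5448000) (.leaf
      33 3294480)) (.one 3 (.leaf 33 3298320) (.leaf 35 4399440))), (75559021433597877944320, .leaf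
      35 4399440)]⟩,
    ⟨5, 5084150373548064, 1, 0, [(19604732136503902224, .one 4 (.leaf 34 4411425) (.leaf 34
      4395045)), (19604749728673169424, .one 3 (.leaf 34 4396320) (.leaf 34 4395045))]⟩,
    ⟨4, 73282953248, 3, 3, [(9007199254814752, .one 1 (.one 2 (.leaf 34 270595) (.leaf 33 135220))
      (.one 2 (.leaf 33 135235) (.leaf 34 205060)))]⟩,
    ⟨5, 72076290315849728, 4, 4, [(151115727451833227087872, .one 0 (.one 1 (.leaf 137 5447940)
      (.leaf 131 78420)) (.one 1 (.leaf 131 1061460) (.leaf 137 4399365)))]⟩,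
    ⟨7, 20282738431494214557339614183424, 4, 3, [(361550035136235548924045292661263826944, .one 2
      (.leaf 0 356713078) (.leaf 0 893452918)), (361550035136235548924045574131945570304, .one 2
      (.leaf 0 356528758) (.leaf 0 893452918))]⟩,
    ⟨6, 151134174213503149150208, 3, 2, [(84180073805580072191977852928, .one 0 (.leaf 33 103104816)
      (.leaf 33 52773216)), (84180073805580072191994626048, .one 0 (.leaf 33 104153376) (.leaf 33
      52773216))]⟩,
    ⟨5, 9288678526418992, 1, 0, [(20761875761449664528, .leaf 33 4411425), (19608954256842817568,
      .leaf 33 4395045), (38055698330552369168, .leaf 33 4411680), (19608954256842817568, .leaf 33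
      4395045)]⟩,
    ⟨4, 12884901936, 1, 0, [(19804094201872, .leaf 33 262450), (18704582574112, .leaf 33 66610),
      (36296768618512, .leaf 33 266290), (18704582574112, .leaf 33 66610)]⟩,
    ⟨8, 361560419734885036217325024357174476800, 7, 0,
      [(5986310728808123556705500745725573382132525793542144, .one 3 (.one 4 (.leaf 2 18807812901)
      (.leaf 0 22565835558)) (.one 4 (.leaf 0 22565843750) (.leaf 2 26860876581))),
      (5986310728808485106720354242843003217652922047266816, .leaf 2 26860876581)]⟩,
    ⟨7, 20366589531340590708072785117184, 4, 0, [(340287579584386529631593809716998832128, .two 1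
      (.leaf 33 1985217313) (.leaf 0 356546098) (.leaf 33 1180107553)),
      (340287579584386529631593844901370920960, .leaf 33 1180107553)]⟩,
    ⟨6, 39208619835159216128, 4, 3, [(1346878762781697573850802290688, .one 2 (.leaf 33 104153616)
      (.leaf 33 70607376)), (1346878762781697855321484034048, .one 2 (.leaf 33 105198096) (.leaf 33
      70607376))]⟩,
    ⟨5, 37396280246272, 3, 2, [(5312662330616041177088, .leaf 33 4530960), (5017514425440983318528,
      .leaf 33 4400400), (9739880908306333564928, .leaf 33 4534800), (5017514425440983318528, .leaf
      33 4400400)]⟩,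
    ⟨4, 68753227776, 3, 3, [(9007199254937600, .two 0 (.leaf 33 270640) (.leaf 38 274465) (.leaf 33
      205120))]⟩,
    ⟨3, 2097200, 2, 2, [(12884901936, .leaf 38 12816), (8590983216, .leaf 33 8451), (77309411376,
      .leaf 33 12546)]⟩,
    ⟨9, 1558911384914898887457301585476036272694545678336, 7, 0,
      [(411376140862798610315923512087577318576981760541654845283696640, .one 5 (.one 6 (.leaf 1
      345636090390) (.leaf 2 85903046226)) (.one 6 (.leaf 2 85919823442) (.leaf 1 158984669025))),
      (411376140862798610316016068891379813839043798434876286237212672, .leaf 1 158984669025)]⟩,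
    ⟨9, 97097537151289213671205297434975147863306141696, 8, 0,
      [(6582018230817319709508158890673160183181568440289888803351429120, .one 2 (.one 3 (.leaf 2
      300917425957) (.leaf 0 361048852262)) (.one 3 (.leaf 0 361049052966) (.leaf 2 429766444837))),
      (6582018230817319806561001994678432095145014362855558077378199552, .leaf 2 429766444837)]⟩,
    ⟨8, 5784966391239645677216978554967944069120, 6, 0,
      [(374144441463241311981921905122819184542488245305344, .one 2 (.one 3 (.leaf 34 36327073281)
      (.leaf 33 32315233281)) (.one 3 (.leaf 33 32316216321) (.leaf 34 27737139201))),
      (374144441463241311982006085045490590401181385752576, .leaf 34 27737139201)]⟩,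
    ⟨7, 1346917448995915209329589878784, 5, 1, [(5444600948831669421043222861746733580288, .two 2
      (.leaf 33 1985037088) (.leaf 41 1733571088) (.leaf 33 1698918658)),
      (5444600948831669421633518672105439232000, .leaf 33 1698918658)]⟩,
    ⟨6, 10035028813481391423488, 4, 0, [(1267669953076372012761006211072, .two 1 (.leaf 33
      106169121) (.leaf 41 105189426) (.leaf 33 72745761)), (1267669953076372047945378299904, .leaf
      33 72745761)]⟩,
    ⟨5, 72059802187988992, 4, 4, [(151115727451837773643776, .two 0 (.leaf 33 5455905) (.leaf 41
      3489825) (.leaf 33 4411425))]⟩,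
    ⟨5, 72059801919619072, 4, 4, [(151115727451837505273856, .two 0 (.leaf 42 5448000) (.leaf 47
      5517825) (.leaf 42 4399440))]⟩,
    ⟨4, 69257404416, 2, 2, [(563019209768960, .two 0 (.leaf 34 213505) (.leaf 33 213505) (.leaf 34
      205825))]⟩,
    ⟨3, 2097440, 2, 2, [(12884902176, .leaf 42 4896), (8590983456, .leaf 33 8496), (77309411616,
      .leaf 33 12576)]⟩,
    ⟨2, 514, 0, 0, [(12800, .leaf 42 288), (8705, .leaf 33 258), (1057280, .leaf 33 288)]⟩]

lemma checkStates_states : checkStates [] states = true := by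
  decide +kernel

lemma forces_states : ∀ s ∈ states, Forces (s.n, s.mat) :=
  forces_of_checkStates states [] (by simp) checkStates_states

section Weights

open scoped Classical

variable {ι : Type} {w : ι → ι → ℕ}

/-- Twice the number of edges inside `Y` for symmetric edge multiplicities `w`, the diagonal
entries counting loops. -/
def dsum (w : ι → ι → ℕ) (Y : Finset ι) : ℕ := ∑ i ∈ Y, (w i i + ∑ j ∈ Y, w i j)

lemma dsum_insert (hw : ∀ i j, w i j = w j i) {y : ι} {Y : Finset ι} (hy : y ∉ Y) :
    dsum w (insert y Y) = dsum w Y + 2 * (w y y + ∑ j ∈ Y, w y j) := by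
  have h : ∑ i ∈ Y, w i y = ∑ i ∈ Y, w y i := Finset.sum_congr rfl fun i _ => hw i y
  simp only [dsum, Finset.sum_insert hy, Finset.sum_add_distrib, h]
  ring

lemma dsum_erase (hw : ∀ i j, w i j = w j i) {y : ι} {Y : Finset ι} (hy : y ∈ Y) :
    dsum w Y = dsum w (Y.erase y) + 2 * ∑ j ∈ Y, w y j := by
  conv_lhs => rw [← Finset.insert_erase hy]
  rw [dsum_insert hw (Finset.notMem_erase y Y), Finset.add_sum_erase Y (fun j => w y j) hy]

lemma dsum_singleton (y : ι) : dsum w {y} = w y y + w y y := by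
  simp [dsum]

lemma even_dsum (hw : ∀ i j, w i j = w j i) (Y : Finset ι) : Even (dsum w Y) := by
  induction Y using Finset.induction_on with
  | empty => simp [dsum]
  | insert y Y hy ih =>
    rw [dsum_insert hw hy]
    exact ih.add (even_two_mul _)

lemma dsum_mono {w' : ι → ι → ℕ} {Y : Finset ι} (h : ∀ i ∈ Y, ∀ j ∈ Y, w i j ≤ w' i j) :
    dsum w Y ≤ dsum w' Y :=
  Finset.sum_le_sum fun i hi => Nat.add_le_add (h i hi i hi) (Finset.sum_le_sum (h i hi))

lemma dsum_image {κ : Type} {σ : κ → ι} {Y : Finset κ} (hσ : Set.InjOn σ Y) :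
    dsum w (Y.image σ) = dsum (fun i j => w (σ i) (σ j)) Y := by
  simp only [dsum, Finset.sum_image hσ]

lemma card_mul_dsum_le (hw : ∀ i j, w i j = w j i) {X : Finset ι} {m : ℕ}
    (h : ∀ y ∈ X, dsum w (X.erase y) ≤ m) : #X * dsum w X ≤ 2 * dsum w X + #X * m := by
  have h1 : ∑ y ∈ X, dsum w X ≤ ∑ y ∈ X, (m + 2 * ∑ j ∈ X, w y j) :=
    Finset.sum_le_sum fun y hy => by
      rw [dsum_erase hw hy]
      exact Nat.add_le_add_right (h y hy) _
  have h2 : ∑ y ∈ X, ∑ j ∈ X, w y j ≤ dsum w X :=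
    Finset.sum_le_sum fun y _ => Nat.le_add_left _ _
  rw [Finset.sum_const, smul_eq_mul, Finset.sum_add_distrib, Finset.sum_const, smul_eq_mul,
    ← Finset.mul_sum] at h1
  omega

/-- The local properties of a multigraph `w` on `P` which is minimal with respect to deletion and
contraction among those that are not apex-pseudoforests. -/
structure Tight (P : Finset ι) (w : ι → ι → ℕ) : Prop where
  symm : ∀ i j, w i j = w j i
  avoid : ∀ p, ∃ Y ⊆ P, p ∉ Y ∧ 2 * #Y < dsum w Y
  indep : ∀ Y ⊆ P, 2 * #Y < dsum w Y → ∀ p ∈ P, p ∉ Y → ∀ q ∈ P, q ∉ Y → p ≠ q → w p q = 0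
  deg : ∀ p ∈ P, 2 ≤ ∑ q ∈ P, w p q
  deg_of_eq_zero : ∀ p ∈ P, w p p = 0 → 3 ≤ ∑ q ∈ P, w p q
  loop_le : ∀ p ∈ P, ∀ q ∈ P, p ≠ q → 2 ≤ w p p → w q q ≤ 1

variable {P : Finset ι}

lemma Tight.loop_le_one (h : Tight P w) {p : ι} (hp : p ∈ P) : w p p ≤ 1 := by
  by_contra! hlt
  obtain ⟨Y, hY, hpY, hbad⟩ := h.avoid p
  have h1 : dsum w Y ≤ ∑ i ∈ Y, 2 := by
    refine Finset.sum_le_sum fun i hi => ?_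
    have h2 : ∑ j ∈ Y, w i j = w i i := by
      refine Finset.sum_eq_single_of_mem i hi fun j hj hji => ?_
      refine h.indep {p} (by simpa using hp) ?_ i (hY hi) ?_ j (hY hj) ?_ hji.symm
      · simp only [Finset.card_singleton, dsum, Finset.sum_singleton]
        omega
      all_goals
        rw [Finset.mem_singleton]
        rintro rfl
        exact hpY ‹_›
    have h3 := h.loop_le p hp i (hY hi) (fun h => hpY (h ▸ hi)) hlt
    omega
  rw [Finset.sum_const, smul_eq_mul] at h1
  omega

/-- A smallest set spanning more edges than it has vertices. -/
structure IsMinBad (P : Finset ι) (w : ι → ι → ℕ) (U : Finset ι) : Prop where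
  sub : U ⊆ P
  bad : 2 * #U < dsum w U
  le : ∀ Y ⊆ P, 2 * #Y < dsum w Y → #U ≤ #Y

lemma Tight.exists_isMinBad [Nonempty ι] (h : Tight P w) : ∃ U, IsMinBad P w U := by
  obtain ⟨Y, hY, -, hbad⟩ := h.avoid (Classical.arbitrary ι)
  obtain ⟨U, hU, hmin⟩ := Finset.exists_min_image
    (P.powerset.filter fun Y => 2 * #Y < dsum w Y) Finset.card ⟨Y, by simp [hY, hbad]⟩
  simp only [Finset.mem_filter, Finset.mem_powerset] at hU hmin
  exact ⟨U, hU.1, hU.2, fun Y hY hbad => hmin Y ⟨hY, hbad⟩⟩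

variable {U : Finset ι}

lemma IsMinBad.two_le_card (h : Tight P w) (hU : IsMinBad P w U) : 2 ≤ #U := by
  by_contra! hlt
  have hbad := hU.bad
  rcases Nat.lt_succ_iff_lt_or_eq.1 hlt with h0 | h1
  · rw [Finset.card_eq_zero.1 (by omega : #U = 0)] at hbad
    simp [dsum] at hbad
  · obtain ⟨u, rfl⟩ := Finset.card_eq_one.1 h1
    have := h.loop_le_one (hU.sub (Finset.mem_singleton_self u))
    simp only [Finset.card_singleton, dsum, Finset.sum_singleton] at hbad
    omega

lemma IsMinBad.card_le_four (h : Tight P w) (hU : IsMinBad P w U) {X : Finset ι} (hX : X ⊆ P)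
    (hc : #X = #U) (hd : 2 * #U + 4 ≤ dsum w X) : #U ≤ 4 := by
  have h1 := card_mul_dsum_le h.symm (X := X) (m := 2 * (#U - 1)) fun y hy => by
    by_contra! hlt
    have hcard := Finset.card_erase_of_mem hy
    have hpos := Finset.card_pos.2 ⟨y, hy⟩
    have := hU.le _ ((Finset.erase_subset y X).trans hX) (by omega)
    omega
  rw [hc] at h1
  have h2 := hU.two_le_card h
  obtain ⟨m, hm⟩ : ∃ m, #U = m + 2 := ⟨#U - 2, by omega⟩
  rw [hm] at h1 hd ⊢
  have h3 : m + 2 - 1 = m + 1 := by omega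
  rw [h3] at h1
  nlinarith

/-- The vertices outside of a smallest bad set `U` have all their neighbours in `U`. -/
lemma IsMinBad.sum_eq (h : Tight P w) (hU : IsMinBad P w U) {x : ι} (hx : x ∈ P) (hxU : x ∉ U) :
    ∑ q ∈ P, w x q = w x x + ∑ q ∈ U, w x q := by
  rw [← Finset.sum_insert hxU]
  symm
  refine Finset.sum_subset (Finset.insert_subset hx hU.sub) fun q hq hqU => ?_
  rw [Finset.mem_insert, not_or] at hqU
  exact h.indep U hU.sub hU.bad x hx hxU q hq hqU.2 (Ne.symm hqU.1)

lemma IsMinBad.card_le_five_of_three_le (h : Tight P w) (hU : IsMinBad P w U) {x : ι} (hx : x ∈ P)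
    (hxU : x ∉ U) (h3 : 3 ≤ ∑ q ∈ P, w x q) : #U ≤ 5 := by
  have hWP : insert x U ⊆ P := Finset.insert_subset hx hU.sub
  have hW := dsum_insert h.symm hxU
  have hcW := Finset.card_insert_of_notMem hxU
  rw [hU.sum_eq h hx hxU] at h3
  obtain ⟨q, hq⟩ := even_dsum h.symm U
  have hbad := hU.bad
  by_cases hex : ∃ y ∈ insert x U, 2 * #U + 4 ≤ dsum w ((insert x U).erase y)
  · obtain ⟨y, hy, hd⟩ := hex
    have := hU.card_le_four h ((Finset.erase_subset _ _).trans hWP)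
      (by rw [Finset.card_erase_of_mem hy, hcW]; rfl) hd
    omega
  · push Not at hex
    have h1 := card_mul_dsum_le h.symm (X := insert x U) (m := 2 * #U + 2) fun y hy => by
      obtain ⟨r, hr⟩ := even_dsum h.symm ((insert x U).erase y)
      have := hex y hy
      omega
    have h2 := hU.two_le_card h
    rw [hcW] at h1
    have h4 : 2 * #U + 8 ≤ dsum w (insert x U) := by omega
    generalize dsum w (insert x U) = D at *
    obtain ⟨m, hm⟩ : ∃ m, #U = m + 2 := ⟨#U - 2, by omega⟩
    rw [hm] at h1 h4 ⊢
    nlinarith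

lemma IsMinBad.card_le_five (h : Tight P w) (hU : IsMinBad P w U) : #U ≤ 5 := by
  by_contra! h6
  have hI : ∀ x ∈ P, x ∉ U → w x x = 1 ∧ ∑ q ∈ U, w x q = 1 := by
    intro x hx hxU
    have h1 := h.deg x hx
    have h2 := h.deg_of_eq_zero x hx
    have h3 : ¬ 3 ≤ ∑ q ∈ P, w x q := fun h3 => by
      have := hU.card_le_five_of_three_le h hx hxU h3
      omega
    have h4 := h.loop_le_one hx
    have h5 := hU.sum_eq h hx hxU
    omega
  have hd : dsum w U = 2 * #U + 2 := by
    obtain ⟨q, hq⟩ := even_dsum h.symm U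
    have h1 := hU.bad
    by_contra hne
    have := hU.card_le_four h hU.sub rfl (by omega)
    omega
  have hdeg : ∀ u ∈ U, 2 ≤ ∑ j ∈ U, w u j := by
    intro u hu
    by_contra! hlt
    have h1 := dsum_erase h.symm hu
    have h2 := Finset.card_erase_of_mem hu
    have := hU.le (U.erase u) ((Finset.erase_subset u U).trans hU.sub) (by omega)
    omega
  have hsmall : ∀ Y ⊆ P, #Y ≤ 5 → dsum w Y ≤ 2 * #Y := by
    intro Y hY hc
    by_contra! hlt
    have := hU.le Y hY hlt
    omega
  let S := U.filter fun u => w u u + ∑ j ∈ U, w u j = 2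
  have hS : ∀ u ∈ S, u ∈ U ∧ w u u = 0 ∧ ∑ j ∈ U, w u j = 2 := by
    intro u hu
    have h1 := Finset.mem_filter.1 hu
    have h2 := hdeg u h1.1
    exact ⟨h1.1, by omega, by omega⟩
  have hcard : #(U \ S) ≤ 2 := by
    have h1 : ∑ u ∈ U, (2 + if u ∈ U \ S then 1 else 0) ≤ dsum w U := by
      refine Finset.sum_le_sum fun u hu => ?_
      have h2 := hdeg u hu
      split_ifs with hs
      · have : ¬ (w u u + ∑ j ∈ U, w u j = 2) := fun h =>
          (Finset.mem_sdiff.1 hs).2 (Finset.mem_filter.2 ⟨hu, h⟩)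
        omega
      · omega
    rw [Finset.sum_add_distrib, Finset.sum_const, smul_eq_mul, ← Finset.card_filter,
      Finset.filter_mem_eq_inter, Finset.inter_eq_right.2 Finset.sdiff_subset] at h1
    omega
  have hpend : ∀ u, ∃ x, u ∈ S → x ∈ P ∧ x ∉ U ∧ 1 ≤ w u x := by
    intro u
    by_cases hu : u ∈ S
    · obtain ⟨huU, h0, h2⟩ := hS u hu
      have h3 := h.deg_of_eq_zero u (hU.sub huU) h0
      rw [← Finset.sum_sdiff hU.sub, h2] at h3
      obtain ⟨x, hx, h4⟩ := Finset.exists_ne_zero_of_sum_ne_zero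
        (s := P \ U) (f := fun x => w u x) (by omega)
      have h5 := Finset.mem_sdiff.1 hx
      exact ⟨x, fun _ => ⟨h5.1, h5.2, Nat.one_le_iff_ne_zero.2 h4⟩⟩
    · exact ⟨u, fun h => absurd h hu⟩
  choose x hx using hpend
  have hxne : ∀ u ∈ S, ∀ v ∈ S, u ≠ v → x u ≠ x v := by
    intro u hu v hv huv hxx
    have h1 := (hI _ (hx u hu).1 (hx u hu).2.1).2
    have h2 : ∑ q ∈ {u, v}, w (x u) q ≤ ∑ q ∈ U, w (x u) q :=
      Finset.sum_le_sum_of_subset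
        (Finset.insert_subset (hS u hu).1 (Finset.singleton_subset_iff.2 (hS v hv).1))
    rw [Finset.sum_pair huv] at h2
    have h3 := (hx u hu).2.2
    have h4 := (hx v hv).2.2
    rw [h.symm] at h3 h4
    rw [← hxx] at h4
    omega
  have hxU : ∀ u ∈ S, ∀ v ∈ U, x u ≠ v := fun u hu v hv h => (hx u hu).2.1 (h ▸ hv)
  have hadj : ∀ u ∈ S, ∀ v ∈ S, u ≠ v → w u v = 0 := by
    intro u hu v hv huv
    by_contra hne
    have h1 := hxU u hu u (hS u hu).1
    have h2 := hxU u hu v (hS v hv).1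
    have h3 := hxU v hv u (hS u hu).1
    have h4 := hxU v hv v (hS v hv).1
    have h5 := hxne u hu v hv huv
    have h6 := hsmall {u, v, x u, x v} (by
      simp [Finset.insert_subset_iff, hU.sub (hS u hu).1, hU.sub (hS v hv).1, (hx u hu).1,
        (hx v hv).1]) (Finset.card_le_four.trans (by norm_num))
    have h7 := (hI _ (hx u hu).1 (hx u hu).2.1).1
    have h8 := (hI _ (hx v hv).1 (hx v hv).2.1).1
    have h9 := (hx u hu).2.2
    have h10 := (hx v hv).2.2
    have hc : #({u, v, x u, x v} : Finset ι) ≤ 4 := Finset.card_le_four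
    have hA : v ∉ ({x u, x v} : Finset ι) := by simp [h2.symm, h4.symm]
    have hB : x u ∉ ({x v} : Finset ι) := by simp [h5]
    rw [dsum_insert h.symm (by simp [huv, h1.symm, h3.symm]), dsum_insert h.symm hA,
      dsum_insert h.symm hB, dsum_singleton] at h6
    simp only [Finset.sum_insert hA, Finset.sum_insert hB, Finset.sum_singleton] at h6
    omega
  have hdouble : ∀ u ∈ S, ∀ t ∈ U, u ≠ t → w u t ≤ 1 := by
    intro u hu t ht hut
    by_contra! hlt
    have h1 := hxU u hu u (hS u hu).1
    have h2 := hxU u hu t ht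
    have h6 := hsmall {u, t, x u} (by
      simp [Finset.insert_subset_iff, hU.sub (hS u hu).1, hU.sub ht, (hx u hu).1])
      (Finset.card_le_three.trans (by norm_num))
    have h7 := (hI _ (hx u hu).1 (hx u hu).2.1).1
    have h9 := (hx u hu).2.2
    have hc : #({u, t, x u} : Finset ι) ≤ 3 := Finset.card_le_three
    rw [dsum_insert h.symm (by simp [hut, h1.symm]), dsum_insert h.symm (by simp [h2.symm]),
      dsum_singleton, Finset.sum_insert (by simp [h2.symm])] at h6
    simp only [Finset.sum_singleton] at h6
    omega
  have hcommon : ∀ t ∈ U \ S, ∀ u ∈ S, ∀ v ∈ S, u ≠ v → 1 ≤ w u t → w v t = 0 := by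
    intro t ht u hu v hv huv hut
    by_contra hne
    obtain ⟨htU, htS⟩ := Finset.mem_sdiff.1 ht
    have hu' : u ≠ t := fun h => htS (h ▸ hu)
    have hv' : v ≠ t := fun h => htS (h ▸ hv)
    have h1 := hxU u hu u (hS u hu).1
    have h2 := hxU u hu v (hS v hv).1
    have h3 := hxU v hv u (hS u hu).1
    have h4 := hxU v hv v (hS v hv).1
    have ht1 := hxU u hu t htU
    have ht2 := hxU v hv t htU
    have h5 := hxne u hu v hv huv
    have h6 := hsmall {u, v, t, x u, x v} (by
      simp [Finset.insert_subset_iff, hU.sub (hS u hu).1, hU.sub (hS v hv).1, (hx u hu).1,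
        (hx v hv).1, hU.sub htU]) Finset.card_le_five
    have h7 := (hI _ (hx u hu).1 (hx u hu).2.1).1
    have h8 := (hI _ (hx v hv).1 (hx v hv).2.1).1
    have h9 := (hx u hu).2.2
    have h10 := (hx v hv).2.2
    have hc : #({u, v, t, x u, x v} : Finset ι) ≤ 5 := Finset.card_le_five
    have hA : v ∉ ({t, x u, x v} : Finset ι) := by simp [h2.symm, h4.symm, hv']
    have hB : t ∉ ({x u, x v} : Finset ι) := by simp [ht1.symm, ht2.symm]
    have hC : x u ∉ ({x v} : Finset ι) := by simp [h5]
    rw [dsum_insert h.symm (by simp [huv, h1.symm, h3.symm, hu']), dsum_insert h.symm hA,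
      dsum_insert h.symm hB, dsum_insert h.symm hC, dsum_singleton] at h6
    simp only [Finset.sum_insert hA, Finset.sum_insert hB, Finset.sum_insert hC,
      Finset.sum_singleton] at h6
    omega
  have h1 : ∑ u ∈ S, ∑ t ∈ U \ S, w u t = ∑ u ∈ S, 2 := by
    refine Finset.sum_congr rfl fun u hu => ?_
    obtain ⟨huU, h0, h2⟩ := hS u hu
    rw [← h2, ← Finset.sum_sdiff (Finset.filter_subset _ U : S ⊆ U), left_eq_add]
    refine Finset.sum_eq_zero fun v hv => ?_
    by_cases huv : u = v
    · rw [← huv, h0]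
    · exact hadj u hu v hv huv
  have h2 : ∑ t ∈ U \ S, ∑ u ∈ S, w u t ≤ ∑ t ∈ U \ S, 1 := by
    refine Finset.sum_le_sum fun t ht => ?_
    by_cases hex : ∃ u ∈ S, 1 ≤ w u t
    · obtain ⟨u, hu, hut⟩ := hex
      rw [Finset.sum_eq_single_of_mem u hu fun v hv hvu => hcommon t ht u hu v hv hvu.symm hut]
      obtain ⟨htU, htS⟩ := Finset.mem_sdiff.1 ht
      exact hdouble u hu t htU fun h => htS (h ▸ hu)
    · push Not at hex
      rw [Finset.sum_eq_zero fun u hu => Nat.lt_one_iff.1 (hex u hu)]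
      exact Nat.zero_le 1
  rw [Finset.sum_comm, h1, Finset.sum_const, Finset.sum_const, smul_eq_mul, smul_eq_mul] at h2
  have h3 : #(U \ S) + #S = #U :=
    Finset.card_sdiff_add_card_eq_card (Finset.filter_subset _ U : S ⊆ U)
  omega

end Weights

section Growth

open scoped Classical

variable {ι : Type} {P U : Finset ι} {w : ι → ι → ℕ} {n k : ℕ} {g : ℕ → ℕ → ℕ} {σ : ℕ → ι}

/-- The map `σ` embeds the weights `g` on `n` points into the weights `w` on `P`. -/
structure Emb (P : Finset ι) (w : ι → ι → ℕ) (n : ℕ) (g : ℕ → ℕ → ℕ) (σ : ℕ → ι) : Prop where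
  mem : ∀ i < n, σ i ∈ P
  inj : ∀ i < n, ∀ j < n, i ≠ j → σ i ≠ σ j
  le : ∀ i < n, ∀ j < n, g i j ≤ w (σ i) (σ j)

/-- The weights `w` on `P` contain one of the 33 graphs or a packed matrix from the list `T`. -/
def HasLeaf (T : List (ℕ × ℕ)) (P : Finset ι) (w : ι → ι → ℕ) : Prop :=
  ∃ n g σ t lam, Emb P w n g σ ∧ leafCheck T n g t lam = true

/-- An embedding mapping exactly the points below `#U` to `U`. -/
structure Grown (P : Finset ι) (w : ι → ι → ℕ) (U : Finset ι) (n : ℕ) (g : ℕ → ℕ → ℕ)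
    (σ : ℕ → ι) : Prop extends Emb P w n g σ where
  card_le : #U ≤ n
  mem_iff : ∀ i < n, σ i ∈ U ↔ i < #U

lemma Emb.injOn (h : Emb P w n g σ) {F : Finset ℕ} (hF : F ⊆ range n) : Set.InjOn σ F := by
  intro i hi j hj hij
  by_contra hne
  exact h.inj i (Finset.mem_range.1 (hF hi)) j (Finset.mem_range.1 (hF hj)) hne hij

lemma Grown.exists_eq (h : Grown P w U n g σ) {u : ι} (hu : u ∈ U) : ∃ i < #U, σ i = u := by
  have hsub : range #U ⊆ range n := Finset.range_subset_range.2 h.card_le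
  have h1 : (range #U).image σ = U := by
    refine Finset.eq_of_subset_of_card_le ?_ ?_
    · intro x hx
      obtain ⟨i, hi, rfl⟩ := Finset.mem_image.1 hx
      exact (h.mem_iff i (Finset.mem_range.1 (hsub hi))).2 (Finset.mem_range.1 hi)
    · rw [Finset.card_image_of_injOn (h.injOn hsub), Finset.card_range]
  rw [← h1] at hu
  obtain ⟨i, hi, h2⟩ := Finset.mem_image.1 hu
  exact ⟨i, Finset.mem_range.1 hi, h2⟩

/-- The indicator of the unordered pair of `a` and `b`. -/
def slot (a b i j : ℕ) : ℕ := bif (i == a && j == b) || (i == b && j == a) then 1 else 0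

/-- Add an edge between `a` and `b` to a packed matrix. -/
def addEdge (M a b i j : ℕ) : ℕ := ent M i j + slot a b i j

/-- Add a point `n` with edges to `a` and `b` to a packed matrix on `n` points. -/
def addPoint (n M a b i j : ℕ) : ℕ :=
  bif Nat.blt i n && Nat.blt j n then ent M i j else slot n a i j + slot n b i j

lemma slot_comm (a b i j : ℕ) : slot a b i j = slot a b j i := by
  simp only [slot, Bool.and_comm, Bool.or_comm]

lemma slot_eq (a b i j : ℕ) :
    slot a b i j = if (i = a ∧ j = b) ∨ (i = b ∧ j = a) then 1 else 0 := by
  simp only [slot, cond_eq_ite, Bool.or_eq_true, Bool.and_eq_true, beq_iff_eq]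

lemma Grown.addEdge {M a b : ℕ} (hw : ∀ i j, w i j = w j i) (h : Grown P w U n (ent M) σ)
    (hab : ent M a b < w (σ a) (σ b)) : Grown P w U n (addEdge M a b) σ where
  mem := h.mem
  inj := h.inj
  card_le := h.card_le
  mem_iff := h.mem_iff
  le i hi j hj := by
    have := h.le i hi j hj
    rw [ApexObstruction.addEdge, slot_eq]
    split_ifs with hs
    · rcases hs with ⟨rfl, rfl⟩ | ⟨rfl, rfl⟩
      · exact hab
      · rw [ent_comm, hw]
        exact hab
    · exact this

lemma Grown.addPoint {M a b : ℕ} (hw : ∀ i j, w i j = w j i) (h : Grown P w U n (ent M) σ)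
    {x : ι} (hx : x ∈ P) (hxU : x ∉ U) (hxσ : ∀ i < n, σ i ≠ x)
    (hedge : ∀ j < n, slot n a n j + slot n b n j ≤ w x (σ j))
    (hloop : slot n a n n + slot n b n n ≤ w x x) :
    Grown P w U (n + 1) (addPoint n M a b) (Function.update σ n x) := by
  have h1 : ∀ i < n, Function.update σ n x i = σ i := fun i hi =>
    Function.update_of_ne hi.ne _ _
  have h2 : Function.update σ n x n = x := Function.update_self _ _ _
  have hb : ∀ i < n, Nat.blt i n = true := fun i hi => Nat.blt_eq.mpr hi
  have hn : Nat.blt n n = false := by rw [Bool.eq_false_iff, ne_eq, Nat.blt_eq]; exact lt_irrefl n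
  refine ⟨⟨?_, ?_, ?_⟩, h.card_le.trans n.le_succ, ?_⟩
  · intro i hi
    rcases Nat.lt_succ_iff_lt_or_eq.1 hi with hi | rfl
    · rw [h1 i hi]; exact h.mem i hi
    · rwa [h2]
  · intro i hi j hj hij
    rcases Nat.lt_succ_iff_lt_or_eq.1 hi with hi | rfl <;>
      rcases Nat.lt_succ_iff_lt_or_eq.1 hj with hj | rfl
    · rw [h1 i hi, h1 j hj]; exact h.inj i hi j hj hij
    · rw [h1 i hi, h2]; exact hxσ i hi
    · rw [h1 j hj, h2]; exact (hxσ j hj).symm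
    · exact absurd rfl hij
  · intro i hi j hj
    rcases Nat.lt_succ_iff_lt_or_eq.1 hi with hi | rfl <;>
      rcases Nat.lt_succ_iff_lt_or_eq.1 hj with hj | rfl
    · rw [h1 i hi, h1 j hj]; simpa [ApexObstruction.addPoint, hb i hi, hb j hj] using h.le i hi j hj
    · rw [h1 i hi, h2, hw, ApexObstruction.addPoint, hn, slot_comm, slot_comm _ b]
      simpa using hedge i hi
    · rw [h1 j hj, h2, ApexObstruction.addPoint, hn]
      simpa using hedge j hj
    · rw [h2, ApexObstruction.addPoint, hn]
      simpa using hloop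
  · intro i hi
    rcases Nat.lt_succ_iff_lt_or_eq.1 hi with hi | rfl
    · rw [h1 i hi]; exact h.mem_iff i hi
    · rw [h2]
      exact ⟨fun h => absurd h hxU, fun h' => absurd h' h.card_le.not_gt⟩

/-- A sum of at least two has a summand of at least two or two positive summands. -/
lemma exists_of_two_le_sum {A : Finset ι} {f : ι → ℕ} (h : 2 ≤ ∑ u ∈ A, f u) :
    (∃ u ∈ A, 2 ≤ f u) ∨ ∃ u ∈ A, ∃ v ∈ A, u ≠ v ∧ 1 ≤ f u ∧ 1 ≤ f v := by
  obtain ⟨u, hu, hne⟩ := Finset.exists_ne_zero_of_sum_ne_zero (s := A) (f := f) (by omega)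
  by_cases h2 : 2 ≤ f u
  · exact .inl ⟨u, hu, h2⟩
  rw [← Finset.add_sum_erase A f hu] at h
  obtain ⟨v, hv, hne'⟩ :=
    Finset.exists_ne_zero_of_sum_ne_zero (s := A.erase u) (f := f) (by omega)
  rw [Finset.mem_erase] at hv
  exact .inr ⟨u, hu, v, hv.2, hv.1.symm, by omega, by omega⟩

end Growth

section GrowthCheck

open scoped Classical

/-- A reason why a configuration is done: a bad set contradicting minimality, a leaf, or an earlier
configuration. -/
inductive Code
  | cut (S : ℕ)
  | win (t lam : ℕ)
  | ptr (b lam : ℕ)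

/-- `dsum` over the points below `n` belonging to the bit set `S`. -/
def dsumTo (S : ℕ) (g : ℕ → ℕ → ℕ) (n : ℕ) : ℕ :=
  sumTo (fun i => bif S.testBit i then
    g i i + sumTo (fun j => bif S.testBit j then g i j else 0) n else 0) n

/-- The bit set `S` is bad, and smaller than `k` or disjoint from an edge. -/
def cutCheck (k n : ℕ) (g : ℕ → ℕ → ℕ) (S : ℕ) : Bool :=
  Nat.blt (2 * sumTo (fun i => bif S.testBit i then 1 else 0) n) (dsumTo S g n) &&
  (Nat.blt (sumTo (fun i => bif S.testBit i then 1 else 0) n) k ||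
    anyTo (fun a => !S.testBit a && anyTo (fun b => !S.testBit b && Nat.ble 1 (g a b)) a) n)

/-- Check a reason; `T` lists the forcing matrices and `R` the earlier configurations. -/
def codeCheck (T : List (ℕ × ℕ)) (R : List (ℕ × ℕ × ℕ)) (k n : ℕ) (g : ℕ → ℕ → ℕ) : Code → Bool
  | .cut S => cutCheck k n g S
  | .win t lam => leafCheck T n g t lam
  | .ptr b lam =>
    match R[b]? with
    | some r => r.1 == k && Nat.ble k r.2.1 && embedCheck r.2.1 (ent r.2.2) n g lam &&
        allTo (fun i => Nat.blt i k == Nat.blt (digit lam i) k) r.2.1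
    | none => false

/-- The configuration `r = (k, n, M)`, with `M` a packed matrix on `n` points, cannot occur in a
tight multigraph with a smallest bad set `U` of size `k` at its first `k` points. -/
def Dead (T : List (ℕ × ℕ)) (r : ℕ × ℕ × ℕ) : Prop :=
  ∀ (ι : Type) (P : Finset ι) (w : ι → ι → ℕ) (U : Finset ι) (σ : ℕ → ι), Tight P w →
    IsMinBad P w U → #U = r.1 → Grown P w U r.2.1 (ent r.2.2) σ → HasLeaf T P w

variable {ι : Type} {P U : Finset ι} {w : ι → ι → ℕ} {n : ℕ} {g : ℕ → ℕ → ℕ} {σ : ℕ → ι}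
  {T : List (ℕ × ℕ)} {R : List (ℕ × ℕ × ℕ)}

lemma dsumTo_eq (S : ℕ) (g : ℕ → ℕ → ℕ) (n : ℕ) :
    dsumTo S g n = dsum g ((range n).filter fun i => S.testBit i) := by
  simp only [dsumTo, sumTo_eq, dsum, Finset.sum_filter, cond_eq_ite]

lemma false_of_cutCheck (h : Tight P w) (hU : IsMinBad P w U) (hσ : Grown P w U n g σ) {S : ℕ}
    (hc : cutCheck #U n g S = true) : False := by
  simp only [cutCheck, Bool.and_eq_true, Bool.or_eq_true, Nat.blt_eq, Nat.ble_eq, anyTo_iff,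
    Bool.not_eq_true', dsumTo_eq, sumTo_eq, cond_eq_ite, ← Finset.card_filter] at hc
  obtain ⟨h1, h2⟩ := hc
  set F := (range n).filter fun i => S.testBit i with hF
  have hFn : F ⊆ range n := Finset.filter_subset _ _
  have hinj := hσ.injOn hFn
  have hsub : F.image σ ⊆ P := by
    intro x hx
    obtain ⟨i, hi, rfl⟩ := Finset.mem_image.1 hx
    exact hσ.mem i (Finset.mem_range.1 (hFn hi))
  have hbad : 2 * #(F.image σ) < dsum w (F.image σ) := by
    rw [Finset.card_image_of_injOn hinj, dsum_image hinj]
    exact h1.trans_le (dsum_mono fun i hi j hj =>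
      hσ.le i (Finset.mem_range.1 (hFn hi)) j (Finset.mem_range.1 (hFn hj)))
  have hnot : ∀ a < n, S.testBit a = false → σ a ∉ F.image σ := by
    intro a ha hS hmem
    obtain ⟨i, hi, hia⟩ := Finset.mem_image.1 hmem
    have hin := Finset.mem_filter.1 hi
    refine hσ.inj i (Finset.mem_range.1 hin.1) a ha ?_ hia
    rintro rfl
    rw [hS] at hin
    exact absurd hin.2 (by simp)
  rcases h2 with h2 | ⟨a, ha, hSa, b, hb, hSb, hg⟩
  · have := hU.le _ hsub hbad
    rw [Finset.card_image_of_injOn hinj] at this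
    omega
  · have hbn : b < n := hb.trans ha
    have h3 := h.indep _ hsub hbad _ (hσ.mem a ha) (hnot a ha hSa) _ (hσ.mem b hbn)
      (hnot b hbn hSb) (hσ.inj a ha b hbn hb.ne')
    have h4 := hσ.le a ha b hbn
    omega

lemma hasLeaf_of_codeCheck (hR : ∀ r ∈ R, Dead T r) (h : Tight P w) (hU : IsMinBad P w U)
    (hσ : Grown P w U n g σ) {c : Code} (hc : codeCheck T R #U n g c = true) : HasLeaf T P w := by
  match c with
  | .cut S => exact (false_of_cutCheck h hU hσ hc).elim
  | .win t lam => exact ⟨n, g, σ, t, lam, hσ.toEmb, hc⟩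
  | .ptr b lam =>
    rw [codeCheck] at hc
    split at hc
    next r hr =>
      simp only [Bool.and_eq_true, Nat.ble_eq, allTo_iff, Bool.beq_eq_decide_eq,
        decide_eq_true_eq, embedCheck_iff] at hc
      obtain ⟨⟨⟨h1, h2⟩, h3, h4, h5⟩, h6⟩ := hc
      refine hR r (List.mem_of_getElem? hr) ι P w U (fun i => σ (digit lam i)) h hU h1.symm
        ⟨⟨fun i hi => hσ.mem _ (h3 i hi),
          fun i hi j hj hij => hσ.inj _ (h3 i hi) _ (h3 j hj) (h4 i hi j hj hij),
          fun i hi j hj => (h5 i hi j hj).trans (hσ.le _ (h3 i hi) _ (h3 j hj))⟩, h2,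
          fun i hi => ?_⟩
      rw [hσ.mem_iff _ (h3 i hi), ← Nat.blt_eq, ← Nat.blt_eq, h6 i hi]
    next => cases hc

/-- Check each element of the first list with the corresponding one of the second list. -/
def zipAll {α β : Type} (f : α → β → Bool) : List α → List β → Bool
  | [], _ => true
  | _ :: _, [] => false
  | a :: l, b :: m => f a b && zipAll f l m

lemma exists_of_zipAll {α β : Type} {f : α → β → Bool} : ∀ {l : List α} {m : List β},
    zipAll f l m = true → ∀ a ∈ l, ∃ b, f a b = true
  | [], _, _ => by simp
  | a :: l, [], h => by cases h
  | a :: l, b :: m, h => by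
    rw [zipAll, Bool.and_eq_true] at h
    exact List.forall_mem_cons.2 ⟨⟨b, h.1⟩, exists_of_zipAll h.2⟩

/-- The possible new edges among the `n` points other than `p`, where the points from `k` onwards
are independent. -/
def edgeSlots (n k p : ℕ) : List (ℕ × ℕ) :=
  (List.range n).flatMap fun a => ((List.range (a + 1)).filter fun b =>
    !(a == p) && !(b == p) && (a == b || Nat.blt b k)).map fun b => (a, b)

/-- The possible pairs of neighbours of a new point `n` among the first `k` points other than `p`
and the new point itself. -/
def pointSlots (n k p : ℕ) : List (ℕ × ℕ) :=
  (List.range k).flatMap fun a => ((n :: List.range (a + 1)).filter fun b =>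
    !(a == p) && !(b == p)).map fun b => (a, b)

lemma mem_edgeSlots {n k p a b : ℕ} : (a, b) ∈ edgeSlots n k p ↔
    a < n ∧ b ≤ a ∧ (a ≠ p ∧ b ≠ p) ∧ (a = b ∨ b < k) := by
  simp [edgeSlots, and_assoc]

lemma mem_pointSlots {n k p a b : ℕ} : (a, b) ∈ pointSlots n k p ↔
    a < k ∧ (b = n ∨ b ≤ a) ∧ a ≠ p ∧ b ≠ p := by
  simp only [pointSlots, List.mem_flatMap, List.mem_range, List.mem_map, List.mem_filter,
    List.mem_cons, Nat.lt_succ_iff, Bool.and_eq_true, Bool.not_eq_true', beq_eq_false_iff_ne,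
    Prod.mk.injEq]
  constructor
  · rintro ⟨a', ha, b', ⟨hb, h⟩, rfl, rfl⟩
    exact ⟨ha, hb, h⟩
  · rintro ⟨ha, hb, h⟩
    exact ⟨a, ha, b, ⟨hb, h⟩, rfl, rfl⟩

/-- The points of the packed matrix other than `p` have an orientation with outdegrees at most
one. -/
def orientCheck (n M p phi : ℕ) : Bool :=
  allTo (fun i => i == p || allTo (fun j => j == p ||
    Nat.ble (bif i == j then 2 * ent M i j else ent M i j)
      ((bif digit phi i == j then 1 else 0) + bif digit phi j == i then 1 else 0)) n) n

/-- A configuration `(k, n, mat)`; if `p < k`, it is extended by an edge or a point using a bad set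
avoiding the point `p`, otherwise by an edge inside of the first `k` points. -/
structure Grow where
  k : ℕ
  n : ℕ
  mat : ℕ
  p : ℕ
  phi : ℕ
  edges : List Code
  points : List Code

/-- Check all extensions of a configuration. -/
def Grow.check (T : List (ℕ × ℕ)) (R : List (ℕ × ℕ × ℕ)) (e : Grow) : Bool :=
  bif Nat.blt e.p e.k then
    orientCheck e.n e.mat e.p e.phi &&
    zipAll (fun s c => codeCheck T R e.k e.n (addEdge e.mat s.1 s.2) c)
      (edgeSlots e.n e.k e.p) e.edges &&
    zipAll (fun s c => codeCheck T R e.k (e.n + 1) (addPoint e.n e.mat s.1 s.2) c)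
      (pointSlots e.n e.k e.p) e.points
  else
    Nat.ble (dsumTo (2 ^ e.k - 1) (ent e.mat) e.k) (2 * e.k) &&
    zipAll (fun s c => codeCheck T R e.k e.n (addEdge e.mat s.1 s.2) c)
      (edgeSlots e.k e.k e.p) e.edges

lemma dsum_le_of_orientCheck {M p phi : ℕ} (hc : orientCheck n M p phi = true) {F : Finset ℕ}
    (hF : F ⊆ range n) (hp : p ∉ F) : dsum (ent M) F ≤ 2 * #F := by
  simp only [orientCheck, allTo_iff, Bool.or_eq_true, beq_iff_eq, Nat.ble_eq, cond_eq_ite] at hc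
  have h1 : dsum (ent M) F ≤ ∑ i ∈ F, ∑ j ∈ F,
      ((if digit phi i = j then 1 else 0) + if digit phi j = i then 1 else 0) := by
    refine Finset.sum_le_sum fun i hi => ?_
    have h2 : ∑ j ∈ F, (if i = j then ent M i i else 0) = ent M i i := by simp [hi]
    rw [← h2, ← Finset.sum_add_distrib]
    refine Finset.sum_le_sum fun j hj => ?_
    have h3 := ((hc i (Finset.mem_range.1 (hF hi))).resolve_left (fun h => hp (h ▸ hi)) j
      (Finset.mem_range.1 (hF hj))).resolve_left (fun h => hp (h ▸ hj))
    refine le_trans ?_ h3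
    split_ifs with hij
    · subst hij
      omega
    · omega
  have h4 : ∑ i ∈ F, ∑ j ∈ F, (if digit phi i = j then 1 else 0) ≤ ∑ i ∈ F, 1 :=
    Finset.sum_le_sum fun i _ => by
      rw [Finset.sum_ite_eq]
      split_ifs <;> simp
  have h5 : ∑ i ∈ F, ∑ j ∈ F, (if digit phi j = i then 1 else 0) =
      ∑ i ∈ F, ∑ j ∈ F, (if digit phi i = j then 1 else 0) := Finset.sum_comm
  simp only [Finset.sum_add_distrib] at h1
  rw [← Finset.card_eq_sum_ones] at h4
  omega

lemma Grow.dead (hR : ∀ r ∈ R, Dead T r) {e : Grow} (hc : e.check T R = true) :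
    Dead T (e.k, e.n, e.mat) := by
  obtain ⟨k, n, M, p, phi, edges, points⟩ := e
  intro ι P w U σ h hU hk hσ
  simp only at hk hσ
  subst hk
  by_contra hno
  have hedge : ∀ {m : ℕ}, m ≤ n → zipAll (fun s c => codeCheck T R #U n (addEdge M s.1 s.2) c)
      (edgeSlots m #U p) edges = true →
      ∀ a < m, a ≠ p → ∀ b < m, b ≠ p → w (σ a) (σ b) ≤ ent M a b := by
    intro m hm hz
    have key : ∀ a < m, a ≠ p → ∀ b ≤ a, b ≠ p → w (σ a) (σ b) ≤ ent M a b := by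
      intro a ha hap b hb hbp
      by_contra! hlt
      by_cases hs : a = b ∨ b < #U
      · obtain ⟨c, hc⟩ := exists_of_zipAll hz (a, b) (mem_edgeSlots.2 ⟨ha, hb, ⟨hap, hbp⟩, hs⟩)
        exact hno (hasLeaf_of_codeCheck hR h hU (hσ.addEdge h.symm hlt) hc)
      · push Not at hs
        have h1 := h.indep U hU.sub hU.bad (σ a) (hσ.mem a (by omega))
          (fun h => by have := (hσ.mem_iff a (by omega)).1 h; omega)
          (σ b) (hσ.mem b (by omega))
          (fun h => by have := (hσ.mem_iff b (by omega)).1 h; omega)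
          (hσ.inj a (by omega) b (by omega) hs.1)
        omega
    intro a ha hap b hb hbp
    rcases le_total b a with hba | hab
    · exact key a ha hap b hba hbp
    · rw [h.symm, ent_comm]
      exact key b hb hbp a hab hap
  simp only [Grow.check] at hc
  by_cases hp : p < #U
  · rw [Nat.blt_eq.mpr hp] at hc
    simp only [cond_true, Bool.and_eq_true] at hc
    obtain ⟨⟨horient, hz⟩, hz'⟩ := hc
    have hpn : p < n := hp.trans_le hσ.card_le
    have hle := hedge le_rfl hz
    have hnew : ∀ x ∈ P, x ∉ U → (∀ i < n, σ i ≠ x) →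
        w x x + ∑ u ∈ U.erase (σ p), w x u ≤ 1 := by
      intro x hx hxU hxσ
      by_contra! hlt
      have hne : ∀ {u}, u ∈ U.erase (σ p) → ∃ a < #U, a ≠ p ∧ σ a = u := by
        intro u hu
        rw [Finset.mem_erase] at hu
        obtain ⟨a, ha, rfl⟩ := hσ.exists_eq hu.2
        exact ⟨a, ha, fun h => hu.1 (by rw [h]), rfl⟩
      have hpt : ∀ a < #U, a ≠ p → ∀ b, (b = n ∨ b ≤ a) → b ≠ p →
          (∀ j < n, slot n a n j + slot n b n j ≤ w x (σ j)) →
          slot n a n n + slot n b n n ≤ w x x → False := by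
        intro a ha hap b hb hbp h1 h2
        obtain ⟨c, hc⟩ := exists_of_zipAll hz' (a, b) (mem_pointSlots.2 ⟨ha, hb, hap, hbp⟩)
        exact hno (hasLeaf_of_codeCheck hR h hU (hσ.addPoint h.symm hx hxU hxσ h1 h2) hc)
      have hUn := hσ.card_le
      have hl := h.loop_le_one hx
      by_cases hl0 : w x x = 0
      · rcases exists_of_two_le_sum (by omega : 2 ≤ ∑ u ∈ U.erase (σ p), w x u) with
          ⟨u, hu, h2⟩ | ⟨u, hu, v, hv, huv, h1, h2⟩
        · obtain ⟨a, ha, hap, rfl⟩ := hne hu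
          refine hpt a ha hap a (.inr le_rfl) hap (fun j hj => ?_) ?_
          · simp only [slot_eq]
            by_cases hja : j = a
            · subst hja
              split_ifs <;> omega
            · rw [if_neg (by omega)]
              omega
          · simp only [slot_eq]
            rw [if_neg (by omega)]
            omega
        · obtain ⟨a, ha, hap, rfl⟩ := hne hu
          obtain ⟨b, hb, hbp, rfl⟩ := hne hv
          have hab : a ≠ b := fun h => huv (by rw [h])
          have hfin : ∀ a b, a < #U → b < #U → b < a → 1 ≤ w x (σ a) → 1 ≤ w x (σ b) →
              (∀ j < n, slot n a n j + slot n b n j ≤ w x (σ j)) ∧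
              slot n a n n + slot n b n n ≤ w x x := by
            intro a b ha hb hba h1 h2
            simp only [slot_eq]
            refine ⟨fun j hj => ?_, ?_⟩
            · have e1 : j = a → 1 ≤ w x (σ j) := fun h => h ▸ h1
              have e2 : j = b → 1 ≤ w x (σ j) := fun h => h ▸ h2
              split_ifs <;> omega
            · rw [if_neg (by omega), if_neg (by omega)]
              omega
          rcases lt_or_gt_of_ne hab with hlt | hgt
          · obtain ⟨h3, h4⟩ := hfin b a hb ha hlt h2 h1
            exact hpt b hb hbp a (.inr hlt.le) hap h3 h4
          · obtain ⟨h3, h4⟩ := hfin a b ha hb hgt h1 h2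
            exact hpt a ha hap b (.inr hgt.le) hbp h3 h4
      · obtain ⟨u, hu, h1⟩ := Finset.exists_ne_zero_of_sum_ne_zero
          (s := U.erase (σ p)) (f := fun u => w x u) (by omega)
        obtain ⟨a, ha, hap, rfl⟩ := hne hu
        refine hpt a ha hap n (.inl rfl) hpn.ne' (fun j hj => ?_) ?_
        · simp only [slot_eq]
          have e1 : j = a → w x (σ j) ≠ 0 := fun h => h ▸ h1
          split_ifs <;> omega
        · simp only [slot_eq]
          rw [if_neg (by omega)]
          split_ifs <;> omega
    obtain ⟨Y, hY, hpY, hbad⟩ := h.avoid (σ p)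
    let F := (range n).filter fun i => σ i ∈ Y
    have hFn : F ⊆ range n := Finset.filter_subset _ _
    have hinj := hσ.injOn hFn
    have hpF : p ∉ F := fun h => hpY (Finset.mem_filter.1 h).2
    have hF : dsum w (F.image σ) ≤ 2 * #(F.image σ) := by
      rw [dsum_image hinj, Finset.card_image_of_injOn hinj]
      refine (dsum_mono fun i hi j hj => ?_).trans (dsum_le_of_orientCheck horient hFn hpF)
      exact hle i (Finset.mem_range.1 (hFn hi)) (fun h => hpF (h ▸ hi)) j
        (Finset.mem_range.1 (hFn hj)) (fun h => hpF (h ▸ hj))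
    have hFY : F.image σ ⊆ Y := by
      intro x hx
      obtain ⟨i, hi, rfl⟩ := Finset.mem_image.1 hx
      exact (Finset.mem_filter.1 hi).2
    have hall : ∀ Z ⊆ Y \ F.image σ, dsum w (F.image σ ∪ Z) ≤ 2 * #(F.image σ ∪ Z) := by
      intro Z
      induction Z using Finset.induction_on with
      | empty => simpa using hF
      | insert z Z hz ih =>
        intro hZ
        obtain ⟨hzY, hZ'⟩ := Finset.insert_subset_iff.1 hZ
        rw [Finset.mem_sdiff] at hzY
        have hzσ : ∀ i < n, σ i ≠ z := by
          rintro i hi rfl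
          exact hzY.2 (Finset.mem_image_of_mem σ
            (Finset.mem_filter.2 ⟨Finset.mem_range.2 hi, hzY.1⟩))
        have hzU : z ∉ U := by
          intro hzU
          obtain ⟨i, hi, hiz⟩ := hσ.exists_eq hzU
          exact hzσ i (hi.trans_le hσ.card_le) hiz
        have hnot : z ∉ F.image σ ∪ Z := by simp [hzY.2, hz]
        have hsubY : F.image σ ∪ Z ⊆ Y :=
          Finset.union_subset hFY (hZ'.trans Finset.sdiff_subset)
        have h1 : ∑ j ∈ F.image σ ∪ Z, w z j ≤ ∑ j ∈ U.erase (σ p), w z j := by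
          refine Finset.sum_le_sum_of_ne_zero fun j hj hne => ?_
          rw [Finset.mem_erase]
          refine ⟨fun h => hpY (h ▸ hsubY hj), ?_⟩
          by_contra hjU
          exact hne (h.indep U hU.sub hU.bad z (hY hzY.1) hzU j (hY (hsubY hj)) hjU
            fun h => hnot (h ▸ hj))
        have h2 := hnew z (hY hzY.1) hzU hzσ
        have h3 := ih hZ'
        rw [Finset.union_insert, dsum_insert h.symm hnot, Finset.card_insert_of_notMem hnot]
        omega
    have h1 := hall _ subset_rfl
    rw [Finset.union_sdiff_of_subset hFY] at h1
    omega
  · rw [Bool.eq_false_iff.2 (fun h => hp (Nat.blt_eq.mp h))] at hc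
    simp only [cond_false, Bool.and_eq_true, Nat.ble_eq, dsumTo_eq] at hc
    obtain ⟨hd, hz⟩ := hc
    have hle := hedge hσ.card_le hz
    have hF : (range #U).filter (fun i => (2 ^ #U - 1).testBit i) = range #U :=
      Finset.filter_true_of_mem fun i hi => by
        rw [Nat.testBit_two_pow_sub_one]
        simpa using hi
    have hsub : range #U ⊆ range n := Finset.range_subset_range.2 hσ.card_le
    have hinj := hσ.injOn hsub
    have himg : (range #U).image σ = U := by
      refine Finset.Subset.antisymm (fun x hx => ?_) fun u hu => ?_
      · obtain ⟨i, hi, rfl⟩ := Finset.mem_image.1 hx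
        exact (hσ.mem_iff i (Finset.mem_range.1 (hsub hi))).2 (Finset.mem_range.1 hi)
      · obtain ⟨i, hi, rfl⟩ := hσ.exists_eq hu
        exact Finset.mem_image_of_mem σ (Finset.mem_range.2 hi)
    have hbad := hU.bad
    rw [hF] at hd
    have h1 : dsum w U ≤ dsum (ent M) (range #U) := by
      conv_lhs => rw [← himg, dsum_image hinj]
      refine dsum_mono fun i hi j hj => ?_
      rw [Finset.mem_range] at hi hj
      exact hle i hi (by omega) j hj (by omega)
    omega

/-- Check a list of configurations, each with respect to `R` and the preceding ones. -/
def checkGrows (T : List (ℕ × ℕ)) : List (ℕ × ℕ × ℕ) → List Grow → Bool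
  | _, [] => true
  | R, e :: l => e.check T R && checkGrows T ((e.k, e.n, e.mat) :: R) l

lemma dead_of_checkGrows (l : List Grow) : ∀ R : List (ℕ × ℕ × ℕ), (∀ r ∈ R, Dead T r) →
    checkGrows T R l = true → ∀ e ∈ l, Dead T (e.k, e.n, e.mat) := by
  induction l with
  | nil => simp
  | cons e l ih =>
    intro R hR hc
    rw [checkGrows, Bool.and_eq_true] at hc
    have he := e.dead hR hc.1
    exact List.forall_mem_cons.2 ⟨he, ih _ (List.forall_mem_cons.2 ⟨he, hR⟩) hc.2⟩

end GrowthCheck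

/-- A case distinction growing a smallest bad set; the configurations `(k, k, 0)` come last for each
size `k`. -/
def growths : List Grow :=
  [
    ⟨2, 3, 1052961, 0, 543, [.cut 2, .win 133 528, .cut 4], [.cut 5, .cut 5]⟩,
    ⟨2, 3, 1118241, 0, 559, [.win 133 528, .win 62 513, .cut 4], [.cut 5, .cut 5]⟩,
    ⟨2, 3, 1052705, 0, 767, [.ptr 1 528, .ptr 0 528, .cut 4], [.cut 5, .cut 5]⟩,
    ⟨2, 3, 74017, 0, 287, [.cut 2, .win 62 258, .win 62 528], [.cut 5, .cut 5]⟩,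
    ⟨2, 3, 8481, 0, 3871, [.cut 2, .ptr 0 528, .ptr 3 528], [.cut 5, .cut 5]⟩,
    ⟨2, 3, 139297, 0, 303, [.win 62 258, .win 93 33, .win 62 513], [.cut 5, .cut 5]⟩,
    ⟨2, 3, 73761, 0, 3887, [.ptr 2 528, .ptr 0 528, .ptr 4 528], [.cut 5, .cut 5]⟩,
    ⟨2, 3, 8225, 0, 4095, [.ptr 2 528, .ptr 0 528, .ptr 4 528], [.cut 5, .cut 5]⟩,
    ⟨2, 2, 33, 1, 240, [.cut 1], [.ptr 5 528, .ptr 0 528]⟩,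
    ⟨2, 3, 1114385, 1, 752, [.cut 1, .win 133 528, .cut 4], [.cut 6, .cut 6]⟩,
    ⟨2, 3, 135441, 1, 240, [.cut 1, .win 62 258, .win 133 528], [.cut 6, .cut 6]⟩,
    ⟨2, 3, 131345, 1, 4080, [.cut 1, .ptr 0 528, .ptr 1 528], [.cut 6, .cut 6]⟩,
    ⟨2, 2, 273, 0, 31, [.cut 2], [.ptr 2 528, .ptr 0 528]⟩,
    ⟨2, 2, 17, 2, 0, [.cut 1, .ptr 4 16, .ptr 0 16], []⟩,
    ⟨2, 2, 257, 2, 0, [.cut 1, .ptr 1 16, .cut 2], []⟩,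
    ⟨2, 2, 1, 2, 0, [.cut 1, .ptr 1 16, .ptr 0 16], []⟩,
    ⟨2, 3, 1183792, 1, 754, [.win 62 513, .win 93 528, .cut 4], [.cut 6, .cut 6]⟩,
    ⟨2, 3, 1179696, 1, 767, [.ptr 8 16, .ptr 0 528, .cut 4], [.cut 6, .cut 6]⟩,
    ⟨2, 4, 68989030448, 1, 13042, [.cut 5, .cut 5, .cut 4, .win 141 12816, .cut 8], [.cut 14, .cut
      14]⟩,
    ⟨2, 4, 68989026352, 1, 13055, [.ptr 10 16, .ptr 0 12816, .cut 4, .ptr 0 8976, .cut 8], [.cut 14,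
      .cut 14]⟩,
    ⟨2, 4, 554766384, 1, 754, [.cut 5, .cut 5, .cut 4, .win 152 8451, .cut 10], [.cut 14, .cut 14]⟩,
    ⟨2, 4, 537989168, 1, 62194, [.cut 5, .cut 5, .cut 4, .ptr 0 12816, .cut 10], [.cut 14, .cut
      14]⟩,
    ⟨2, 4, 571539504, 1, 755, [.cut 9, .win 152 8451, .cut 4, .cut 9, .cut 9], [.cut 14, .cut 14]⟩,
    ⟨2, 4, 554762288, 1, 62195, [.ptr 14 16, .ptr 2 12816, .cut 4, .ptr 0 12816, .ptr 6 784], [.cut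
      14, .cut 14]⟩,
    ⟨2, 4, 537985072, 1, 62207, [.ptr 15 16, .ptr 2 12816, .cut 4, .ptr 0 12816, .ptr 6 784], [.cut
      14, .cut 14]⟩,
    ⟨2, 3, 1114160, 0, 559, [.ptr 22 513, .ptr 7 528, .cut 4], [.ptr 5 12816, .ptr 0 12816]⟩,
    ⟨2, 3, 204848, 1, 242, [.win 93 33, .win 115 528, .win 93 528], [.cut 6, .cut 6]⟩,
    ⟨2, 3, 200752, 1, 4082, [.ptr 18 16, .ptr 0 528, .ptr 10 528], [.cut 6, .cut 6]⟩,
    ⟨2, 3, 196656, 1, 4095, [.ptr 19 16, .ptr 0 528, .ptr 10 528], [.cut 6, .cut 6]⟩,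
    ⟨2, 4, 553787440, 1, 242, [.cut 5, .cut 5, .cut 5, .win 91 4896, .cut 10], [.cut 14, .cut 14]⟩,
    ⟨2, 4, 537010224, 1, 61682, [.cut 5, .cut 5, .cut 5, .ptr 0 12816, .cut 10], [.cut 14, .cut
      14]⟩,
    ⟨2, 4, 553783344, 1, 4082, [.ptr 22 16, .ptr 1 12816, .cut 6, .ptr 1 8976, .cut 10], [.cut 14,
      .cut 14]⟩,
    ⟨2, 4, 537006128, 1, 65522, [.ptr 23 16, .ptr 1 12816, .ptr 15 528, .ptr 0 12816, .cut 10],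
      [.cut 14, .cut 14]⟩,
    ⟨2, 4, 537002032, 1, 65535, [.ptr 24 16, .ptr 0 12816, .ptr 15 528, .ptr 0 8976, .ptr 15 784],
      [.cut 14, .cut 14]⟩,
    ⟨2, 3, 131120, 0, 303, [.ptr 26 513, .ptr 5 528, .ptr 16 528], [.ptr 9 8976, .ptr 0 12816]⟩,
    ⟨2, 2, 48, 0, 255, [.ptr 26 1], [.ptr 9 528, .ptr 0 528]⟩,
    ⟨2, 2, 32, 2, 0, [.ptr 27 16, .ptr 0 16, .ptr 27 1], []⟩,
    ⟨2, 2, 16, 2, 0, [.ptr 23 16, .ptr 0 16, .ptr 23 1], []⟩,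
    ⟨2, 2, 0, 2, 0, [.ptr 22 16, .ptr 0 16, .ptr 22 1], []⟩,
    ⟨3, 4, 73014513681, 2, 16128, [.cut 1, .cut 3, .cut 3, .cut 9, .win 141 12321, .cut 8], [.cut
      17, .cut 17, .cut 13, .cut 13, .cut 13]⟩,
    ⟨3, 4, 4580249617, 0, 4911, [.cut 3, .win 146 531, .cut 5, .win 146 786, .win 146 801, .cut 9],
      [.cut 13, .cut 13, .cut 11, .cut 11, .cut 11]⟩,
    ⟨3, 4, 4311814161, 2, 3840, [.cut 1, .cut 3, .cut 3, .cut 9, .ptr 0 12816, .cut 9], [.cut 17,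
      .cut 17, .cut 13, .cut 13, .cut 13]⟩,
    ⟨3, 4, 8858439697, 2, 7936, [.cut 1, .cut 3, .cut 3, .win 146 801, .win 152 531, .cut 12], [.cut
      14, .cut 14, .cut 13, .cut 13, .cut 13]⟩,
    ⟨3, 4, 8590004241, 2, 65280, [.cut 1, .cut 3, .cut 3, .ptr 1 12816, .ptr 0 12816, .cut 12],
      [.cut 17, .cut 17, .cut 13, .cut 13, .cut 13]⟩,
    ⟨3, 3, 69649, 1, 240, [.cut 1, .cut 5, .cut 5], [.cut 9, .cut 9, .ptr 4 12816, .ptr 2 12816,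
      .ptr 0 12816]⟩,
    ⟨3, 3, 4113, 3, 0, [.cut 1, .cut 3, .cut 3, .cut 5, .ptr 0 528, .cut 5], []⟩,
    ⟨3, 4, 73014575121, 1, 13296, [.cut 1, .ptr 6 12816, .cut 6, .cut 9, .cut 12, .cut 8], [.cut 14,
      .cut 14, .cut 28, .cut 14, .cut 28]⟩,
    ⟨3, 4, 4580311057, 1, 1008, [.cut 1, .win 146 531, .cut 6, .cut 9, .win 152 786, .cut 9], [.cut
      14, .cut 14, .cut 11, .cut 11, .cut 11]⟩,
    ⟨3, 4, 4311875601, 2, 3840, [.cut 1, .cut 3, .cut 3, .cut 9, .ptr 0 12816, .cut 9], [.cut 17,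
      .cut 17, .cut 19, .cut 19, .cut 19]⟩,
    ⟨3, 4, 8590065681, 1, 9200, [.cut 1, .ptr 5 12816, .cut 6, .ptr 0 12816, .cut 12, .cut 12],
      [.cut 14, .cut 14, .cut 28, .cut 14, .cut 28]⟩,
    ⟨3, 3, 131089, 1, 4080, [.cut 1, .ptr 5 528, .cut 6], [.cut 9, .cut 9, .ptr 3 12816, .ptr 1
      12816, .ptr 0 12816]⟩,
    ⟨3, 4, 4312858641, 0, 8751, [.cut 3, .cut 6, .cut 4, .win 141 8241, .cut 12, .cut 9], [.cut 13,
      .cut 13, .cut 20, .cut 13, .cut 20]⟩,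
    ⟨3, 3, 1114129, 1, 752, [.cut 1, .cut 5, .cut 4], [.cut 9, .cut 9, .cut 12, .ptr 0 12816, .cut
      12]⟩,
    ⟨3, 3, 65553, 3, 0, [.cut 1, .cut 3, .cut 3, .ptr 8 528, .ptr 2 528, .ptr 0 528], []⟩,
    ⟨3, 3, 1048593, 3, 0, [.cut 1, .cut 3, .cut 3, .cut 5, .ptr 1 528, .cut 4], []⟩,
    ⟨3, 3, 17, 3, 0, [.cut 1, .cut 3, .cut 3, .ptr 9 528, .ptr 1 528, .ptr 0 528], []⟩,
    ⟨3, 3, 1048833, 3, 0, [.cut 1, .cut 3, .cut 2, .cut 5, .cut 6, .cut 4], []⟩,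
    ⟨3, 3, 257, 3, 0, [.cut 1, .cut 3, .cut 2, .ptr 2 288, .ptr 2 33, .ptr 0 528], []⟩,
    ⟨3, 3, 131073, 3, 0, [.cut 1, .ptr 7 528, .cut 6, .ptr 7 288, .cut 6, .cut 6], []⟩,
    ⟨3, 3, 65537, 3, 0, [.cut 1, .ptr 5 528, .ptr 4 33, .ptr 5 288, .ptr 0 528, .ptr 4 18], []⟩,
    ⟨3, 3, 1, 3, 0, [.cut 1, .ptr 4 528, .ptr 2 528, .ptr 4 288, .ptr 0 528, .ptr 2 288], []⟩,
    ⟨3, 4, 68736393248, 0, 12591, [.cut 3, .cut 6, .cut 5, .win 152 12546, .win 152 12801, .cut 8],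
      [.cut 13, .cut 13, .cut 11, .cut 11, .cut 11]⟩,
    ⟨3, 4, 69004763168, 0, 12607, [.cut 3, .win 152 12546, .cut 5, .cut 10, .win 146 12546, .cut 8],
      [.cut 13, .cut 13, .cut 11, .cut 11, .cut 11]⟩,
    ⟨3, 4, 68736327712, 0, 16175, [.cut 3, .ptr 1 12816, .cut 5, .ptr 0 12816, .ptr 0 12576, .cut
      8], [.cut 13, .cut 13, .cut 11, .cut 11, .cut 11]⟩,
    ⟨3, 4, 73299664928, 0, 13119, [.cut 3, .win 146 12546, .cut 5, .cut 10, .cut 12, .cut 8], [.cut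
      13, .cut 13, .cut 11, .cut 11, .cut 11]⟩,
    ⟨3, 4, 69004697632, 0, 16191, [.cut 3, .ptr 2 12816, .cut 5, .cut 10, .ptr 0 12816, .cut 8],
      [.cut 13, .cut 13, .cut 11, .cut 11, .cut 11]⟩,
    ⟨3, 4, 68736262176, 0, 16383, [.cut 3, .ptr 2 12816, .cut 5, .ptr 0 12816, .ptr 0 12576, .cut
      8], [.cut 13, .cut 13, .cut 11, .cut 11, .cut 11]⟩,
    ⟨3, 4, 302129184, 0, 4399, [.cut 3, .cut 6, .cut 5, .win 91 4896, .win 92 8496, .cut 9], [.cut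
      13, .cut 13, .cut 11, .cut 11, .cut 11]⟩,
    ⟨3, 4, 33693728, 0, 61743, [.cut 3, .cut 6, .cut 5, .ptr 0 12816, .ptr 0 12576, .cut 9], [.cut
      13, .cut 13, .cut 11, .cut 11, .cut 11]⟩,
    ⟨3, 4, 570499104, 0, 4415, [.cut 3, .win 91 4896, .cut 5, .cut 10, .win 92 12576, .cut 9], [.cut
      13, .cut 13, .cut 11, .cut 11, .cut 11]⟩,
    ⟨3, 4, 4597030944, 0, 4911, [.cut 3, .win 92 8496, .cut 5, .win 92 12576, .win 92 12816, .cut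
      9], [.cut 13, .cut 13, .cut 11, .cut 11, .cut 11]⟩,
    ⟨3, 4, 302063648, 0, 7983, [.cut 3, .ptr 3 12816, .cut 5, .ptr 1 12816, .ptr 0 12816, .cut 9],
      [.cut 13, .cut 13, .cut 11, .cut 11, .cut 11]⟩,
    ⟨3, 4, 33628192, 0, 65327, [.cut 3, .ptr 3 12816, .cut 5, .ptr 0 12816, .ptr 0 12576, .cut 9],
      [.cut 13, .cut 13, .cut 11, .cut 11, .cut 11]⟩,
    ⟨3, 4, 4865400864, 0, 4927, [.cut 3, .win 92 12576, .cut 5, .cut 10, .win 91 12816, .cut 9],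
      [.cut 13, .cut 13, .cut 11, .cut 11, .cut 11]⟩,
    ⟨3, 4, 570433568, 0, 7999, [.cut 3, .ptr 4 12816, .cut 5, .cut 10, .ptr 0 12816, .cut 9], [.cut
      13, .cut 13, .cut 11, .cut 11, .cut 11]⟩,
    ⟨3, 4, 4596965408, 0, 5119, [.cut 3, .ptr 4 12816, .cut 5, .ptr 1 12816, .ptr 1 12576, .cut 9],
      [.cut 13, .cut 13, .cut 11, .cut 11, .cut 11]⟩,
    ⟨3, 4, 301998112, 0, 8191, [.cut 3, .ptr 4 12816, .cut 5, .ptr 1 12816, .ptr 0 12816, .cut 9],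
      [.cut 13, .cut 13, .cut 11, .cut 11, .cut 11]⟩,
    ⟨3, 4, 33562656, 0, 65535, [.cut 3, .ptr 4 12816, .cut 5, .ptr 0 12816, .ptr 0 12576, .cut 9],
      [.cut 13, .cut 13, .cut 11, .cut 11, .cut 11]⟩,
    ⟨3, 4, 73282887712, 0, 13119, [.cut 3, .win 152 12816, .cut 5, .cut 10, .cut 12, .cut 8], [.cut
      13, .cut 13, .cut 11, .cut 11, .cut 11]⟩,
    ⟨3, 4, 73014452256, 2, 16129, [.cut 3, .cut 3, .cut 3, .ptr 13 12576, .ptr 0 12816, .cut 8],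
      [.cut 19, .cut 19, .cut 13, .cut 13, .cut 13]⟩,
    ⟨3, 4, 4580253728, 0, 4911, [.cut 3, .win 114 8451, .cut 5, .win 92 12576, .win 92 12816, .win
      146 12546], [.cut 13, .cut 13, .cut 11, .cut 11, .cut 11]⟩,
    ⟨3, 4, 4848623648, 0, 4927, [.cut 3, .win 92 12576, .cut 5, .cut 10, .win 91 12816, .cut 10],
      [.cut 13, .cut 13, .cut 11, .cut 11, .cut 11]⟩,
    ⟨3, 4, 4580188192, 0, 5119, [.cut 3, .ptr 1 12816, .cut 5, .ptr 0 12816, .ptr 0 12576, .ptr 17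
      12816], [.cut 13, .cut 13, .cut 11, .cut 11, .cut 11]⟩,
    ⟨3, 4, 4311752736, 2, 3841, [.cut 3, .cut 3, .cut 3, .ptr 6 12576, .ptr 0 12816, .ptr 17 12576],
      [.cut 19, .cut 19, .cut 13, .cut 13, .cut 13]⟩,
    ⟨3, 4, 8858378272, 2, 7937, [.cut 3, .cut 3, .cut 3, .ptr 2 12576, .win 91 12816, .cut 12],
      [.cut 19, .cut 19, .cut 13, .cut 13, .cut 13]⟩,
    ⟨3, 4, 8589942816, 2, 65281, [.cut 3, .cut 3, .cut 3, .ptr 1 12816, .ptr 0 12816, .cut 12],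
      [.cut 19, .cut 19, .cut 13, .cut 13, .cut 13]⟩,
    ⟨3, 3, 8224, 1, 242, [.cut 3, .cut 5, .cut 5], [.ptr 19 12816, .ptr 8 12816, .ptr 6 12816, .ptr
      2 12816, .ptr 0 12816]⟩,
    ⟨3, 4, 73282949152, 1, 13298, [.cut 3, .win 152 12816, .cut 12, .win 146 12546, .cut 12, .cut
      8], [.cut 14, .cut 14, .cut 11, .cut 11, .cut 11]⟩,
    ⟨3, 4, 68987981856, 0, 12607, [.cut 3, .ptr 24 12801, .ptr 48 12546, .cut 10, .ptr 0 12816, .cut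
      8], [.cut 26, .cut 26, .cut 11, .cut 11, .cut 11]⟩,
    ⟨3, 4, 4848685088, 1, 1010, [.cut 3, .win 92 12576, .win 146 8451, .win 114 12546, .win 92
      12816, .cut 10], [.cut 14, .cut 14, .cut 11, .cut 11, .cut 11]⟩,
    ⟨3, 4, 9126875168, 1, 9202, [.cut 3, .win 91 12816, .cut 12, .win 92 12816, .cut 12, .cut 10],
      [.cut 14, .cut 14, .cut 11, .cut 11, .cut 11]⟩,
    ⟨3, 4, 4831907872, 1, 62450, [.cut 3, .ptr 6 12576, .ptr 49 12546, .ptr 1 12816, .ptr 0 12816,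
      .cut 10], [.cut 14, .cut 14, .cut 11, .cut 11, .cut 11]⟩,
    ⟨3, 4, 536940576, 0, 4415, [.cut 3, .ptr 19 12801, .ptr 48 12546, .cut 10, .ptr 0 12816, .cut
      10], [.cut 26, .cut 26, .cut 11, .cut 11, .cut 11]⟩,
    ⟨3, 4, 73014513696, 2, 16129, [.cut 3, .cut 3, .cut 3, .ptr 5 12801, .ptr 5 12816, .cut 8],
      [.cut 19, .cut 19, .cut 19, .cut 19, .cut 19]⟩,
    ⟨3, 4, 4580249632, 0, 4911, [.cut 3, .ptr 13 12801, .win 146 8451, .ptr 4 12816, .win 92 12816,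
      .win 146 12546], [.cut 19, .cut 19, .cut 11, .cut 11, .cut 11]⟩,
    ⟨3, 4, 4563472416, 2, 7937, [.cut 3, .cut 3, .cut 3, .ptr 0 12816, .ptr 3 12816, .ptr 7 12816],
      [.cut 19, .cut 19, .cut 19, .cut 19, .cut 19]⟩,
    ⟨3, 4, 8590004256, 0, 9007, [.cut 3, .ptr 10 12801, .cut 12, .ptr 0 12816, .cut 12, .cut 12],
      [.cut 19, .cut 19, .cut 28, .ptr 0 16912, .cut 28]⟩,
    ⟨3, 3, 69664, 0, 3887, [.cut 3, .ptr 10 513, .ptr 52 258], [.ptr 8 12816, .ptr 4 12816, .ptr 3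
      12816, .ptr 1 12816, .ptr 0 12816]⟩,
    ⟨3, 3, 4128, 3, 0, [.cut 3, .cut 3, .cut 3, .ptr 11 528, .ptr 0 528, .ptr 47 258], []⟩,
    ⟨3, 3, 32, 3, 0, [.cut 3, .cut 3, .cut 3, .ptr 0 528, .ptr 0 513, .ptr 40 258], []⟩,
    ⟨3, 3, 69648, 3, 0, [.ptr 55 528, .ptr 2 528, .ptr 55 513, .ptr 2 288, .ptr 2 33, .ptr 55 258],
      []⟩,
    ⟨3, 3, 4112, 3, 0, [.ptr 55 528, .ptr 2 528, .ptr 47 513, .ptr 2 288, .ptr 0 528, .ptr 47 258],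
      []⟩,
    ⟨3, 3, 16, 3, 0, [.ptr 46 528, .ptr 2 528, .ptr 46 513, .ptr 0 528, .ptr 0 513, .ptr 42 258],
      []⟩,
    ⟨3, 3, 0, 3, 0, [.ptr 42 528, .ptr 0 528, .ptr 42 513, .ptr 0 288, .ptr 0 33, .ptr 42 258], []⟩,
    ⟨4, 4, 16781329, 4, 0, [.cut 1, .cut 3, .cut 3, .cut 5, .cut 7, .cut 5, .cut 9, .cut 11, .cut
      13, .cut 9], []⟩,
    ⟨4, 5, 299071726161937, 1, 139504, [.cut 1, .cut 5, .cut 5, .cut 11, .cut 13, .cut 11, .cut 19,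
      .cut 21, .win 153 17185, .cut 19], [.cut 33, .cut 33, .cut 37, .cut 37, .cut 37, .cut 23, .cut
      23, .cut 23, .cut 23]⟩,
    ⟨4, 4, 4563406865, 3, 61440, [.cut 1, .cut 3, .cut 3, .cut 5, .cut 7, .cut 5], [.cut 17, .cut
      17, .cut 19, .cut 19, .cut 19, .cut 21, .cut 21, .ptr 0 274960, .cut 21]⟩,
    ⟨4, 4, 268439569, 4, 0, [.cut 1, .cut 3, .cut 3, .cut 5, .cut 7, .cut 5, .cut 11, .cut 11, .ptr
      0 12816, .cut 11], []⟩,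
    ⟨4, 4, 68719480849, 4, 0, [.cut 1, .cut 3, .cut 3, .cut 5, .cut 7, .cut 5, .cut 9, .cut 11, .cut
      13, .cut 8], []⟩,
    ⟨4, 4, 4113, 4, 0, [.cut 1, .cut 3, .cut 3, .cut 5, .cut 7, .cut 5, .ptr 4 12816, .ptr 1 12816,
      .ptr 1 12576, .ptr 0 12816], []⟩,
    ⟨4, 5, 76561198228766737, 1, 279536, [.cut 1, .cut 7, .cut 7, .cut 11, .cut 14, .cut 11, .cut
      17, .cut 28, .cut 24, .cut 16], [.cut 30, .cut 30, .cut 27, .cut 27, .cut 27, .cut 56, .cut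
      30, .cut 27, .cut 56]⟩,
    ⟨4, 5, 4504703702466577, 0, 201519, [.cut 3, .cut 7, .cut 7, .cut 11, .cut 14, .cut 11, .cut 19,
      .win 153 12865, .cut 25, .cut 17], [.cut 35, .cut 35, .cut 27, .cut 27, .cut 27, .cut 46, .cut
      46, .cut 27, .cut 46]⟩,
    ⟨4, 5, 4802671353593873, 1, 148464, [.cut 1, .cut 7, .cut 7, .cut 11, .cut 14, .cut 11, .cut 19,
      .cut 22, .cut 26, .cut 19], [.cut 30, .cut 30, .cut 27, .cut 27, .cut 27, .cut 23, .cut 23,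
      .cut 23, .cut 23]⟩,
    ⟨4, 5, 4521196376883217, 3, 127232, [.cut 1, .cut 3, .cut 3, .cut 7, .cut 7, .cut 7, .cut 19,
      .cut 19, .ptr 0 274960, .cut 19], [.cut 30, .cut 30, .cut 35, .cut 30, .cut 35, .cut 27, .cut
      27, .cut 27, .cut 27]⟩,
    ⟨4, 5, 9007203818209297, 1, 214000, [.cut 1, .cut 7, .cut 7, .cut 11, .cut 14, .cut 11, .cut 25,
      .cut 28, .cut 24, .cut 24], [.cut 30, .cut 30, .cut 27, .cut 27, .cut 27, .cut 56, .cut 30,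
      .cut 27, .cut 56]⟩,
    ⟨4, 4, 4563468305, 2, 7936, [.cut 1, .cut 3, .cut 3, .cut 11, .cut 11, .cut 11], [.cut 17, .cut
      17, .cut 19, .cut 19, .cut 19, .ptr 4 274960, .ptr 3 274960, .ptr 1 274960, .ptr 0 274960]⟩,
    ⟨4, 4, 268501009, 4, 0, [.cut 1, .cut 3, .cut 3, .cut 7, .cut 7, .cut 7, .cut 11, .cut 11, .ptr
      0 12816, .cut 11], []⟩,
    ⟨4, 5, 299075752755217, 1, 140272, [.cut 1, .cut 7, .cut 7, .cut 13, .cut 12, .cut 12, .cut 19,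
      .cut 22, .cut 28, .cut 19], [.cut 30, .cut 30, .cut 44, .cut 30, .cut 44, .cut 23, .cut 23,
      .cut 23, .cut 23]⟩,
    ⟨4, 5, 4521200403415057, 1, 205808, [.cut 1, .cut 7, .cut 7, .cut 13, .cut 12, .cut 12, .cut 19,
      .cut 28, .cut 28, .cut 19], [.cut 30, .cut 30, .cut 39, .cut 30, .cut 39, .cut 44, .cut 30,
      .cut 44, .cut 44]⟩,
    ⟨4, 4, 8590000145, 0, 9007, [.cut 3, .cut 7, .cut 7, .cut 14, .cut 12, .cut 12], [.cut 19, .cut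
      19, .cut 28, .ptr 1 274960, .cut 28, .cut 28, .ptr 0 274960, .cut 28, .cut 28]⟩,
    ⟨4, 5, 282647502848017, 0, 144175, [.cut 3, .cut 7, .cut 7, .cut 11, .cut 12, .cut 8, .cut 19,
      .cut 21, .cut 25, .cut 17], [.cut 29, .cut 29, .cut 44, .cut 29, .cut 44, .cut 23, .cut 23,
      .cut 23, .cut 23]⟩,
    ⟨4, 4, 73014509585, 1, 13296, [.cut 1, .cut 7, .cut 7, .cut 9, .cut 12, .cut 8], [.cut 17, .cut
      17, .cut 28, .ptr 0 274960, .cut 28, .cut 24, .cut 25, .cut 28, .cut 24]⟩,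
    ⟨4, 4, 4295032849, 4, 0, [.cut 1, .cut 3, .cut 3, .cut 7, .cut 7, .cut 7, .ptr 15 8976, .ptr 6
      12816, .ptr 2 12816, .ptr 0 12816], []⟩,
    ⟨4, 4, 68719542289, 4, 0, [.cut 1, .cut 3, .cut 3, .cut 7, .cut 7, .cut 7, .cut 9, .cut 11, .ptr
      1 12816, .cut 8], []⟩,
    ⟨4, 4, 65553, 4, 0, [.cut 1, .cut 3, .cut 3, .cut 7, .cut 7, .cut 7, .ptr 16 8976, .ptr 7 12816,
      .ptr 1 12816, .ptr 0 12816], []⟩,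
    ⟨4, 4, 4296015889, 4, 0, [.cut 1, .cut 3, .cut 3, .cut 5, .cut 7, .cut 4, .cut 13, .ptr 3 8976,
      .cut 12, .cut 12], []⟩,
    ⟨4, 4, 68720525329, 4, 0, [.cut 1, .cut 3, .cut 3, .cut 5, .cut 7, .cut 4, .cut 9, .cut 11, .cut
      12, .cut 8], []⟩,
    ⟨4, 4, 1048593, 4, 0, [.cut 1, .cut 3, .cut 3, .cut 5, .cut 7, .cut 4, .ptr 18 8976, .ptr 3
      8976, .ptr 1 12816, .ptr 0 12816], []⟩,
    ⟨4, 4, 8589934609, 4, 0, [.cut 1, .cut 3, .cut 3, .cut 13, .ptr 8 12816, .cut 12, .cut 13, .ptr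
      8 8976, .cut 12, .cut 12], []⟩,
    ⟨4, 4, 4294967313, 4, 0, [.cut 1, .cut 3, .cut 3, .ptr 21 12576, .ptr 6 12816, .ptr 3 12816,
      .ptr 21 8496, .ptr 6 8976, .ptr 0 12816, .ptr 3 8976], []⟩,
    ⟨4, 4, 17, 4, 0, [.cut 1, .cut 3, .cut 3, .ptr 20 12816, .ptr 5 12816, .ptr 2 12816, .ptr 20
      8976, .ptr 5 8976, .ptr 0 12816, .ptr 2 8976], []⟩,
    ⟨4, 4, 68720525569, 4, 0, [.cut 1, .cut 3, .cut 2, .cut 5, .cut 6, .cut 4, .cut 9, .cut 10, .cut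
      12, .cut 8], []⟩,
    ⟨4, 4, 1048833, 4, 0, [.cut 1, .cut 3, .cut 2, .cut 5, .cut 6, .cut 4, .ptr 5 8496, .ptr 5 8241,
      .ptr 5 4146, .ptr 0 12816], []⟩,
    ⟨4, 4, 8589934849, 4, 0, [.cut 1, .cut 3, .cut 2, .cut 13, .cut 14, .cut 12, .cut 13, .cut 14,
      .cut 12, .cut 12], []⟩,
    ⟨4, 4, 4294967553, 4, 0, [.cut 1, .cut 3, .cut 2, .ptr 10 4896, .ptr 10 801, .ptr 7 4146, .ptr
      10 4656, .ptr 10 561, .ptr 0 12816, .ptr 7 4131], []⟩,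
    ⟨4, 4, 257, 4, 0, [.cut 1, .cut 3, .cut 2, .ptr 7 12576, .ptr 7 12321, .ptr 2 12816, .ptr 7
      8496, .ptr 7 8241, .ptr 0 12816, .ptr 2 8976], []⟩,
    ⟨4, 4, 268566529, 4, 0, [.cut 1, .cut 7, .cut 6, .cut 7, .cut 6, .cut 6, .ptr 16 8496, .cut 14,
      .cut 14, .cut 14], []⟩,
    ⟨4, 4, 131073, 4, 0, [.cut 1, .cut 7, .cut 6, .cut 7, .cut 6, .cut 6, .ptr 8 8496, .ptr 0 12816,
      .ptr 0 12576, .ptr 3 8496], []⟩,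
    ⟨4, 4, 4563468289, 4, 0, [.cut 1, .ptr 22 12816, .cut 14, .ptr 22 12576, .cut 14, .cut 14, .ptr
      22 8496, .cut 14, .cut 14, .cut 14], []⟩,
    ⟨4, 4, 268500993, 4, 0, [.cut 1, .ptr 22 12816, .ptr 30 801, .ptr 16 12576, .ptr 2 12816, .ptr
      15 786, .ptr 16 8496, .ptr 2 8976, .ptr 0 12816, .ptr 15 531], []⟩,
    ⟨4, 4, 65537, 4, 0, [.cut 1, .ptr 15 12816, .ptr 12 12321, .ptr 15 12576, .ptr 2 12816, .ptr 12
      12306, .ptr 10 8496, .ptr 0 12816, .ptr 0 12576, .ptr 5 8496], []⟩,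
    ⟨4, 4, 1, 4, 0, [.cut 1, .ptr 10 12816, .ptr 5 12816, .ptr 10 12576, .ptr 0 12816, .ptr 5 12576,
      .ptr 10 8496, .ptr 0 8976, .ptr 0 4896, .ptr 5 8496], []⟩,
    ⟨4, 5, 76561197977047072, 0, 279551, [.cut 3, .cut 7, .cut 7, .cut 11, .cut 13, .cut 11, .cut
      19, .cut 28, .cut 24, .cut 16], [.cut 29, .cut 29, .cut 27, .cut 27, .cut 27, .cut 56, .cut
      29, .cut 27, .cut 56]⟩,
    ⟨4, 5, 4786178427457568, 0, 148479, [.cut 3, .cut 7, .cut 7, .cut 11, .cut 13, .cut 11, .cut 19,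
      .cut 21, .cut 25, .cut 19], [.cut 29, .cut 29, .cut 27, .cut 27, .cut 27, .cut 23, .cut 23,
      .cut 23, .cut 23]⟩,
    ⟨4, 5, 4504703450746912, 3, 61441, [.cut 3, .cut 3, .cut 3, .cut 7, .cut 7, .cut 7, .cut 19,
      .cut 19, .ptr 0 274960, .cut 19], [.cut 35, .cut 35, .cut 29, .cut 29, .cut 29, .cut 27, .cut
      27, .cut 27, .cut 27]⟩,
    ⟨4, 5, 4802671101874208, 0, 148303, [.cut 3, .cut 7, .cut 7, .cut 11, .cut 13, .cut 11, .cut 19,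
      .cut 28, .cut 28, .cut 19], [.cut 29, .cut 29, .cut 27, .cut 27, .cut 27, .cut 23, .cut 23,
      .cut 23, .cut 23]⟩,
    ⟨4, 5, 4521196125163552, 3, 126977, [.cut 3, .cut 3, .cut 3, .cut 7, .cut 7, .cut 7, .cut 19,
      .cut 19, .ptr 0 274960, .cut 19], [.cut 35, .cut 35, .cut 35, .cut 35, .cut 35, .cut 27, .cut
      27, .cut 27, .cut 27]⟩,
    ⟨4, 5, 9007203566489632, 0, 214015, [.cut 3, .cut 7, .cut 7, .cut 11, .cut 13, .cut 11, .ptr 0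
      274960, .cut 28, .cut 24, .cut 24], [.cut 29, .cut 29, .cut 27, .cut 27, .cut 27, .cut 56,
      .cut 29, .cut 27, .cut 56]⟩,
    ⟨4, 4, 4311748640, 2, 3841, [.cut 3, .cut 3, .cut 3, .cut 11, .cut 11, .cut 11], [.cut 19, .cut
      19, .cut 19, .cut 19, .cut 19, .ptr 5 274960, .ptr 3 274960, .ptr 1 274960, .ptr 0 274960]⟩,
    ⟨4, 4, 16781344, 4, 0, [.cut 3, .cut 3, .cut 3, .cut 7, .cut 7, .cut 7, .cut 11, .cut 11, .ptr 0
      12816, .cut 11], []⟩,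
    ⟨4, 5, 76561198228705312, 0, 279359, [.cut 3, .cut 7, .cut 7, .cut 11, .cut 28, .cut 11, .cut
      19, .cut 28, .cut 24, .cut 16], [.cut 35, .cut 35, .cut 27, .cut 27, .cut 27, .cut 56, .cut
      58, .cut 27, .cut 56]⟩,
    ⟨4, 5, 4786178679115808, 0, 148287, [.cut 3, .cut 7, .cut 7, .cut 11, .cut 28, .cut 11, .cut 19,
      .cut 21, .cut 28, .cut 19], [.cut 29, .cut 29, .cut 27, .cut 27, .cut 27, .cut 23, .cut 23,
      .cut 23, .cut 23]⟩,
    ⟨4, 5, 4504703702405152, 3, 61441, [.cut 3, .cut 3, .cut 3, .cut 7, .cut 7, .cut 7, .cut 19,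
      .cut 19, .ptr 0 274960, .cut 19], [.cut 35, .cut 35, .cut 35, .cut 35, .cut 35, .cut 27, .cut
      27, .cut 27, .cut 27]⟩,
    ⟨4, 5, 4521196376821792, 3, 126977, [.cut 3, .cut 3, .cut 3, .cut 7, .cut 7, .cut 7, .cut 19,
      .cut 19, .ptr 1 271105, .cut 19], [.cut 35, .cut 35, .cut 35, .cut 35, .cut 35, .cut 27, .cut
      27, .cut 27, .cut 27]⟩,
    ⟨4, 5, 9007203818147872, 0, 213823, [.cut 3, .cut 7, .cut 7, .cut 11, .cut 28, .cut 11, .cut 26,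
      .cut 28, .cut 24, .cut 24], [.cut 35, .cut 35, .cut 27, .cut 27, .cut 27, .cut 56, .cut 58,
      .cut 27, .cut 56]⟩,
    ⟨4, 4, 4563406880, 2, 7937, [.cut 3, .cut 3, .cut 3, .cut 11, .cut 11, .cut 11], [.cut 19, .cut
      19, .cut 19, .cut 19, .cut 19, .ptr 4 274960, .ptr 2 274960, .ptr 1 274960, .ptr 0 274960]⟩,
    ⟨4, 4, 268439584, 4, 0, [.cut 3, .cut 3, .cut 3, .cut 7, .cut 7, .cut 7, .cut 11, .cut 11, .ptr
      0 12816, .cut 11], []⟩,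
    ⟨4, 5, 299075752693792, 1, 140274, [.cut 3, .cut 7, .cut 7, .cut 13, .cut 12, .cut 12, .cut 19,
      .cut 28, .cut 28, .cut 19], [.cut 35, .cut 35, .cut 44, .cut 45, .cut 44, .cut 23, .cut 23,
      .cut 23, .cut 23]⟩,
    ⟨4, 5, 4521200403353632, 1, 205810, [.cut 3, .cut 7, .cut 7, .cut 13, .cut 12, .cut 12, .cut 19,
      .cut 28, .cut 28, .cut 19], [.cut 35, .cut 35, .cut 39, .cut 39, .cut 39, .cut 44, .cut 45,
      .cut 44, .cut 44]⟩,
    ⟨4, 4, 8589938720, 0, 9215, [.cut 3, .cut 7, .cut 7, .ptr 3 12816, .cut 12, .cut 12], [.cut 19,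
      .cut 19, .cut 28, .ptr 1 274960, .cut 28, .cut 28, .ptr 0 274960, .cut 28, .cut 28]⟩,
    ⟨4, 4, 4294971424, 4, 0, [.cut 3, .cut 3, .cut 3, .cut 7, .cut 7, .cut 7, .ptr 11 12816, .ptr 4
      12816, .ptr 0 12816, .ptr 40 4131], []⟩,
    ⟨4, 4, 4128, 4, 0, [.cut 3, .cut 3, .cut 3, .cut 7, .cut 7, .cut 7, .ptr 11 12816, .ptr 4 12816,
      .ptr 0 12816, .ptr 24 8451], []⟩,
    ⟨4, 4, 8589934624, 4, 0, [.cut 3, .cut 3, .cut 3, .ptr 2 12816, .ptr 2 12801, .cut 12, .ptr 2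
      8976, .ptr 2 8961, .cut 12, .cut 12], []⟩,
    ⟨4, 4, 4294967328, 4, 0, [.cut 3, .cut 3, .cut 3, .ptr 2 12816, .ptr 2 12801, .ptr 34 4146, .ptr
      2 8976, .ptr 2 8961, .ptr 0 12816, .ptr 34 4131], []⟩,
    ⟨4, 4, 32, 4, 0, [.cut 3, .cut 3, .cut 3, .ptr 2 12816, .ptr 2 12801, .ptr 26 12546, .ptr 2
      8976, .ptr 2 8961, .ptr 0 12816, .ptr 26 8451], []⟩,
    ⟨4, 5, 72058698129805328, 0, 267055, [.cut 7, .cut 7, .cut 7, .cut 11, .cut 13, .cut 11, .cut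
      19, .cut 21, .cut 25, .cut 16], [.cut 29, .cut 29, .cut 27, .cut 27, .cut 27, .cut 23, .cut
      23, .cut 23, .cut 23]⟩,
    ⟨4, 5, 72058693834838032, 1, 262388, [.cut 7, .cut 7, .cut 7, .cut 11, .ptr 0 274960, .cut 11,
      .cut 17, .cut 21, .cut 25, .cut 16], [.cut 49, .cut 49, .cut 27, .cut 27, .cut 27, .cut 23,
      .cut 23, .cut 23, .cut 23]⟩,
    ⟨4, 5, 2203603505168, 0, 987951, [.cut 7, .cut 7, .cut 7, .cut 11, .cut 13, .cut 11, .cut 19,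
      .cut 21, .cut 25, .cut 17], [.cut 29, .cut 29, .cut 27, .cut 27, .cut 27, .cut 23, .cut 23,
      .cut 23, .cut 23]⟩,
    ⟨4, 5, 2199308537872, 1, 244, [.cut 7, .cut 7, .cut 7, .cut 11, .ptr 0 274960, .cut 11, .cut 17,
      .cut 21, .cut 25, .cut 17], [.cut 49, .cut 49, .cut 27, .cut 27, .cut 27, .cut 23, .cut 23,
      .cut 23, .cut 23]⟩,
    ⟨4, 5, 18696277921808, 0, 70447, [.cut 7, .cut 7, .cut 7, .cut 11, .cut 13, .cut 11, .cut 19,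
      .win 32 274960, .win 32 271120, .cut 19], [.cut 46, .cut 46, .cut 27, .cut 27, .cut 27, .cut
      23, .cut 23, .cut 23, .cut 23]⟩,
    ⟨4, 5, 300166959665168, 0, 70703, [.cut 7, .cut 7, .cut 7, .cut 11, .win 32 274960, .cut 11,
      .cut 19, .cut 21, .win 32 148240, .cut 19], [.cut 43, .cut 43, .cut 27, .cut 27, .cut 27, .cut
      23, .cut 23, .cut 23, .cut 23]⟩,
    ⟨4, 5, 18691982954512, 0, 73519, [.cut 7, .cut 7, .cut 7, .cut 11, .ptr 1 274960, .cut 11, .cut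
      19, .ptr 0 274960, .ptr 0 271120, .cut 19], [.ptr 4 340481, .ptr 2 340481, .cut 27, .cut 27,
      .cut 27, .cut 23, .cut 23, .cut 23, .cut 23]⟩,
    ⟨4, 5, 76561193950580752, 0, 278847, [.cut 7, .cut 7, .cut 7, .cut 11, .ptr 6 270595, .cut 11,
      .cut 26, .win 153 266290, .cut 24, .cut 16], [.cut 39, .cut 39, .cut 27, .cut 27, .cut 27,
      .cut 56, .cut 58, .cut 27, .cut 56]⟩,
    ⟨4, 5, 4786174400991248, 0, 201775, [.cut 7, .cut 7, .cut 7, .cut 11, .win 32 270640, .cut 11,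
      .win 32 148240, .cut 21, .cut 25, .cut 21], [.cut 29, .cut 29, .cut 27, .cut 27, .cut 27, .cut
      23, .cut 23, .cut 23, .cut 23]⟩,
    ⟨4, 5, 4504699424280592, 1, 16627, [.cut 7, .cut 7, .cut 7, .cut 11, .ptr 4 270640, .cut 11,
      .cut 25, .ptr 0 274960, .cut 25, .cut 25], [.cut 39, .cut 39, .cut 27, .cut 27, .cut 27, .cut
      57, .cut 57, .cut 27, .cut 57]⟩,
    ⟨4, 5, 9288674516733968, 3, 192770, [.cut 7, .cut 7, .cut 7, .cut 7, .cut 7, .cut 7, .cut 25,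
      .cut 26, .cut 28, .cut 24], [.cut 30, .cut 30, .cut 29, .cut 29, .cut 29, .cut 27, .cut 27,
      .cut 27, .cut 27]⟩,
    ⟨4, 5, 9007199540023312, 0, 213311, [.cut 7, .cut 7, .cut 7, .cut 11, .ptr 8 270595, .cut 11,
      .cut 26, .ptr 0 274960, .cut 24, .cut 24], [.cut 39, .cut 39, .cut 27, .cut 27, .cut 27, .cut
      56, .cut 58, .cut 27, .cut 56]⟩,
    ⟨4, 4, 285282320, 2, 7939, [.cut 7, .cut 7, .cut 7, .cut 11, .cut 11, .cut 11], [.ptr 10 274960,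
      .ptr 8 274960, .ptr 10 274945, .ptr 5 274960, .ptr 8 274945, .ptr 4 274960, .ptr 2 274960,
      .ptr 2 274945, .ptr 0 274960]⟩,
    ⟨4, 4, 16846864, 4, 0, [.cut 7, .cut 7, .cut 7, .cut 7, .cut 7, .cut 7, .ptr 29 8496, .ptr 0
      12816, .ptr 0 12576, .ptr 62 8451], []⟩,
    ⟨4, 4, 69648, 4, 0, [.cut 7, .cut 7, .cut 7, .cut 7, .cut 7, .cut 7, .ptr 0 12816, .ptr 0 12801,
      .ptr 0 12546, .ptr 40 8451], []⟩,
    ⟨4, 4, 16781328, 4, 0, [.ptr 75 12816, .ptr 30 12816, .ptr 63 12801, .ptr 30 12576, .ptr 1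
      12816, .ptr 63 12546, .ptr 30 8496, .ptr 1 8976, .ptr 1 4896, .ptr 63 8451], []⟩,
    ⟨4, 4, 4563406864, 4, 0, [.ptr 74 12816, .ptr 25 12816, .ptr 74 8961, .ptr 25 12576, .ptr 3
      12321, .ptr 74 4866, .ptr 3 8496, .ptr 25 8241, .ptr 25 4146, .ptr 74 531], []⟩,
    ⟨4, 4, 268439568, 4, 0, [.ptr 74 12816, .ptr 25 12816, .ptr 74 8961, .ptr 21 12576, .ptr 3
      12801, .ptr 59 12546, .ptr 3 8976, .ptr 21 8241, .ptr 0 12816, .ptr 59 8211], []⟩,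
    ⟨4, 4, 4112, 4, 0, [.ptr 73 12816, .ptr 21 12816, .ptr 58 12801, .ptr 21 12576, .ptr 3 12816,
      .ptr 58 12546, .ptr 2 12816, .ptr 0 12816, .ptr 0 12576, .ptr 43 8451], []⟩,
    ⟨4, 4, 4294967312, 4, 0, [.ptr 54 12816, .ptr 20 12816, .ptr 54 12801, .ptr 1 12576, .ptr 1
      12321, .ptr 54 4146, .ptr 1 8496, .ptr 1 8241, .ptr 20 4146, .ptr 54 4131], []⟩,
    ⟨4, 4, 16, 4, 0, [.ptr 54 12816, .ptr 20 12816, .ptr 54 12801, .ptr 1 12816, .ptr 1 12801, .ptr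
      44 12546, .ptr 1 8976, .ptr 1 8961, .ptr 0 12816, .ptr 44 8451], []⟩,
    ⟨4, 4, 0, 4, 0, [.ptr 44 12816, .ptr 0 12816, .ptr 44 12801, .ptr 0 12576, .ptr 0 12321, .ptr 44
      12546, .ptr 0 8496, .ptr 0 8241, .ptr 0 4146, .ptr 44 8451], []⟩,
    ⟨5, 5, 1099528409105, 5, 0, [.cut 1, .cut 3, .cut 3, .cut 5, .cut 7, .cut 5, .cut 9, .cut 11,
      .cut 13, .cut 9, .cut 17, .cut 19, .cut 21, .cut 25, .cut 17], []⟩,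
    ⟨5, 5, 17592202825745, 5, 0, [.cut 1, .cut 3, .cut 3, .cut 5, .cut 7, .cut 5, .cut 9, .cut 11,
      .cut 13, .cut 9, .cut 19, .cut 19, .cut 23, .cut 27, .cut 19], []⟩,
    ⟨5, 5, 72057594054709265, 5, 0, [.cut 1, .cut 3, .cut 3, .cut 5, .cut 7, .cut 5, .cut 9, .cut
      11, .cut 13, .cut 9, .cut 17, .cut 19, .cut 21, .cut 25, .cut 16], []⟩,
    ⟨5, 5, 16781329, 5, 0, [.cut 1, .cut 3, .cut 3, .cut 5, .cut 7, .cut 5, .cut 9, .cut 11, .cut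
      13, .cut 9, .ptr 2 274960, .ptr 1 274960, .ptr 1 274720, .ptr 1 270640, .ptr 0 274960], []⟩,
    ⟨5, 5, 17592454483985, 5, 0, [.cut 1, .cut 3, .cut 3, .cut 5, .cut 7, .cut 5, .cut 11, .cut 11,
      .cut 15, .cut 11, .cut 19, .cut 19, .cut 23, .cut 27, .cut 19], []⟩,
    ⟨5, 6, 75576315255062905491473, 0, 4396127, [.cut 3, .cut 7, .cut 5, .cut 11, .cut 15, .cut 11,
      .cut 23, .cut 21, .cut 27, .cut 21, .cut 35, .cut 39, .cut 43, .cut 51, .cut 35], [.cut 67,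
      .cut 67, .cut 59, .cut 59, .cut 59, .cut 55, .cut 55, .cut 55, .cut 55, .cut 85, .cut 122,
      .cut 59, .cut 55, .cut 85]⟩,
    ⟨5, 5, 4785074872520721, 3, 192512, [.cut 1, .cut 3, .cut 3, .cut 5, .cut 7, .cut 5, .cut 21,
      .cut 23, .cut 21, .cut 21], [.cut 33, .cut 33, .cut 35, .cut 35, .cut 35, .cut 37, .cut 37,
      .cut 39, .cut 37, .cut 53, .cut 53, .ptr 0 5517840, .cut 53, .cut 53]⟩,
    ⟨5, 5, 281475245150225, 5, 0, [.cut 1, .cut 3, .cut 3, .cut 5, .cut 7, .cut 5, .cut 11, .cut 11,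
      .cut 15, .cut 11, .cut 21, .cut 23, .cut 21, .ptr 0 274960, .cut 21], []⟩,
    ⟨5, 5, 4503599895810065, 5, 0, [.cut 1, .cut 3, .cut 3, .cut 5, .cut 7, .cut 5, .cut 11, .cut
      11, .cut 15, .cut 11, .cut 27, .cut 27, .ptr 1 274960, .cut 27, .cut 27], []⟩,
    ⟨5, 5, 72057594306367505, 5, 0, [.cut 1, .cut 3, .cut 3, .cut 5, .cut 7, .cut 5, .cut 11, .cut
      11, .cut 15, .cut 11, .cut 17, .cut 19, .cut 21, .cut 27, .cut 16], []⟩,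
    ⟨5, 5, 268439569, 5, 0, [.cut 1, .cut 3, .cut 3, .cut 5, .cut 7, .cut 5, .cut 11, .cut 11, .cut
      15, .cut 11, .ptr 8 213520, .ptr 5 274960, .ptr 2 274960, .ptr 1 274960, .ptr 0 274960], []⟩,
    ⟨5, 5, 4503668346851345, 5, 0, [.cut 1, .cut 3, .cut 3, .cut 5, .cut 7, .cut 5, .cut 9, .cut 11,
      .cut 13, .cut 8, .cut 25, .cut 27, .cut 29, .cut 24, .cut 24], []⟩,
    ⟨5, 5, 72057662757408785, 5, 0, [.cut 1, .cut 3, .cut 3, .cut 5, .cut 7, .cut 5, .cut 9, .cut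
      11, .cut 13, .cut 8, .cut 17, .cut 19, .cut 21, .cut 24, .cut 16], []⟩,
    ⟨5, 5, 68719480849, 5, 0, [.cut 1, .cut 3, .cut 3, .cut 5, .cut 7, .cut 5, .cut 9, .cut 11, .cut
      13, .cut 8, .ptr 10 213520, .ptr 3 213520, .ptr 3 213280, .ptr 1 274960, .ptr 0 274960], []⟩,
    ⟨5, 5, 9007199254745105, 5, 0, [.cut 1, .cut 3, .cut 3, .cut 5, .cut 7, .cut 5, .cut 25, .cut
      27, .cut 29, .cut 24, .cut 25, .cut 27, .cut 29, .cut 24, .cut 24], []⟩,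
    ⟨5, 5, 4503599627374609, 5, 0, [.cut 1, .cut 3, .cut 3, .cut 5, .cut 7, .cut 5, .ptr 13 270640,
      .ptr 6 274960, .ptr 6 274720, .ptr 3 274960, .ptr 13 205120, .ptr 6 213520, .ptr 6 213280,
      .ptr 0 274960, .ptr 3 213520], []⟩,
    ⟨5, 5, 4113, 5, 0, [.cut 1, .cut 3, .cut 3, .cut 5, .cut 7, .cut 5, .ptr 12 274960, .ptr 5
      274960, .ptr 5 274720, .ptr 2 274960, .ptr 12 213520, .ptr 5 213520, .ptr 5 213280, .ptr 0
      274960, .ptr 2 213520], []⟩,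
    ⟨5, 5, 17592454545425, 5, 0, [.cut 1, .cut 3, .cut 3, .cut 7, .cut 7, .cut 7, .cut 11, .cut 11,
      .cut 15, .cut 11, .cut 19, .cut 19, .cut 23, .cut 27, .cut 19], []⟩,
    ⟨5, 6, 5017519173123870621713, 1, 2315504, [.cut 1, .cut 7, .cut 7, .cut 11, .cut 15, .cut 11,
      .cut 23, .cut 23, .cut 27, .cut 23, .cut 39, .cut 39, .cut 43, .cut 60, .cut 39], [.cut 62,
      .cut 62, .cut 71, .cut 62, .cut 71, .cut 75, .cut 62, .cut 124, .cut 75, .cut 47, .cut 47,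
      .cut 47, .cut 47, .cut 47]⟩,
    ⟨5, 5, 4785074872582161, 4, 987392, [.cut 1, .cut 3, .cut 3, .cut 7, .cut 7, .cut 7, .cut 11,
      .cut 11, .cut 15, .cut 11], [.cut 33, .cut 33, .cut 35, .cut 35, .cut 35, .cut 39, .cut 39,
      .cut 39, .cut 39, .cut 43, .cut 43, .cut 43, .ptr 0 5517840, .cut 43]⟩,
    ⟨5, 5, 281475245211665, 5, 0, [.cut 1, .cut 3, .cut 3, .cut 7, .cut 7, .cut 7, .cut 11, .cut 11,
      .cut 15, .cut 11, .cut 23, .cut 23, .cut 23, .ptr 0 274960, .cut 23], []⟩,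
    ⟨5, 5, 72057594306428945, 5, 0, [.cut 1, .cut 3, .cut 3, .cut 7, .cut 7, .cut 7, .cut 11, .cut
      11, .cut 15, .cut 11, .cut 17, .cut 19, .cut 23, .cut 27, .cut 16], []⟩,
    ⟨5, 5, 268501009, 5, 0, [.cut 1, .cut 3, .cut 3, .cut 7, .cut 7, .cut 7, .cut 11, .cut 11, .cut
      15, .cut 11, .ptr 17 205840, .ptr 4 274960, .ptr 1 274960, .ptr 1 271120, .ptr 0 274960], []⟩,
    ⟨5, 6, 4740818012022253879313, 1, 3294192, [.cut 1, .cut 7, .cut 7, .cut 15, .cut 15, .cut 15,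
      .cut 23, .cut 23, .cut 28, .cut 23, .cut 35, .cut 39, .cut 43, .cut 60, .cut 35], [.cut 62,
      .cut 62, .cut 71, .cut 62, .cut 71, .cut 92, .cut 62, .cut 92, .cut 92, .cut 47, .cut 47, .cut
      47, .cut 47, .cut 47]⟩,
    ⟨5, 5, 4785078899114001, 0, 148271, [.cut 3, .cut 7, .cut 7, .cut 15, .cut 15, .cut 15, .cut 23,
      .cut 23, .cut 28, .cut 23], [.cut 35, .cut 35, .cut 39, .cut 39, .cut 39, .cut 60, .ptr 0
      5517840, .cut 60, .cut 60, .cut 60, .ptr 0 5456400, .cut 60, .cut 60, .cut 60]⟩,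
    ⟨5, 5, 281479271743505, 5, 0, [.cut 1, .cut 3, .cut 3, .cut 7, .cut 7, .cut 7, .cut 15, .cut 15,
      .cut 15, .cut 15, .cut 23, .cut 23, .cut 23, .ptr 0 274960, .cut 23], []⟩,
    ⟨5, 5, 9007203549773841, 1, 214000, [.cut 1, .cut 7, .cut 7, .cut 15, .cut 15, .cut 15, .cut 25,
      .cut 28, .cut 24, .cut 24], [.cut 33, .cut 33, .cut 39, .cut 39, .cut 39, .cut 56, .cut 57,
      .cut 60, .cut 56, .cut 56, .cut 57, .cut 60, .cut 56, .cut 56]⟩,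
    ⟨5, 5, 76561197960331281, 1, 279536, [.cut 1, .cut 7, .cut 7, .cut 15, .cut 15, .cut 15, .cut
      17, .cut 23, .cut 24, .cut 16], [.cut 33, .cut 33, .cut 39, .cut 39, .cut 39, .cut 56, .cut
      57, .cut 60, .cut 56, .cut 48, .cut 49, .cut 60, .cut 56, .cut 48]⟩,
    ⟨5, 5, 4503603922403345, 5, 0, [.cut 1, .cut 3, .cut 3, .cut 7, .cut 7, .cut 7, .cut 15, .cut
      15, .cut 15, .cut 15, .ptr 21 205840, .ptr 8 213520, .ptr 3 274960, .ptr 1 274960, .ptr 0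
      274960], []⟩,
    ⟨5, 5, 72057598332960785, 5, 0, [.cut 1, .cut 3, .cut 3, .cut 7, .cut 7, .cut 7, .cut 15, .cut
      15, .cut 15, .cut 15, .cut 17, .cut 19, .cut 23, .ptr 1 274960, .cut 16], []⟩,
    ⟨5, 5, 4295032849, 5, 0, [.cut 1, .cut 3, .cut 3, .cut 7, .cut 7, .cut 7, .cut 15, .cut 15, .cut
      15, .cut 15, .ptr 21 205840, .ptr 9 213520, .ptr 4 274960, .ptr 1 274960, .ptr 0 274960], []⟩,
    ⟨5, 5, 4503668346912785, 5, 0, [.cut 1, .cut 3, .cut 3, .cut 7, .cut 7, .cut 7, .cut 9, .cut 11,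
      .cut 15, .cut 8, .cut 25, .cut 27, .ptr 3 213520, .cut 24, .cut 24], []⟩,
    ⟨5, 5, 72057662757470225, 5, 0, [.cut 1, .cut 3, .cut 3, .cut 7, .cut 7, .cut 7, .cut 9, .cut
      11, .cut 15, .cut 8, .cut 17, .cut 19, .cut 23, .cut 24, .cut 16], []⟩,
    ⟨5, 5, 68719542289, 5, 0, [.cut 1, .cut 3, .cut 3, .cut 7, .cut 7, .cut 7, .cut 9, .cut 11, .cut
      15, .cut 8, .ptr 23 205840, .ptr 11 213520, .ptr 3 213520, .ptr 1 274960, .ptr 0 274960], []⟩,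
    ⟨5, 5, 9007199254806545, 5, 0, [.cut 1, .cut 3, .cut 3, .cut 7, .cut 7, .cut 7, .cut 25, .cut
      27, .ptr 7 274960, .cut 24, .cut 25, .cut 27, .ptr 7 213520, .cut 24, .cut 24], []⟩,
    ⟨5, 5, 4503599627436049, 5, 0, [.cut 1, .cut 3, .cut 3, .cut 7, .cut 7, .cut 7, .ptr 27 271120,
      .ptr 14 271120, .ptr 6 274960, .ptr 3 274960, .ptr 27 205840, .ptr 14 205840, .ptr 6 213520,
      .ptr 0 274960, .ptr 3 213520], []⟩,
    ⟨5, 5, 65553, 5, 0, [.cut 1, .cut 3, .cut 3, .cut 7, .cut 7, .cut 7, .ptr 25 271120, .ptr 13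
      274960, .ptr 5 274960, .ptr 2 274960, .ptr 25 205840, .ptr 13 213520, .ptr 5 213520, .ptr 0
      274960, .ptr 2 213520], []⟩,
    ⟨5, 5, 72057598333943825, 5, 0, [.cut 1, .cut 3, .cut 3, .cut 5, .cut 7, .cut 4, .cut 13, .cut
      15, .cut 12, .cut 12, .cut 17, .cut 19, .cut 20, .cut 28, .cut 16], []⟩,
    ⟨5, 5, 4296015889, 5, 0, [.cut 1, .cut 3, .cut 3, .cut 5, .cut 7, .cut 4, .cut 13, .cut 15, .cut
      12, .cut 12, .ptr 26 205840, .ptr 6 205840, .ptr 26 66610, .ptr 6 66610, .ptr 0 274960], []⟩,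
    ⟨5, 5, 72057662758453265, 5, 0, [.cut 1, .cut 3, .cut 3, .cut 5, .cut 7, .cut 4, .cut 9, .cut
      11, .cut 12, .cut 8, .cut 17, .cut 19, .cut 20, .cut 24, .cut 16], []⟩,
    ⟨5, 5, 68720525329, 5, 0, [.cut 1, .cut 3, .cut 3, .cut 5, .cut 7, .cut 4, .cut 9, .cut 11, .cut
      12, .cut 8, .ptr 27 205840, .ptr 7 205840, .ptr 2 213520, .ptr 2 148240, .ptr 0 274960], []⟩,
    ⟨5, 5, 9007199255789585, 5, 0, [.cut 1, .cut 3, .cut 3, .cut 5, .cut 7, .cut 4, .cut 25, .cut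
      27, .cut 28, .cut 24, .cut 25, .cut 27, .cut 28, .cut 24, .cut 24], []⟩,
    ⟨5, 5, 4503599628419089, 5, 0, [.cut 1, .cut 3, .cut 3, .cut 5, .cut 7, .cut 4, .ptr 32 147760,
      .ptr 12 148240, .ptr 10 66610, .ptr 4 148240, .ptr 32 143680, .ptr 12 144400, .ptr 10 66370,
      .ptr 0 274960, .ptr 4 144400], []⟩,
    ⟨5, 5, 1048593, 5, 0, [.cut 1, .cut 3, .cut 3, .cut 5, .cut 7, .cut 4, .ptr 29 271120, .ptr 9
      271120, .ptr 4 274960, .ptr 2 274960, .ptr 29 205840, .ptr 9 205840, .ptr 4 213520, .ptr 0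
      274960, .ptr 2 213520], []⟩,
    ⟨5, 5, 281483566645265, 5, 0, [.cut 1, .cut 3, .cut 3, .cut 13, .cut 15, .cut 12, .cut 13, .cut
      15, .cut 12, .cut 12, .cut 29, .ptr 17 205840, .cut 28, .cut 28, .cut 28], []⟩,
    ⟨5, 5, 8589934609, 5, 0, [.cut 1, .cut 3, .cut 3, .cut 13, .cut 15, .cut 12, .cut 13, .cut 15,
      .cut 12, .cut 12, .ptr 30 205840, .ptr 10 205840, .ptr 0 274960, .ptr 0 271120, .ptr 3
      205840], []⟩,
    ⟨5, 5, 4785078899048465, 5, 0, [.cut 1, .cut 3, .cut 3, .cut 29, .ptr 21 274960, .cut 28, .cut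
      29, .ptr 21 271120, .cut 28, .cut 28, .cut 29, .ptr 21 205840, .cut 28, .cut 28, .cut 28],
      []⟩,
    ⟨5, 5, 281479271677969, 5, 0, [.cut 1, .cut 3, .cut 3, .ptr 42 274720, .ptr 21 274960, .ptr 35
      66610, .ptr 38 270640, .ptr 18 271120, .ptr 2 274960, .ptr 15 66595, .ptr 38 205120, .ptr 18
      205840, .ptr 2 213520, .ptr 0 274960, .ptr 15 66340], []⟩,
    ⟨5, 5, 4294967313, 5, 0, [.cut 1, .cut 3, .cut 3, .ptr 37 274720, .ptr 17 274960, .ptr 9 274960,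
      .ptr 37 270640, .ptr 17 271120, .ptr 2 274960, .ptr 9 271120, .ptr 32 205840, .ptr 12 205840,
      .ptr 0 274960, .ptr 0 271120, .ptr 5 205840], []⟩,
    ⟨5, 5, 17, 5, 0, [.cut 1, .cut 3, .cut 3, .ptr 32 274960, .ptr 12 274960, .ptr 5 274960, .ptr 32
      271120, .ptr 12 271120, .ptr 0 274960, .ptr 5 271120, .ptr 32 205840, .ptr 12 205840, .ptr 0
      213520, .ptr 0 148240, .ptr 5 205840], []⟩,
    ⟨5, 5, 72057662758453505, 5, 0, [.cut 1, .cut 3, .cut 2, .cut 5, .cut 6, .cut 4, .cut 9, .cut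
      10, .cut 12, .cut 8, .cut 17, .cut 18, .cut 20, .cut 24, .cut 16], []⟩,
    ⟨5, 5, 68720525569, 5, 0, [.cut 1, .cut 3, .cut 2, .cut 5, .cut 6, .cut 4, .cut 9, .cut 10, .cut
      12, .cut 8, .ptr 11 205120, .ptr 11 204865, .ptr 11 200770, .ptr 11 135235, .ptr 0 274960],
      []⟩,
    ⟨5, 5, 9007199255789825, 5, 0, [.cut 1, .cut 3, .cut 2, .cut 5, .cut 6, .cut 4, .cut 25, .cut
      26, .cut 28, .cut 24, .cut 25, .cut 26, .cut 28, .cut 24, .cut 24], []⟩,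
    ⟨5, 5, 4503599628419329, 5, 0, [.cut 1, .cut 3, .cut 2, .cut 5, .cut 6, .cut 4, .ptr 20 136240,
      .ptr 20 132145, .ptr 20 66610, .ptr 13 135235, .ptr 20 136000, .ptr 20 131905, .ptr 20 66370,
      .ptr 0 274960, .ptr 13 135220], []⟩,
    ⟨5, 5, 1048833, 5, 0, [.cut 1, .cut 3, .cut 2, .cut 5, .cut 6, .cut 4, .ptr 13 270640, .ptr 13
      270385, .ptr 13 266290, .ptr 2 274960, .ptr 13 205120, .ptr 13 204865, .ptr 13 200770, .ptr 0
      274960, .ptr 2 213520], []⟩,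
    ⟨5, 5, 281483566645505, 5, 0, [.cut 1, .cut 3, .cut 2, .cut 13, .cut 14, .cut 12, .cut 13, .cut
      14, .cut 12, .cut 12, .cut 29, .cut 30, .cut 28, .cut 28, .cut 28], []⟩,
    ⟨5, 5, 8589934849, 5, 0, [.cut 1, .cut 3, .cut 2, .cut 13, .cut 14, .cut 12, .cut 13, .cut 14,
      .cut 12, .cut 12, .ptr 14 205120, .ptr 14 204865, .ptr 0 274960, .ptr 0 271120, .ptr 3
      205840], []⟩,
    ⟨5, 5, 4785078899048705, 5, 0, [.cut 1, .cut 3, .cut 2, .cut 29, .cut 30, .cut 28, .cut 29, .cut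
      30, .cut 28, .cut 28, .cut 29, .cut 30, .cut 28, .cut 28, .cut 28], []⟩,
    ⟨5, 5, 281479271678209, 5, 0, [.cut 1, .cut 3, .cut 2, .ptr 36 82720, .ptr 36 17185, .ptr 45
      66610, .ptr 28 82480, .ptr 28 16945, .ptr 2 274960, .ptr 25 66595, .ptr 28 78400, .ptr 28
      12865, .ptr 2 213520, .ptr 0 274960, .ptr 25 66340], []⟩,
    ⟨5, 5, 4294967553, 5, 0, [.cut 1, .cut 3, .cut 2, .ptr 25 267040, .ptr 25 262945, .ptr 18
      266290, .ptr 25 266800, .ptr 25 262705, .ptr 2 274960, .ptr 18 266275, .ptr 16 205120, .ptr 16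
      204865, .ptr 0 274960, .ptr 0 271120, .ptr 5 205840], []⟩,
    ⟨5, 5, 257, 5, 0, [.cut 1, .cut 3, .cut 2, .ptr 16 274720, .ptr 16 274465, .ptr 5 274960, .ptr
      16 270640, .ptr 16 270385, .ptr 0 274960, .ptr 5 271120, .ptr 16 205120, .ptr 16 204865, .ptr
      0 213520, .ptr 0 148240, .ptr 5 205840], []⟩,
    ⟨5, 5, 17592454610945, 5, 0, [.cut 1, .cut 7, .cut 6, .cut 7, .cut 6, .cut 6, .cut 15, .cut 14,
      .cut 14, .cut 14, .cut 23, .cut 22, .cut 22, .cut 30, .cut 22], []⟩,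
    ⟨5, 5, 281475245277185, 5, 0, [.cut 1, .cut 7, .cut 6, .cut 7, .cut 6, .cut 6, .cut 15, .cut 14,
      .cut 14, .cut 14, .cut 23, .cut 22, .cut 22, .cut 30, .cut 22], []⟩,
    ⟨5, 5, 4503599895937025, 5, 0, [.cut 1, .cut 7, .cut 6, .cut 7, .cut 6, .cut 6, .cut 15, .cut
      14, .cut 14, .cut 14, .ptr 36 136000, .cut 30, .cut 30, .cut 30, .cut 30], []⟩,
    ⟨5, 5, 268566529, 5, 0, [.cut 1, .cut 7, .cut 6, .cut 7, .cut 6, .cut 6, .cut 15, .cut 14, .cut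
      14, .cut 14, .ptr 19 205120, .ptr 2 274960, .ptr 1 274960, .ptr 0 274960, .ptr 8 205120], []⟩,
    ⟨5, 5, 9007199254872065, 5, 0, [.cut 1, .cut 7, .cut 6, .cut 7, .cut 6, .cut 6, .cut 25, .cut
      30, .cut 30, .cut 24, .cut 25, .cut 30, .cut 30, .cut 24, .cut 24], []⟩,
    ⟨5, 5, 4503599627501569, 5, 0, [.cut 1, .cut 7, .cut 6, .cut 7, .cut 6, .cut 6, .ptr 31 136240,
      .ptr 2 274960, .ptr 2 274720, .ptr 24 135235, .ptr 31 136000, .ptr 2 213520, .ptr 2 213280,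
      .ptr 0 274960, .ptr 24 135220], []⟩,
    ⟨5, 5, 131073, 5, 0, [.cut 1, .cut 7, .cut 6, .cut 7, .cut 6, .cut 6, .ptr 21 270640, .ptr 2
      274960, .ptr 2 274720, .ptr 10 270640, .ptr 21 205120, .ptr 2 213520, .ptr 2 213280, .ptr 0
      274960, .ptr 10 205120], []⟩,
    ⟨5, 5, 17596749512705, 5, 0, [.cut 1, .cut 15, .cut 14, .cut 15, .cut 14, .cut 14, .cut 15, .cut
      14, .cut 14, .cut 14, .ptr 43 205120, .cut 30, .cut 30, .cut 30, .cut 30], []⟩,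
    ⟨5, 5, 4563468289, 5, 0, [.cut 1, .cut 15, .cut 14, .cut 15, .cut 14, .cut 14, .cut 15, .cut 14,
      .cut 14, .cut 14, .ptr 22 205120, .ptr 0 274960, .ptr 0 274720, .ptr 0 270640, .ptr 11
      205120], []⟩,
    ⟨5, 5, 17592454545409, 5, 0, [.cut 1, .ptr 52 274960, .ptr 67 17185, .ptr 44 274720, .ptr 8
      274960, .ptr 48 17170, .ptr 44 270640, .ptr 8 271120, .ptr 1 274960, .ptr 48 16915, .ptr 44
      205120, .ptr 8 205840, .ptr 1 213520, .ptr 1 148240, .ptr 48 12820], []⟩,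
    ⟨5, 5, 4785074872582145, 5, 0, [.cut 1, .ptr 51 274960, .cut 30, .ptr 51 213280, .cut 30, .cut
      30, .ptr 51 147760, .cut 30, .cut 30, .cut 30, .ptr 51 78400, .cut 30, .cut 30, .cut 30, .cut
      30], []⟩,
    ⟨5, 5, 281475245211649, 5, 0, [.cut 1, .ptr 51 274960, .ptr 62 17185, .ptr 51 213280, .ptr 9
      274960, .ptr 62 13330, .ptr 43 270640, .ptr 8 271120, .ptr 3 274720, .ptr 42 16915, .ptr 43
      201280, .ptr 3 213520, .ptr 8 201760, .ptr 0 274960, .ptr 42 12580], []⟩,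
    ⟨5, 5, 268500993, 5, 0, [.cut 1, .ptr 50 274960, .ptr 59 262945, .ptr 42 274720, .ptr 8 274960,
      .ptr 39 262930, .ptr 42 270640, .ptr 8 271120, .ptr 3 274960, .ptr 39 262675, .ptr 25 205120,
      .ptr 2 274960, .ptr 0 274960, .ptr 0 271120, .ptr 14 205120], []⟩,
    ⟨5, 5, 4503599627436033, 5, 0, [.cut 1, .ptr 38 274960, .ptr 31 274465, .ptr 38 274720, .ptr 7
      274960, .ptr 31 274450, .ptr 38 136240, .ptr 1 271120, .ptr 1 267040, .ptr 31 135235, .ptr 38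
      136000, .ptr 1 205840, .ptr 1 201760, .ptr 7 136240, .ptr 31 135220], []⟩,
    ⟨5, 5, 65537, 5, 0, [.cut 1, .ptr 38 274960, .ptr 31 274465, .ptr 38 274720, .ptr 7 274960, .ptr
      31 274450, .ptr 26 270640, .ptr 1 274960, .ptr 1 274720, .ptr 15 270640, .ptr 26 205120, .ptr
      1 213520, .ptr 1 213280, .ptr 0 274960, .ptr 15 205120], []⟩,
    ⟨5, 5, 1, 5, 0, [.cut 1, .ptr 26 274960, .ptr 15 274960, .ptr 26 274720, .ptr 0 274960, .ptr 15
      274720, .ptr 26 270640, .ptr 0 271120, .ptr 0 267040, .ptr 15 270640, .ptr 26 205120, .ptr 0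
      205840, .ptr 0 201760, .ptr 0 136240, .ptr 15 205120], []⟩,
    ⟨5, 5, 1099528409120, 5, 0, [.cut 3, .cut 3, .cut 3, .cut 7, .cut 7, .cut 7, .cut 11, .cut 11,
      .cut 15, .cut 11, .cut 19, .cut 19, .cut 23, .cut 27, .cut 19], []⟩,
    ⟨5, 5, 17592202825760, 5, 0, [.cut 3, .cut 3, .cut 3, .cut 7, .cut 7, .cut 7, .cut 11, .cut 11,
      .cut 15, .cut 11, .cut 19, .cut 19, .cut 23, .cut 27, .cut 19], []⟩,
    ⟨5, 6, 5017519173123618902048, 0, 2315519, [.cut 3, .cut 7, .cut 7, .cut 11, .cut 15, .cut 11,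
      .cut 23, .cut 23, .cut 27, .cut 23, .cut 39, .cut 39, .cut 43, .cut 60, .cut 39], [.cut 61,
      .cut 61, .cut 71, .cut 61, .cut 71, .cut 75, .cut 61, .cut 124, .cut 75, .cut 47, .cut 47,
      .cut 47, .cut 47, .cut 47]⟩,
    ⟨5, 5, 4785074620862496, 4, 983041, [.cut 3, .cut 3, .cut 3, .cut 7, .cut 7, .cut 7, .cut 11,
      .cut 11, .cut 15, .cut 11], [.cut 35, .cut 35, .cut 35, .cut 35, .cut 35, .cut 39, .cut 39,
      .cut 39, .cut 39, .cut 43, .cut 43, .cut 43, .ptr 0 5517840, .cut 43]⟩,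
    ⟨5, 5, 281474993492000, 5, 0, [.cut 3, .cut 3, .cut 3, .cut 7, .cut 7, .cut 7, .cut 11, .cut 11,
      .cut 15, .cut 11, .cut 23, .cut 23, .cut 23, .ptr 0 274960, .cut 23], []⟩,
    ⟨5, 5, 16781344, 5, 0, [.cut 3, .cut 3, .cut 3, .cut 7, .cut 7, .cut 7, .cut 11, .cut 11, .cut
      15, .cut 11, .ptr 4 274960, .ptr 3 274960, .ptr 0 274960, .ptr 0 271120, .ptr 20 205060], []⟩,
    ⟨5, 6, 5017519173123870560288, 0, 2315327, [.cut 3, .cut 7, .cut 7, .cut 11, .cut 15, .cut 11,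
      .cut 23, .cut 23, .cut 27, .cut 23, .cut 39, .cut 39, .cut 43, .cut 60, .cut 39], [.cut 67,
      .cut 67, .cut 71, .cut 71, .cut 71, .cut 75, .cut 75, .cut 124, .cut 75, .cut 47, .cut 47,
      .cut 47, .cut 47, .cut 47]⟩,
    ⟨5, 5, 4785074872520736, 4, 987137, [.cut 3, .cut 3, .cut 3, .cut 7, .cut 7, .cut 7, .cut 11,
      .cut 11, .cut 15, .cut 11], [.cut 35, .cut 35, .cut 35, .cut 35, .cut 35, .cut 39, .cut 39,
      .cut 39, .cut 39, .cut 43, .cut 43, .cut 43, .ptr 0 5517840, .cut 43]⟩,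
    ⟨5, 5, 281475245150240, 5, 0, [.cut 3, .cut 3, .cut 3, .cut 7, .cut 7, .cut 7, .cut 11, .cut 11,
      .cut 15, .cut 11, .cut 23, .cut 23, .cut 23, .ptr 0 274960, .cut 23], []⟩,
    ⟨5, 5, 268439584, 5, 0, [.cut 3, .cut 3, .cut 3, .cut 7, .cut 7, .cut 7, .cut 11, .cut 11, .cut
      15, .cut 11, .ptr 7 213520, .ptr 7 148225, .ptr 0 274960, .ptr 0 271105, .ptr 23 205060], []⟩,
    ⟨5, 6, 4740818012022253817888, 0, 3294047, [.cut 3, .cut 7, .cut 7, .cut 15, .cut 15, .cut 15,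
      .cut 23, .cut 23, .cut 28, .cut 23, .cut 35, .cut 39, .cut 43, .cut 60, .cut 35], [.cut 67,
      .cut 67, .cut 71, .cut 71, .cut 71, .cut 92, .cut 107, .cut 92, .cut 92, .cut 47, .cut 47,
      .cut 47, .cut 47, .cut 47]⟩,
    ⟨5, 5, 4785078899052576, 0, 148479, [.cut 3, .cut 7, .cut 7, .cut 15, .cut 15, .cut 15, .cut 23,
      .cut 23, .cut 28, .cut 23], [.cut 35, .cut 35, .cut 39, .cut 39, .cut 39, .cut 60, .ptr 0
      5517840, .cut 60, .cut 60, .cut 60, .ptr 0 5456400, .cut 60, .cut 60, .cut 60]⟩,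
    ⟨5, 5, 281479271682080, 5, 0, [.cut 3, .cut 3, .cut 3, .cut 7, .cut 7, .cut 7, .cut 15, .cut 15,
      .cut 15, .cut 15, .cut 23, .cut 23, .cut 23, .ptr 0 274960, .cut 23], []⟩,
    ⟨5, 6, 4740822234146904477728, 0, 3359583, [.cut 3, .cut 7, .cut 7, .cut 15, .cut 15, .cut 15,
      .cut 27, .cut 28, .cut 24, .cut 24, .cut 35, .cut 39, .cut 43, .cut 56, .cut 35], [.cut 67,
      .cut 67, .cut 59, .cut 59, .cut 59, .cut 88, .cut 122, .cut 59, .cut 88, .cut 47, .cut 47,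
      .cut 47, .cut 47, .cut 47]⟩,
    ⟨5, 6, 75576319477191582683168, 0, 4408159, [.cut 3, .cut 7, .cut 7, .cut 15, .cut 15, .cut 15,
      .cut 27, .cut 28, .cut 24, .cut 24, .cut 35, .cut 39, .cut 56, .cut 51, .cut 35], [.cut 67,
      .cut 67, .cut 59, .cut 59, .cut 59, .cut 79, .cut 79, .cut 59, .cut 79, .cut 88, .cut 115,
      .cut 59, .cut 88, .cut 88]⟩,
    ⟨5, 5, 9007203549712416, 0, 214015, [.cut 3, .cut 7, .cut 7, .cut 15, .cut 15, .cut 15, .cut 27,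
      .cut 28, .cut 24, .cut 24], [.cut 35, .cut 35, .cut 39, .cut 39, .cut 39, .cut 56, .ptr 1
      5517840, .cut 60, .cut 56, .cut 56, .ptr 0 5517840, .cut 60, .cut 56, .cut 56]⟩,
    ⟨5, 5, 4503603922341920, 5, 0, [.cut 3, .cut 3, .cut 3, .cut 7, .cut 7, .cut 7, .cut 15, .cut
      15, .cut 15, .cut 15, .ptr 12 213520, .ptr 8 213520, .ptr 4 274960, .ptr 0 274960, .ptr 66
      66100], []⟩,
    ⟨5, 5, 4294971424, 5, 0, [.cut 3, .cut 3, .cut 3, .cut 7, .cut 7, .cut 7, .cut 15, .cut 15, .cut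
      15, .cut 15, .ptr 12 213520, .ptr 8 213520, .ptr 4 274960, .ptr 0 274960, .ptr 30 205060],
      []⟩,
    ⟨5, 5, 9007199254745120, 5, 0, [.cut 3, .cut 3, .cut 3, .cut 7, .cut 7, .cut 7, .cut 27, .cut
      27, .ptr 2 274960, .cut 24, .cut 27, .cut 27, .ptr 2 213520, .cut 24, .cut 24], []⟩,
    ⟨5, 5, 4503599627374624, 5, 0, [.cut 3, .cut 3, .cut 3, .cut 7, .cut 7, .cut 7, .ptr 14 271120,
      .ptr 10 271105, .ptr 2 274960, .ptr 51 135235, .ptr 14 205840, .ptr 10 205825, .ptr 2 213520,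
      .ptr 0 274960, .ptr 51 135220], []⟩,
    ⟨5, 5, 4128, 5, 0, [.cut 3, .cut 3, .cut 3, .cut 7, .cut 7, .cut 7, .ptr 14 274960, .ptr 10
      274960, .ptr 2 274960, .ptr 32 270595, .ptr 14 213520, .ptr 10 213520, .ptr 2 213520, .ptr 0
      274960, .ptr 32 205060], []⟩,
    ⟨5, 5, 8589934624, 5, 0, [.cut 3, .cut 3, .cut 3, .cut 15, .cut 15, .cut 12, .cut 15, .cut 15,
      .cut 12, .cut 12, .ptr 2 205840, .ptr 2 205825, .ptr 2 66610, .ptr 2 66595, .ptr 32 205060],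
      []⟩,
    ⟨5, 5, 4785078899048480, 5, 0, [.cut 3, .cut 3, .cut 3, .ptr 10 274960, .ptr 10 274945, .cut 28,
      .ptr 10 271120, .ptr 10 271105, .cut 28, .cut 28, .ptr 10 205840, .ptr 10 205825, .cut 28,
      .cut 28, .cut 28], []⟩,
    ⟨5, 5, 281479271677984, 5, 0, [.cut 3, .cut 3, .cut 3, .ptr 10 274960, .ptr 10 274945, .ptr 85
      66610, .ptr 6 271120, .ptr 6 271105, .ptr 4 66610, .ptr 65 66595, .ptr 6 205840, .ptr 6
      205825, .ptr 4 66370, .ptr 0 274960, .ptr 65 66340], []⟩,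
    ⟨5, 5, 4294967328, 5, 0, [.cut 3, .cut 3, .cut 3, .ptr 6 274960, .ptr 6 274945, .ptr 55 266290,
      .ptr 6 271120, .ptr 6 271105, .ptr 2 274960, .ptr 55 266275, .ptr 4 205840, .ptr 4 205825,
      .ptr 0 274960, .ptr 0 271120, .ptr 34 205060], []⟩,
    ⟨5, 5, 32, 5, 0, [.cut 3, .cut 3, .cut 3, .ptr 4 274960, .ptr 4 274945, .ptr 34 274690, .ptr 4
      271120, .ptr 4 271105, .ptr 0 274960, .ptr 34 270595, .ptr 4 205840, .ptr 4 205825, .ptr 0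
      213520, .ptr 0 148240, .ptr 34 205060], []⟩,
    ⟨5, 6, 5017518892748153884688, 2, 3165955, [.cut 7, .cut 7, .cut 7, .cut 15, .cut 15, .cut 15,
      .cut 23, .cut 23, .cut 25, .cut 23, .cut 39, .cut 39, .cut 45, .cut 57, .cut 39], [.cut 71,
      .cut 71, .cut 61, .cut 61, .cut 61, .cut 89, .cut 89, .cut 61, .cut 89, .cut 47, .cut 47, .cut
      47, .cut 47, .cut 47]⟩,
    ⟨5, 5, 4504699155845136, 1, 16627, [.cut 7, .cut 7, .cut 7, .cut 15, .cut 15, .cut 15, .cut 23,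
      .cut 23, .cut 25, .cut 23], [.cut 39, .cut 39, .cut 39, .cut 39, .cut 39, .cut 57, .cut 57,
      .ptr 0 5517840, .cut 57, .cut 57, .cut 57, .ptr 0 5456400, .cut 57, .cut 57]⟩,
    ⟨5, 5, 1099528474640, 5, 0, [.cut 7, .cut 7, .cut 7, .cut 7, .cut 7, .cut 7, .cut 15, .cut 15,
      .cut 15, .cut 15, .cut 23, .cut 23, .cut 23, .ptr 0 274960, .cut 23], []⟩,
    ⟨5, 6, 1284483687861735328387088, 0, 5587279, [.cut 7, .cut 7, .cut 7, .cut 15, .cut 15, .cut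
      15, .cut 23, .cut 23, .cut 27, .cut 23, .cut 39, .cut 39, .cut 56, .cut 48, .cut 32], [.cut
      71, .cut 71, .cut 59, .cut 59, .cut 59, .cut 55, .cut 55, .cut 55, .cut 55, .cut 112, .cut
      114, .cut 59, .cut 55, .cut 112]⟩,
    ⟨5, 6, 75559021168610760527888, 1, 344307, [.cut 7, .cut 7, .cut 7, .cut 15, .cut 15, .cut 15,
      .cut 23, .cut 23, .cut 27, .cut 23, .cut 39, .cut 39, .cut 57, .cut 51, .cut 39], [.cut 71,
      .cut 71, .cut 59, .cut 59, .cut 59, .cut 55, .cut 55, .cut 55, .cut 55, .cut 121, .cut 121,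
      .cut 59, .cut 55, .cut 121]⟩,
    ⟨5, 6, 75576314991179863232528, 0, 4276575, [.cut 7, .cut 7, .cut 7, .cut 15, .cut 15, .cut 15,
      .cut 23, .cut 23, .cut 27, .cut 23, .cut 39, .cut 39, .cut 58, .cut 50, .cut 39], [.cut 71,
      .cut 71, .cut 59, .cut 59, .cut 59, .cut 55, .cut 55, .cut 55, .cut 55, .cut 114, .cut 114,
      .cut 59, .cut 55, .cut 114]⟩,
    ⟨5, 6, 75853016152285506506768, 0, 4277551, [.cut 7, .cut 7, .cut 7, .cut 15, .cut 15, .cut 15,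
      .cut 23, .cut 23, .cut 27, .cut 23, .cut 39, .cut 39, .win 30 5517840, .cut 54, .cut 39],
      [.cut 71, .cut 71, .cut 71, .cut 71, .cut 71, .cut 55, .cut 55, .cut 55, .cut 55, .cut 91,
      .cut 91, .cut 118, .cut 55, .cut 91]⟩,
    ⟨5, 6, 151115731973020477100048, 0, 4538703, [.cut 7, .cut 7, .cut 7, .cut 15, .cut 15, .cut 15,
      .cut 23, .cut 23, .cut 27, .cut 23, .cut 50, .cut 54, .cut 56, .cut 48, .cut 48], [.cut 71,
      .cut 71, .cut 59, .cut 59, .cut 59, .cut 55, .cut 55, .cut 55, .cut 55, .cut 112, .cut 114,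
      .cut 59, .cut 55, .cut 112]⟩,
    ⟨5, 5, 4521191830261776, 3, 127234, [.cut 7, .cut 7, .cut 7, .cut 7, .cut 7, .cut 7, .cut 23,
      .cut 23, .cut 23, .cut 23], [.cut 39, .cut 39, .cut 39, .cut 39, .cut 39, .cut 39, .cut 39,
      .cut 39, .cut 39, .ptr 4 5517840, .ptr 3 5517840, .ptr 2 5517840, .ptr 1 5517840, .ptr 0
      5517840]⟩,
    ⟨5, 5, 17592202891280, 5, 0, [.cut 7, .cut 7, .cut 7, .cut 7, .cut 7, .cut 7, .cut 15, .cut 15,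
      .cut 15, .cut 15, .cut 23, .cut 23, .cut 23, .ptr 0 274960, .cut 23], []⟩,
    ⟨5, 5, 4503599644217360, 5, 0, [.cut 7, .cut 7, .cut 7, .cut 7, .cut 7, .cut 7, .cut 15, .cut
      15, .cut 15, .cut 15, .ptr 8 274960, .ptr 1 274960, .ptr 1 274720, .ptr 24 135235, .ptr 88
      135220], []⟩,
    ⟨5, 5, 16846864, 5, 0, [.cut 7, .cut 7, .cut 7, .cut 7, .cut 7, .cut 7, .cut 15, .cut 15, .cut
      15, .cut 15, .ptr 8 274960, .ptr 1 274960, .ptr 1 274720, .ptr 0 274960, .ptr 45 205060], []⟩,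
    ⟨5, 5, 4503599627440144, 5, 0, [.cut 7, .cut 7, .cut 7, .cut 7, .cut 7, .cut 7, .ptr 1 274960,
      .ptr 1 274945, .ptr 1 274690, .ptr 68 135235, .ptr 1 213520, .ptr 1 213505, .ptr 1 213250,
      .ptr 15 135235, .ptr 68 135220], []⟩,
    ⟨5, 5, 69648, 5, 0, [.cut 7, .cut 7, .cut 7, .cut 7, .cut 7, .cut 7, .ptr 1 274960, .ptr 1
      274945, .ptr 1 274690, .ptr 46 270595, .ptr 1 213520, .ptr 1 213505, .ptr 1 213250, .ptr 0
      274960, .ptr 46 205060], []⟩,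
    ⟨5, 5, 1099528409104, 5, 0, [.ptr 116 274960, .ptr 39 274960, .ptr 99 274945, .ptr 39 274720,
      .ptr 11 274960, .ptr 99 274690, .ptr 39 270640, .ptr 11 271120, .ptr 11 267040, .ptr 99
      270595, .ptr 39 205120, .ptr 11 205840, .ptr 11 201760, .ptr 11 136240, .ptr 99 205060], []⟩,
    ⟨5, 6, 1208944271161369691164688, 0, 5325919, [.cut 23, .cut 23, .cut 23, .cut 27, .cut 29, .cut
      27, .cut 23, .cut 23, .cut 27, .cut 23, .cut 34, .cut 39, .cut 43, .cut 50, .cut 32], [.cut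
      98, .cut 98, .cut 59, .cut 59, .cut 59, .cut 55, .cut 55, .cut 55, .cut 55, .cut 93, .cut 114,
      .cut 59, .cut 55, .cut 93]⟩,
    ⟨5, 6, 36898290814226010128, 0, 1131615, [.cut 23, .cut 23, .cut 23, .cut 27, .cut 29, .cut 27,
      .cut 23, .cut 23, .cut 27, .cut 23, .cut 34, .cut 39, .cut 43, .cut 50, .cut 34], [.cut 98,
      .cut 98, .cut 59, .cut 59, .cut 59, .cut 55, .cut 55, .cut 55, .cut 55, .cut 93, .cut 114,
      .cut 59, .cut 55, .cut 93]⟩,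
    ⟨5, 6, 313599451919869284368, 0, 2180191, [.cut 23, .cut 23, .cut 23, .cut 27, .cut 29, .cut 27,
      .cut 23, .cut 23, .cut 27, .cut 23, .cut 39, .cut 39, .win 31 2184240, .cut 54, .cut 39],
      [.cut 91, .cut 91, .cut 93, .cut 103, .cut 93, .cut 55, .cut 55, .cut 55, .cut 55, .cut 91,
      .cut 91, .cut 93, .cut 55, .cut 91]⟩,
    ⟨5, 6, 1284483688143210305032208, 0, 5588047, [.cut 23, .cut 23, .cut 23, .cut 27, .cut 29, .cut
      27, .cut 23, .cut 23, .cut 27, .cut 23, .cut 50, .cut 52, .cut 56, .cut 48, .cut 32], [.cut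
      61, .cut 61, .cut 59, .cut 59, .cut 59, .cut 55, .cut 55, .cut 55, .cut 55, .cut 112, .cut 61,
      .cut 59, .cut 55, .cut 112]⟩,
    ⟨5, 6, 75576315272654839877648, 0, 4277343, [.cut 23, .cut 23, .cut 23, .cut 27, .cut 29, .cut
      27, .cut 23, .cut 23, .cut 27, .cut 23, .cut 50, .cut 54, .cut 58, .cut 50, .cut 50], [.cut
      114, .cut 114, .cut 59, .cut 59, .cut 59, .cut 55, .cut 55, .cut 55, .cut 55, .cut 93, .cut
      114, .cut 59, .cut 55, .cut 93]⟩,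
    ⟨5, 6, 151115732254495453745168, 0, 4539471, [.cut 23, .cut 23, .cut 23, .cut 27, .cut 29, .cut
      27, .cut 23, .cut 23, .cut 27, .cut 23, .cut 50, .cut 52, .cut 56, .cut 48, .cut 48], [.cut
      61, .cut 61, .cut 59, .cut 59, .cut 59, .cut 55, .cut 55, .cut 55, .cut 55, .cut 112, .cut 61,
      .cut 59, .cut 55, .cut 112]⟩,
    ⟨5, 5, 4802666806906896, 0, 83199, [.cut 23, .cut 23, .cut 23, .cut 27, .cut 29, .cut 27, .cut
      23, .cut 23, .cut 27, .cut 23], [.ptr 5 5517840, .ptr 4 5517840, .ptr 5 5517600, .ptr 3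
      5517840, .ptr 4 5517600, .ptr 5 5513520, .ptr 3 5514000, .ptr 3 5509920, .ptr 4 5513520, .ptr
      2 5517840, .ptr 1 5517840, .ptr 1 5517600, .ptr 1 5513520, .ptr 0 5517840]⟩,
    ⟨5, 5, 299067179536400, 5, 0, [.cut 23, .cut 23, .cut 23, .cut 23, .cut 23, .cut 23, .ptr 44
      270640, .ptr 13 271120, .ptr 13 267040, .ptr 105 270595, .cut 23, .cut 23, .cut 23, .ptr 0
      274960, .cut 23], []⟩,
    ⟨5, 5, 17592202825744, 5, 0, [.ptr 124 274960, .ptr 47 274960, .ptr 121 205825, .ptr 44 274720,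
      .ptr 13 274960, .ptr 105 274690, .ptr 44 270640, .ptr 13 271120, .ptr 12 267040, .ptr 105
      270595, .ptr 20 205840, .ptr 36 204865, .ptr 0 274960, .ptr 0 271120, .ptr 100 204820], []⟩,
    ⟨5, 5, 16781328, 5, 0, [.ptr 123 274960, .ptr 44 274960, .ptr 104 274945, .ptr 44 274720, .ptr
      12 274960, .ptr 104 274690, .ptr 44 270640, .ptr 12 271120, .ptr 12 267040, .ptr 104 270595,
      .ptr 9 274960, .ptr 0 274960, .ptr 0 274720, .ptr 0 270640, .ptr 56 205060], []⟩,
    ⟨5, 5, 4563406864, 5, 0, [.cut 15, .cut 15, .cut 15, .cut 15, .cut 15, .cut 15, .cut 15, .cut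
      15, .cut 15, .cut 15, .ptr 2 213520, .ptr 2 148225, .ptr 2 82690, .ptr 2 16915, .ptr 56
      205060], []⟩,
    ⟨5, 5, 4785074872520720, 5, 0, [.ptr 122 274960, .ptr 44 274960, .ptr 122 271105, .ptr 44
      213280, .ptr 17 274465, .ptr 122 201730, .ptr 17 270640, .ptr 44 147505, .ptr 17 66610, .ptr
      122 132115, .ptr 17 201280, .ptr 17 131905, .ptr 44 77890, .ptr 44 8515, .ptr 122 66340], []⟩,
    ⟨5, 5, 281475245150224, 5, 0, [.ptr 122 274960, .ptr 44 274960, .ptr 121 271105, .ptr 44 213280,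
      .ptr 17 274465, .ptr 121 201730, .ptr 16 271120, .ptr 36 270385, .ptr 4 82690, .ptr 101
      270355, .ptr 16 201760, .ptr 4 144385, .ptr 36 200770, .ptr 0 274960, .ptr 101 200740], []⟩,
    ⟨5, 5, 268439568, 5, 0, [.ptr 120 274960, .ptr 44 274960, .ptr 120 271105, .ptr 36 274720, .ptr
      16 274945, .ptr 100 274690, .ptr 16 271120, .ptr 36 270385, .ptr 2 274960, .ptr 100 270355,
      .ptr 4 213520, .ptr 4 148225, .ptr 0 274960, .ptr 0 271105, .ptr 58 205060], []⟩,
    ⟨5, 5, 4503599627374608, 5, 0, [.ptr 116 274960, .ptr 35 274960, .ptr 96 274945, .ptr 35 274720,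
      .ptr 16 274960, .ptr 96 274690, .ptr 5 270640, .ptr 1 271105, .ptr 1 267010, .ptr 84 135235,
      .ptr 5 205120, .ptr 1 205825, .ptr 1 201730, .ptr 31 135235, .ptr 84 135220], []⟩,
    ⟨5, 5, 4112, 5, 0, [.ptr 116 274960, .ptr 35 274960, .ptr 96 274945, .ptr 35 274720, .ptr 16
      274960, .ptr 96 274690, .ptr 5 274960, .ptr 1 274960, .ptr 1 274720, .ptr 59 270595, .ptr 5
      213520, .ptr 1 213520, .ptr 1 213280, .ptr 0 274960, .ptr 59 205060], []⟩,
    ⟨5, 5, 4294967312, 5, 0, [.ptr 85 274960, .ptr 32 274960, .ptr 85 274945, .ptr 2 274720, .ptr 2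
      274465, .ptr 85 266290, .ptr 2 270640, .ptr 2 270385, .ptr 32 266290, .ptr 85 266275, .ptr 1
      205840, .ptr 1 205825, .ptr 1 66610, .ptr 1 66595, .ptr 59 205060], []⟩,
    ⟨5, 5, 16, 5, 0, [.ptr 85 274960, .ptr 32 274960, .ptr 85 274945, .ptr 1 274960, .ptr 1 274945,
      .ptr 59 274690, .ptr 1 271120, .ptr 1 271105, .ptr 0 274960, .ptr 59 270595, .ptr 1 205840,
      .ptr 1 205825, .ptr 0 213520, .ptr 0 148240, .ptr 59 205060], []⟩,
    ⟨5, 5, 0, 5, 0, [.ptr 59 274960, .ptr 0 274960, .ptr 59 274945, .ptr 0 274720, .ptr 0 274465,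
      .ptr 59 274690, .ptr 0 270640, .ptr 0 270385, .ptr 0 266290, .ptr 59 270595, .ptr 0 205120,
      .ptr 0 204865, .ptr 0 200770, .ptr 0 135235, .ptr 59 205060], []⟩]

/-- The forcing matrices. -/
def forcing : List (ℕ × ℕ) := states.map fun s => (s.n, s.mat)

lemma checkGrows_growths : checkGrows forcing [] growths = true := by
  decide +kernel

lemma forces_of_mem_forcing : ∀ r ∈ forcing, Forces r :=
  List.forall_mem_map.2 forces_states

lemma dead_root {k : ℕ} (h2 : 2 ≤ k) (h5 : k ≤ 5) : Dead forcing (k, k, 0) := by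
  have h := dead_of_checkGrows growths [] (by simp) checkGrows_growths
  have key : ∀ e ∈ growths, e.n = e.k → e.mat = 0 → Dead forcing (e.k, e.k, 0) := by
    intro e he h1 h0
    have := h e he
    rwa [h1, h0] at this
  have hmem : (growths.any fun e => e.k == k && e.n == e.k && e.mat == 0) = true := by
    interval_cases k <;> decide +kernel
  obtain ⟨e, he, hk⟩ := List.any_eq_true.1 hmem
  simp only [Bool.and_eq_true, beq_iff_eq] at hk
  obtain ⟨⟨rfl, h1⟩, h0⟩ := hk
  exact key e he h1 h0

section Divisions

open scoped Classical

variable {V : Type} {G : SimpleGraph V} {D : Finset (Finset V)}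

/-- A family of disjoint connected sets such that no single one of them meets all bad unions. -/
structure Division (G : SimpleGraph V) (D : Finset (Finset V)) : Prop where
  conn : ∀ P ∈ D, (G.induce (P : Set V)).Connected
  disj : (D : Set (Finset V)).PairwiseDisjoint id
  avoid : ∀ P, ∃ Y ⊆ D, P ∉ Y ∧ Bad G (Y.biUnion id)

variable (G) in
/-- The edge multiplicities of the multigraph obtained by contracting the sets of a division. -/
noncomputable def mult (P Q : Finset V) : ℕ :=
  if P = Q then (cross G P P + 2) / 2 - #P else cross G P Q

lemma mult_of_ne {P Q : Finset V} (h : P ≠ Q) : mult G P Q = cross G P Q := if_neg h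

lemma mult_comm (P Q : Finset V) : mult G P Q = mult G Q P := by
  by_cases h : P = Q
  · rw [h]
  · rw [mult_of_ne h, mult_of_ne (Ne.symm h), cross_comm]

lemma two_mul_mult_self {P : Finset V} (h : (G.induce (P : Set V)).Connected) :
    2 * mult G P P + 2 * #P = cross G P P + 2 := by
  have h1 := two_mul_card_le_of_connected h
  have h2 := cross_induce (G := G) P
  rw [mult, if_pos rfl]
  omega

lemma Bad.union {Z Q : Finset V} (hZ : Bad G Z) (hQ : (G.induce (Q : Set V)).Connected)
    (hdisj : Disjoint Z Q) (h : 0 < cross G Z Q) : Bad G (Z ∪ Q) := by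
  have := two_mul_card_le_of_connected hQ
  unfold Bad at hZ ⊢
  rw [Finset.card_union_of_disjoint hdisj, cross_union_self hdisj]
  omega

lemma exists_division [Finite V] (h : ¬ ApexPseudoforest G) :
    ∃ D : Finset (Finset V), Division G D := by
  have := Fintype.ofFinite V
  rw [apexPseudoforest_iff] at h
  push Not at h
  refine ⟨univ.image singleton, fun P hP => ?_, ?_, fun P => ?_⟩
  · obtain ⟨v, -, rfl⟩ := Finset.mem_image.1 hP
    exact connected_singleton v
  · intro P hP Q hQ hne
    obtain ⟨u, -, rfl⟩ := Finset.mem_image.1 hP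
    obtain ⟨v, -, rfl⟩ := Finset.mem_image.1 hQ
    exact Finset.disjoint_singleton.2 fun h => hne (by rw [h])
  · obtain ⟨Z, hZ, hbad⟩ := h {v | P = {v}} fun u hu v hv =>
      Finset.singleton_injective (hu.symm.trans hv)
    refine ⟨Z.image singleton, Finset.image_subset_image (Finset.subset_univ Z), fun hP => ?_, ?_⟩
    · obtain ⟨v, hv, rfl⟩ := Finset.mem_image.1 hP
      exact Set.disjoint_left.1 hZ hv rfl
    · rwa [show (Z.image singleton).biUnion id = Z by ext; simp]

lemma Division.bad_iff (h : Division G D) {Y : Finset (Finset V)} (hY : Y ⊆ D) :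
    Bad G (Y.biUnion id) ↔ 2 * #Y < dsum (mult G) Y := by
  have hdisj := h.disj.subset (Finset.coe_subset.2 hY)
  have h1 : ∀ P ∈ Y, (mult G P P + ∑ Q ∈ Y, mult G P Q) + 2 * #P =
      (∑ Q ∈ Y, cross G P Q) + 2 := by
    intro P hP
    have h2 : ∑ Q ∈ Y.erase P, mult G P Q = ∑ Q ∈ Y.erase P, cross G P Q :=
      Finset.sum_congr rfl fun Q hQ => mult_of_ne (Finset.ne_of_mem_erase hQ).symm
    have h3 := two_mul_mult_self (h.conn P (hY hP))
    rw [← Finset.add_sum_erase Y _ hP, ← Finset.add_sum_erase Y (fun Q => cross G P Q) hP, h2]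
    omega
  have h2 := Finset.sum_congr (rfl : Y = Y) h1
  simp only [Finset.sum_add_distrib, Finset.sum_const, smul_eq_mul, ← Finset.mul_sum] at h2
  have h3 := cross_biUnion (G := G) hdisj
  have h4 := Finset.card_biUnion hdisj
  simp only [id_eq] at h3 h4
  rw [Bad, h3, h4, dsum, Finset.sum_add_distrib]
  omega

lemma Division.disjoint_biUnion (h : Division G D) {Y : Finset (Finset V)} (hY : Y ⊆ D)
    {P : Finset V} (hP : P ∈ D) (hPY : P ∉ Y) : Disjoint (Y.biUnion id) P := by
  refine (Finset.disjoint_biUnion_left _ _ _).2 fun Q hQ => ?_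
  exact h.disj (hY hQ) hP fun h => hPY (h ▸ hQ)

lemma Division.bad_insert (h : Division G D) {Y : Finset (Finset V)} (hY : Y ⊆ D) {P Q : Finset V}
    (hPY : P ∈ Y) (hQ : Q ∈ D) (hPQ : 0 < cross G P Q) (hbad : Bad G (Y.biUnion id)) :
    Bad G ((insert (P ∪ Q) ((Y.erase P).erase Q)).biUnion id) := by
  have hsub : P ⊆ Y.biUnion id := Finset.subset_biUnion_of_mem id hPY
  have heq : (insert (P ∪ Q) ((Y.erase P).erase Q)).biUnion id = Y.biUnion id ∪ Q := by
    ext x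
    simp only [Finset.mem_biUnion, Finset.mem_insert, Finset.mem_erase, Finset.mem_union, id_eq]
    constructor
    · rintro ⟨R, rfl | hR, hx⟩
      · exact (Finset.mem_union.1 hx).imp (fun hx => ⟨P, hPY, hx⟩) id
      · exact .inl ⟨R, hR.2.2, hx⟩
    · rintro (⟨R, hR, hx⟩ | hx)
      · by_cases hRP : R = P
        · exact ⟨_, .inl rfl, Finset.mem_union_left _ (hRP ▸ hx)⟩
        · by_cases hRQ : R = Q
          · exact ⟨_, .inl rfl, Finset.mem_union_right _ (hRQ ▸ hx)⟩
          · exact ⟨R, .inr ⟨hRQ, hRP, hR⟩, hx⟩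
      · exact ⟨_, .inl rfl, Finset.mem_union_right _ hx⟩
  rw [heq]
  by_cases hQY : Q ∈ Y
  · have hQsub : Q ⊆ Y.biUnion id := Finset.subset_biUnion_of_mem id hQY
    rwa [Finset.union_eq_left.2 hQsub]
  · exact hbad.union (h.conn Q hQ) (h.disjoint_biUnion hY hQ hQY)
      (hPQ.trans_le (cross_mono hsub subset_rfl))

/-- Two adjacent sets which are both avoided by a bad union can be merged. -/
lemma Division.merge (h : Division G D) {P Q : Finset V} (hP : P ∈ D) (hQ : Q ∈ D) (hPQ : P ≠ Q)
    (hc : 0 < cross G P Q) {Y : Finset (Finset V)} (hY : Y ⊆ D) (hPY : P ∉ Y) (hQY : Q ∉ Y)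
    (hbad : Bad G (Y.biUnion id)) : Division G (insert (P ∪ Q) ((D.erase P).erase Q)) := by
  have hne : ∀ {R}, R ∈ D → (G.induce (R : Set V)).Connected := fun hR => h.conn _ hR
  have hsub : ∀ {R}, R ∈ D → (P ⊆ R ∨ Q ⊆ R) → R = P ∨ R = Q := by
    rintro R hR (hs | hs)
    · by_contra! hR'
      exact (nonempty_of_connected (hne hP)).ne_empty
        (Finset.disjoint_self_iff_empty _ |>.1 ((h.disj hP hR hR'.1.symm).mono_right hs))
    · by_contra! hR'
      exact (nonempty_of_connected (hne hQ)).ne_empty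
        (Finset.disjoint_self_iff_empty _ |>.1 ((h.disj hQ hR hR'.2.symm).mono_right hs))
  have hU : P ∪ Q ∉ D := by
    intro hU
    have h1 := h.disj hP hQ hPQ
    rcases hsub hU (.inl Finset.subset_union_left) with h2 | h2
    · exact (nonempty_of_connected (hne hQ)).ne_empty
        (Finset.disjoint_self_iff_empty _ |>.1 (h1.mono_left (h2 ▸ Finset.subset_union_right)))
    · exact (nonempty_of_connected (hne hP)).ne_empty
        (Finset.disjoint_self_iff_empty _ |>.1 (h1.mono_right (h2 ▸ Finset.subset_union_left)))
  have herase : ∀ {Z : Finset (Finset V)}, Z ⊆ D → P ∉ Z → Q ∉ Z →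
      Z ⊆ insert (P ∪ Q) ((D.erase P).erase Q) := fun hZ hPZ hQZ R hR =>
    Finset.mem_insert_of_mem (Finset.mem_erase.2 ⟨fun h => hQZ (h ▸ hR),
      Finset.mem_erase.2 ⟨fun h => hPZ (h ▸ hR), hZ hR⟩⟩)
  refine ⟨fun R hR => ?_, ?_, fun R => ?_⟩
  · rcases Finset.mem_insert.1 hR with rfl | hR
    · exact connected_union (h.conn P hP) (h.conn Q hQ) hc
    · exact h.conn R (Finset.mem_of_mem_erase (Finset.mem_of_mem_erase hR))
  · rw [Finset.coe_insert, Set.pairwiseDisjoint_insert]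
    refine ⟨h.disj.subset fun R hR => Finset.mem_of_mem_erase (Finset.mem_of_mem_erase hR),
      fun R hR _ => ?_⟩
    simp only [Finset.coe_erase, Set.mem_sdiff, Finset.mem_coe, Set.mem_singleton_iff] at hR
    exact Finset.disjoint_union_left.2
      ⟨h.disj hP hR.1.1 (Ne.symm hR.1.2), h.disj hQ hR.1.1 (Ne.symm hR.2)⟩
  · by_cases hRY : R ∉ Y
    · exact ⟨Y, herase hY hPY hQY, hRY, hbad⟩
    rw [not_not] at hRY
    obtain ⟨Z, hZ, hRZ, hbad'⟩ := h.avoid R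
    have hZ' : insert (P ∪ Q) ((Z.erase P).erase Q) ⊆ insert (P ∪ Q) ((D.erase P).erase Q) :=
      Finset.insert_subset_insert _ (Finset.erase_subset_erase _ (Finset.erase_subset_erase _ hZ))
    have hRZ' : R ∉ insert (P ∪ Q) ((Z.erase P).erase Q) := by
      rw [Finset.mem_insert, Finset.mem_erase, Finset.mem_erase]
      rintro (rfl | h)
      · exact hU (hY hRY)
      · exact hRZ h.2.2
    by_cases hPZ : P ∈ Z
    · exact ⟨_, hZ', hRZ', h.bad_insert hZ hPZ hQ hc hbad'⟩
    by_cases hQZ : Q ∈ Z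
    · refine ⟨_, hZ', hRZ', ?_⟩
      rw [Finset.union_comm, Finset.erase_right_comm]
      exact h.bad_insert hZ hQZ hP (cross_comm P Q ▸ hc) hbad'
    · exact ⟨Z, herase hZ hPZ hQZ, hRZ, hbad'⟩

lemma card_merge_lt {P Q : Finset V} (hP : P ∈ D) (hQ : Q ∈ D) (hPQ : P ≠ Q) :
    #(insert (P ∪ Q) ((D.erase P).erase Q)) < #D := by
  have h1 := Finset.card_insert_le (P ∪ Q) ((D.erase P).erase Q)
  have h2 := Finset.card_erase_add_one hP
  have h3 := Finset.card_erase_add_one (Finset.mem_erase.2 ⟨hPQ.symm, hQ⟩)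
  omega

/-- Removing a set of small degree from a bad union. -/
lemma Division.bad_erase (h : Division G D) {Y : Finset (Finset V)} (hY : Y ⊆ D) {P : Finset V}
    (hbad : Bad G (Y.biUnion id)) (hP : ∑ Q ∈ Y, mult G P Q ≤ 1) :
    Bad G ((Y.erase P).biUnion id) := by
  by_cases hPY : P ∈ Y
  · have hsum : dsum (mult G) Y = dsum (mult G) (Y.erase P) + 2 * ∑ Q ∈ Y, mult G P Q := by
      convert dsum_erase mult_comm hPY
    rw [h.bad_iff hY] at hbad
    rw [h.bad_iff ((Finset.erase_subset _ _).trans hY)]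
    have := Finset.card_erase_add_one hPY
    omega
  · rwa [Finset.erase_eq_of_notMem hPY]

lemma Division.erase (h : Division G D) {P : Finset V} (hP : ∑ Q ∈ D, mult G P Q ≤ 1) :
    Division G (D.erase P) := by
  refine ⟨fun R hR => h.conn R (Finset.mem_of_mem_erase hR),
    h.disj.subset fun R hR => Finset.mem_of_mem_erase hR, fun R => ?_⟩
  obtain ⟨Y, hY, hRY, hbad⟩ := h.avoid R
  exact ⟨Y.erase P, Finset.erase_subset_erase _ hY, fun hR => hRY (Finset.mem_of_mem_erase hR),
    h.bad_erase hY hbad ((Finset.sum_le_sum_of_subset hY).trans hP)⟩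

lemma Division.model (h : Division G D) {n : ℕ} {g : ℕ → ℕ → ℕ} {σ : ℕ → Finset V}
    (hσ : Emb D (mult G) n g σ) : Model G n g σ where
  conn i hi := h.conn _ (hσ.mem i hi)
  disj i hi j hj hij := h.disj (hσ.mem i hi) (hσ.mem j hj) (hσ.inj i hi j hj hij)
  edge i hi j hj hij := (hσ.le i hi j hj).trans_eq (mult_of_ne (hσ.inj i hi j hj hij))
  loop i hi := by
    have h1 := hσ.le i hi i hi
    have h2 := two_mul_mult_self (h.conn _ (hσ.mem i hi))
    omega

lemma leafCheck_two_loops : leafCheck forcing 2 (ent 514) 173 16 = true := by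
  decide +kernel

lemma Division.hasObs_of_two_loops (h : Division G D) {P Q : Finset V} (hP : P ∈ D) (hQ : Q ∈ D)
    (hPQ : P ≠ Q) (hP2 : 2 ≤ mult G P P) (hQ2 : 2 ≤ mult G Q Q) : HasObs G := by
  have e00 : ent 514 0 0 = 2 := by decide +kernel
  have e01 : ent 514 0 1 = 0 := by decide +kernel
  have e10 : ent 514 1 0 = 0 := by decide +kernel
  have e11 : ent 514 1 1 = 2 := by decide +kernel
  refine Model.hasObs_of_leafCheck forces_of_mem_forcing
    (h.model (σ := fun i => if i = 0 then P else Q) ⟨?_, ?_, ?_⟩) leafCheck_two_loops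
  · intro i hi
    interval_cases i <;> simpa
  · intro i hi j hj hij
    interval_cases i <;> interval_cases j <;> first | exact absurd rfl hij | simpa using hPQ |
      simpa using hPQ.symm
  · intro i hi j hj
    interval_cases i <;> interval_cases j <;> simp [e00, e01, e10, e11, hP2, hQ2]

lemma Division.tight (h : Division G D) (hno : ¬ HasObs G)
    (hmin : ∀ D', #D' < #D → ¬ Division G D') : Tight D (mult G) := by
  have havoid : ∀ P, ∃ Y ⊆ D, P ∉ Y ∧ Bad G (Y.biUnion id) ∧ 2 * #Y < dsum (mult G) Y := by
    intro P
    obtain ⟨Y, hY, hPY, hbad⟩ := h.avoid P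
    exact ⟨Y, hY, hPY, hbad, (h.bad_iff hY).1 hbad⟩
  have hdeg : ∀ P ∈ D, 2 ≤ ∑ Q ∈ D, mult G P Q := by
    intro P hP
    by_contra! hlt
    exact hmin _ (Finset.card_erase_lt_of_mem hP) (h.erase (by omega))
  have hmerge : ∀ Y ⊆ D, Bad G (Y.biUnion id) → ∀ P ∈ D, P ∉ Y → ∀ Q ∈ D, Q ∉ Y → P ≠ Q →
      mult G P Q = 0 := by
    intro Y hY hbad P hP hPY Q hQ hQY hPQ
    by_contra hpos
    rw [mult_of_ne hPQ] at hpos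
    exact hmin _ (card_merge_lt hP hQ hPQ)
      (h.merge hP hQ hPQ (Nat.pos_of_ne_zero hpos) hY hPY hQY hbad)
  refine ⟨mult_comm, fun P => ?_, fun Y hY hbad => hmerge Y hY ((h.bad_iff hY).2 hbad), hdeg,
    fun P hP h0 => ?_, fun P hP Q hQ hPQ h2 => ?_⟩
  · obtain ⟨Y, hY, hPY, -, hbad⟩ := havoid P
    exact ⟨Y, hY, hPY, hbad⟩
  · by_contra! hlt
    have h2 := hdeg P hP
    obtain ⟨Q, hQ, hPQ⟩ := Finset.exists_ne_zero_of_sum_ne_zero (s := D)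
      (f := fun Q => mult G P Q) (by omega)
    have hne : P ≠ Q := fun h => hPQ (h ▸ h0)
    obtain ⟨Y, hY, hQY, hbad⟩ := h.avoid Q
    refine hPQ (hmerge (Y.erase P) ((Finset.erase_subset _ _).trans hY)
      (h.bad_erase hY hbad ?_) P hP (Finset.notMem_erase _ _) Q hQ
      (fun hQ => hQY (Finset.mem_of_mem_erase hQ)) hne)
    have h3 := Finset.sum_le_sum_of_subset (f := fun R => mult G P R)
      (Finset.insert_subset hQ hY)
    rw [Finset.sum_insert hQY] at h3
    omega
  · by_contra! h2'
    exact hno (h.hasObs_of_two_loops hP hQ hPQ h2 h2')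

lemma ent_zero (i j : ℕ) : ent 0 i j = 0 := by simp [ent, digit]

lemma Tight.hasLeaf {ι : Type} [Inhabited ι] {P : Finset ι} {w : ι → ι → ℕ} (h : Tight P w) :
    HasLeaf forcing P w := by
  obtain ⟨U, hU⟩ := h.exists_isMinBad
  let e := U.equivFin
  let σ : ℕ → ι := fun i => if hi : i < #U then e.symm ⟨i, hi⟩ else default
  have hσ : ∀ i (hi : i < #U), σ i = e.symm ⟨i, hi⟩ := fun i hi => dif_pos hi
  have hmem : ∀ i < #U, σ i ∈ U := fun i hi => hσ i hi ▸ (e.symm ⟨i, hi⟩).2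
  refine dead_root (hU.two_le_card h) (hU.card_le_five h) ι P w U σ h hU rfl
    ⟨⟨fun i hi => hU.sub (hmem i hi), fun i hi j hj hij hσij => hij ?_, fun i _ j _ => ?_⟩, le_rfl,
      fun i hi => ⟨fun _ => hi, hmem i⟩⟩
  · rw [hσ i hi, hσ j hj, Subtype.coe_inj, e.symm.injective.eq_iff, Fin.mk.injEq] at hσij
    exact hσij
  · rw [ent_zero]
    exact Nat.zero_le _

lemma Division.hasObs : ∀ {D : Finset (Finset V)}, Division G D → HasObs G := by
  intro D h
  induction hk : #D using Nat.strong_induction_on generalizing D with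
  | _ k ih =>
    by_contra hno
    have ht := h.tight hno fun D' hD' h' => hno (ih _ (hk ▸ hD') h' rfl)
    obtain ⟨n, g, σ, t, lam, hσ, hc⟩ := ht.hasLeaf
    exact hno ((h.model hσ).hasObs_of_leafCheck forces_of_mem_forcing hc)

theorem hasObs_of_not_apexPseudoforest [Finite V] (h : ¬ ApexPseudoforest G) : HasObs G :=
  (exists_division h).choose_spec.hasObs

end Divisions

lemma obs_of_mem_OList : ∀ H ∈ OList, ObsApexPseudoforest H.2 := by
  simp only [OList, List.forall_mem_cons]
  exact ⟨obs_O1, obs_O2, obs_O3, obs_O4, obs_O5, obs_O6, obs_O7, obs_O8, obs_O9, obs_O10, obs_O11,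
    obs_O12, obs_O13, obs_O14, obs_O15, obs_O16, obs_O17, obs_O18, obs_O19, obs_O20, obs_O21,
    obs_O22, obs_O23, obs_O24, obs_O25, obs_O26, obs_O27, obs_O28, obs_O29, obs_O30, obs_O31,
    obs_O32, obs_O33, by simp⟩

end ApexObstruction

/-- The minor-obstruction set of the class of apex-pseudoforests is exactly the list `O`
of 33 graphs; consequently a graph is an apex-pseudoforest iff it contains none of the
33 graphs of `O` as a minor. -/
theorem obstructions_of_apexPseudoforest :
    (∀ (V : Type) [Finite V] (G : SimpleGraph V), ObsApexPseudoforest G ↔ InO G) ∧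
    (∀ (V : Type) [Finite V] (G : SimpleGraph V),
      ApexPseudoforest G ↔ ∀ H ∈ OList, ¬ IsMinorOf H.2 G) := by
  have hobs := ApexObstruction.obs_of_mem_OList
  constructor
  · refine fun V _ G => ⟨fun hG => ?_, fun ⟨H, hH, ⟨e⟩⟩ =>
      ApexObstruction.ObsApexPseudoforest.of_iso e (hobs H hH)⟩
    obtain ⟨H, hH, hHG⟩ := ApexObstruction.hasObs_of_not_apexPseudoforest hG.1
    refine ⟨H, hH, not_isEmpty_iff.1 fun he => (hobs H hH).1 (hG.2 _ H.2 hHG ⟨fun e => ?_⟩)⟩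
    exact he.false e.symm
  · refine fun V _ G => ⟨fun hG H hH hHG =>
      (hobs H hH).1 (ApexObstruction.ApexPseudoforest.of_isMinorOf hHG hG), fun h => ?_⟩
    by_contra hG
    obtain ⟨H, hH, hHG⟩ := ApexObstruction.hasObs_of_not_apexPseudoforest hG
    exact h H hH hHG
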